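/- For all 0 ≤ r,s ≤ n with Â_{rs} = −1 (that is, r − s ≡ ±1 (mod n+1)) and all k, m, n ∈ ℤ^{N+1}, the Serre relations hold as operators on V: [ρ(E_r)_k, [ρ(E_r)_m, ρ(E_s)_n]] = 0 and [ρ(F_r)_k, [ρ(F_r)_m, ρ(F_s)_n]] = 0. -/

import Mathlib

noncomputable section

namespace Stmt16

/-- Multi-indices `m ∈ ℤ^{N+1}`. -/
abbrev MM (N : ℕ) := Fin (N + 1) → ℤ

/-- Index type for the polynomial variables `x_{ij}(m)`, `1 ≤ i < j ≤ n+1`. -/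
def XIdx (n N : ℕ) := {ij : ℕ × ℕ // 1 ≤ ij.1 ∧ ij.1 < ij.2 ∧ ij.2 ≤ n + 1} × MM N

/-- Index type for the polynomial variables `y_i(k)`, `1 ≤ i ≤ n`, `k > 0`. -/
def YIdx (n N : ℕ) (pos : MM N → Prop) :=
  {i : ℕ // 1 ≤ i ∧ i ≤ n} × {k : MM N // pos k}

/-- The Fock space `V = ℂ[x] ⊗ ℂ[y]`, realized as the polynomial ring in the
two (disjoint) families of variables. -/
abbrev Fock (n N : ℕ) (pos : MM N → Prop) :=
  MvPolynomial (XIdx n N ⊕ YIdx n N pos) ℂ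

/-- `a_{ij,m}`: multiplication by `-x_{ij}(m)` (and `0` for out-of-range indices). -/
def aop (n N : ℕ) (pos : MM N → Prop) (i j : ℕ) (m : MM N) :
    Fock n N pos → Fock n N pos := fun w =>
  if h : 1 ≤ i ∧ i < j ∧ j ≤ n + 1 then
    -(MvPolynomial.X (Sum.inl ((⟨(i, j), h⟩, m) : XIdx n N)) : Fock n N pos) * w
  else 0

/-- `a*_{ij,m}`: the partial derivative `∂/∂x_{ij}(-m)` (and `0` for
out-of-range indices). -/
def astar (n N : ℕ) (pos : MM N → Prop) (i j : ℕ) (m : MM N) :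
    Fock n N pos → Fock n N pos := fun w =>
  if h : 1 ≤ i ∧ i < j ∧ j ≤ n + 1 then
    MvPolynomial.pderiv (Sum.inl ((⟨(i, j), h⟩, -m) : XIdx n N)) w
  else 0

/-- `(κ·D a*_{ij})_v := Σ_{q ∈ ℤ^{N+1}} Σ_{p=0}^N κ_{q-v,p}(-q_p) a*_{ij,q}`,
a pointwise locally finite sum of operators. -/
def kD (n N : ℕ) (pos : MM N → Prop) (kappa : MM N → Fin (N + 1) → ℂ)
    (i j : ℕ) (v : MM N) : Fock n N pos → Fock n N pos := fun w =>
  ∑ᶠ q : MM N,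
    (∑ p : Fin (N + 1), kappa (q - v) p * (-(q p : ℂ))) • astar n N pos i j q w

open Classical in
/-- `θ(m) = 1` if `m > 0` and `0` otherwise. -/
def theta {N : ℕ} (pos : MM N → Prop) (m : MM N) : ℂ := if pos m then 1 else 0

open Classical in
/-- `∂/∂y_i(s)`, with the convention that it is `0` unless `1 ≤ i ≤ n` and `s > 0`. -/
def ydot (n N : ℕ) (pos : MM N → Prop) (i : ℕ) (s : MM N) :
    Fock n N pos → Fock n N pos := fun w =>
  if h : (1 ≤ i ∧ i ≤ n) ∧ pos s then
    MvPolynomial.pderiv (Sum.inr ((⟨i, h.1⟩, ⟨s, h.2⟩) : YIdx n N pos)) w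
  else 0

/-- `Σ_{p=0}^N m_p κ_{-m+s,p}`. -/
def cnum {N : ℕ} (kappa : MM N → Fin (N + 1) → ℂ) (m s : MM N) : ℂ :=
  ∑ p : Fin (N + 1), (m p : ℂ) * kappa (-m + s) p

open Classical in
/-- The operator `Φ(b_i(m))` (for `1 ≤ i ≤ n`), acting on `V`. -/
def Phi (n N : ℕ) (pos : MM N → Prop) (kappa : MM N → Fin (N + 1) → ℂ)
    (lam : ℕ → ℂ) (i : ℕ) (m : MM N) : Fock n N pos → Fock n N pos := fun w =>
  theta pos (-m) • (∑ᶠ s : MM N, cnum kappa m s •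
      (ydot n N pos (i - 1) s w - ydot n N pos i s w))
  + theta pos m • (∑ᶠ s : MM N, cnum kappa m s •
      (ydot n N pos (i - 1) s w - (2 : ℂ) • ydot n N pos i s w
        + ydot n N pos (i + 1) s w))
  + (if h : (1 ≤ i ∧ i ≤ n) ∧ pos (-m) then
      (MvPolynomial.X (Sum.inr ((⟨i, h.1⟩, ⟨-m, h.2⟩) : YIdx n N pos)) :
          Fock n N pos) * w
    else 0)
  - (if m = 0 then lam i else 0) • w

/-- `Φ(b_0(m)) := -Σ_{i=1}^n Φ(b_i(m))`, and `Φ(b_i(m))` for `1 ≤ i ≤ n`. -/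
def PhiHat (n N : ℕ) (pos : MM N → Prop) (kappa : MM N → Fin (N + 1) → ℂ)
    (lam : ℕ → ℂ) (i : ℕ) (m : MM N) : Fock n N pos → Fock n N pos :=
  if i = 0 then -(∑ r ∈ Finset.Icc 1 n, Phi n N pos kappa lam r m)
  else Phi n N pos kappa lam i m

/-- The `m`-th mode of the product of two families of operators:
`(XY)_m := Σ_{k+l=m} X_k Y_l` (pointwise locally finite sum). -/
def fmul (n N : ℕ) (pos : MM N → Prop)
    (X Y : MM N → Fock n N pos → Fock n N pos) :
    MM N → Fock n N pos → Fock n N pos :=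
  fun m w => ∑ᶠ k : MM N, X k (Y (m - k) w)

/-- Modewise product of a finite list of families of operators; the empty
product is the identity family (the delta family supported at `0`). -/
def fprod (n N : ℕ) (pos : MM N → Prop) :
    List (MM N → Fock n N pos → Fock n N pos) →
      MM N → Fock n N pos → Fock n N pos
  | [] => fun m w => if m = 0 then w else 0
  | X :: L => fmul n N pos X (fprod n N pos L)

/-- The affine Cartan matrix of type `A_n^{(1)}` (indices `0 ≤ i, j ≤ n`), as an
integer matrix. -/
def AcarZ (n i j : ℕ) : ℤ :=
  if i = j then 2
  else if (i + 1) % (n + 1) = j % (n + 1) ∨ (j + 1) % (n + 1) = i % (n + 1) then -1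
  else 0

/-- The affine Cartan matrix of type `A_n^{(1)}`, with complex entries. -/
def Acar (n i j : ℕ) : ℂ := (AcarZ n i j : ℂ)

/-- `ρ(F_r)_m` for `1 ≤ r ≤ n`. -/
def rhoF (n N : ℕ) (pos : MM N → Prop) (r : ℕ) (m : MM N) :
    Fock n N pos → Fock n N pos :=
  aop n N pos r (r + 1) m
    - ∑ j ∈ Finset.Ico 1 r, fmul n N pos (aop n N pos j (r + 1)) (astar n N pos j r) m

/-- `ρ(H_r)_m` for `1 ≤ r ≤ n`. -/
def rhoHn (n N : ℕ) (pos : MM N → Prop) (kappa : MM N → Fin (N + 1) → ℂ)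
    (lam : ℕ → ℂ) (r : ℕ) (m : MM N) : Fock n N pos → Fock n N pos :=
  (2 : ℂ) • fmul n N pos (aop n N pos r (r + 1)) (astar n N pos r (r + 1)) m
  + ∑ i ∈ Finset.Ico 1 r,
      (fmul n N pos (aop n N pos i (r + 1)) (astar n N pos i (r + 1)) m
        - fmul n N pos (aop n N pos i r) (astar n N pos i r) m)
  + ∑ j ∈ Finset.Icc (r + 2) (n + 1),
      (fmul n N pos (aop n N pos r j) (astar n N pos r j) m
        - fmul n N pos (aop n N pos (r + 1) j) (astar n N pos (r + 1) j) m)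
  + Phi n N pos kappa lam r m

/-- `ρ(H_r)_m` for `0 ≤ r ≤ n`, with `ρ(H_0)_m := -Σ_{r=1}^n ρ(H_r)_m`. -/
def rhoH (n N : ℕ) (pos : MM N → Prop) (kappa : MM N → Fin (N + 1) → ℂ)
    (lam : ℕ → ℂ) (r : ℕ) (m : MM N) : Fock n N pos → Fock n N pos :=
  if r = 0 then -(∑ s ∈ Finset.Icc 1 n, rhoHn n N pos kappa lam s m)
  else rhoHn n N pos kappa lam r m

/-- `ρ(E_r)_m` for `1 ≤ r ≤ n`. -/
def rhoEn (n N : ℕ) (pos : MM N → Prop) (kappa : MM N → Fin (N + 1) → ℂ)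
    (lam : ℕ → ℂ) (r : ℕ) (m : MM N) : Fock n N pos → Fock n N pos :=
  fmul n N pos (aop n N pos r (r + 1))
      (fmul n N pos (astar n N pos r (r + 1)) (astar n N pos r (r + 1))) m
  - ∑ j ∈ Finset.Icc (r + 2) (n + 1),
      fmul n N pos (aop n N pos (r + 1) j) (astar n N pos r j) m
  + ∑ j ∈ Finset.Ico 1 r,
      fmul n N pos (aop n N pos j r) (astar n N pos j (r + 1)) m
  + ∑ j ∈ Finset.Icc (r + 2) (n + 1),
      (fmul n N pos (fmul n N pos (aop n N pos r j) (astar n N pos r j))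
          (astar n N pos r (r + 1)) m
        - fmul n N pos (fmul n N pos (aop n N pos (r + 1) j) (astar n N pos (r + 1) j))
            (astar n N pos r (r + 1)) m)
  + fmul n N pos (astar n N pos r (r + 1)) (Phi n N pos kappa lam r) m
  + kD n N pos kappa r (r + 1) m

/-- `ρ(E_r)_m` for `0 ≤ r ≤ n`, with `ρ(E_0)_m := -a_{1,n+1;m}`. -/
def rhoE (n N : ℕ) (pos : MM N → Prop) (kappa : MM N → Fin (N + 1) → ℂ)
    (lam : ℕ → ℂ) (r : ℕ) (m : MM N) : Fock n N pos → Fock n N pos :=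
  if r = 0 then -(aop n N pos 1 (n + 1) m) else rhoEn n N pos kappa lam r m

/-- The strictly increasing sequence `1 = q_1 < q_2 < ⋯ < q_i` encoded by a
subset `s ⊆ {2,…,n+1}`, as the sorted list `1 :: sort s`. -/
def ql (s : Finset ℕ) : List ℕ := 1 :: s.sort (· ≤ ·)

/-- The last entry `q_i` of the sequence encoded by `s`. -/
def qend (s : Finset ℕ) : ℕ := ((ql s).getLast?).getD 0

/-- The second-to-last entry `q_{i-1}` of the sequence encoded by `s`
(`0` if the sequence has length `1`, so that the condition `q_{i-1} ≤ r` is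
vacuous in that case). -/
def qpen (s : Finset ℕ) : ℕ := (((ql s).dropLast).getLast?).getD 0

/-- The list of adjacent pairs `(q_l, q_{l+1})` of a list. -/
def qpairs (l : List ℕ) : List (ℕ × ℕ) := l.zip l.tail

/-- `ρ(F_0)_m`. -/
def rhoF0 (n N : ℕ) (pos : MM N → Prop) (kappa : MM N → Fin (N + 1) → ℂ)
    (lam : ℕ → ℂ) (m : MM N) : Fock n N pos → Fock n N pos :=
  -(∑ r ∈ Finset.Icc 1 (n + 1), ∑ j ∈ Finset.Icc 1 (n + 1),
      ∑ s ∈ (Finset.Icc 2 (n + 1)).powerset,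
        if r < j ∧ qend s = j ∧ qpen s ≤ r then
          fprod n N pos
            (aop n N pos r j ::
              ((qpairs (ql s)).map fun p => astar n N pos p.1 p.2)
                ++ [astar n N pos r (n + 1)]) m
        else 0)
  - (∑ r ∈ Finset.Icc 1 n, ∑ s ∈ (Finset.Icc 2 (n + 1)).powerset,
      if qend s ≤ r then
        fprod n N pos
          (((qpairs (ql s ++ [n + 1])).map fun p => astar n N pos p.1 p.2)
            ++ [Phi n N pos kappa lam r]) m
      else 0)
  - (∑ r ∈ Finset.Icc 1 n, ∑ s ∈ (Finset.Icc 2 (n + 1)).powerset,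
      if qend s = r then
        fprod n N pos
          (((qpairs (ql s)).map fun p => astar n N pos p.1 p.2)
            ++ [kD n N pos kappa r (n + 1)]) m
      else 0)

/-- `ρ(F_r)_m` for `0 ≤ r ≤ n`. -/
def rhoFa (n N : ℕ) (pos : MM N → Prop) (kappa : MM N → Fin (N + 1) → ℂ)
    (lam : ℕ → ℂ) (r : ℕ) (m : MM N) : Fock n N pos → Fock n N pos :=
  if r = 0 then rhoF0 n N pos kappa lam m else rhoF n N pos r m

/-- The commutator of two operators. -/
def comm {V : Type*} [AddCommGroup V] (f g : V → V) : V → V :=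
  fun w => f (g w) - g (f w)

section Loop

set_option linter.unusedSectionVars false

variable {G V : Type*} [AddCommGroup G] [AddCommGroup V] [Module ℂ V]

/-- The operators on `V[t^±] = G →₀ V`. -/
abbrev LoopEnd (G V : Type*) [AddCommGroup V] [Module ℂ V] := Module.End ℂ (G →₀ V)

/-- Multiplication by the Laurent monomial `t ^ k` on `V[t^±] = G →₀ V`. -/
def shift (k : G) : Module.End ℂ (G →₀ V) := Finsupp.lmapDomain V ℂ (fun l => k + l)

/-- The inclusion of `V` as the constant Laurent polynomials. -/
def incl : V →ₗ[ℂ] (G →₀ V) := Finsupp.lsingle 0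

/-- The coefficientwise extension of an operator on `V` to Laurent polynomials. -/
def cw (φ : Module.End ℂ V) : Module.End ℂ (G →₀ V) := Finsupp.mapRange.linearMap φ

/-- The pairing `v t^l ↦ P_{-l} v` of a family of operators with Laurent polynomials. -/
def pair (P : G → Module.End ℂ V) : (G →₀ V) →ₗ[ℂ] V := Finsupp.lsum ℂ fun l => P (-l)

/-- The modes of an operator on Laurent polynomials. -/
def mode (f : Module.End ℂ (G →₀ V)) (l : G) : Module.End ℂ V :=
  Finsupp.lapply l ∘ₗ f ∘ₗ incl

/-- The degree derivation `v t^l ↦ d(l) v t^l`. -/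
def degOp (d : G →+ ℂ) : Module.End ℂ (G →₀ V) :=
  Finsupp.lsum ℂ fun l => d l • Finsupp.lsingle l

/-- Operators that are linear over the Laurent polynomials. -/
def IsLoop (f : Module.End ℂ (G →₀ V)) : Prop := ∀ k, Commute (shift k) f

@[simp] lemma shift_single (k l : G) (v : V) :
    shift k (Finsupp.single l v) = Finsupp.single (k + l) v := by
  simp [shift]

@[simp] lemma cw_single (φ : Module.End ℂ V) (l : G) (v : V) :
    cw φ (Finsupp.single l v) = Finsupp.single l (φ v) := by
  simp [cw]

@[simp] lemma cw_apply (φ : Module.End ℂ V) (u : G →₀ V) (l : G) : cw φ u l = φ (u l) := by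
  simp [cw]

@[simp] lemma pair_single (P : G → Module.End ℂ V) (l : G) (v : V) :
    pair P (Finsupp.single l v) = P (-l) v := by
  simp [pair]

@[simp] lemma degOp_single (d : G →+ ℂ) (l : G) (v : V) :
    degOp d (Finsupp.single l v) = Finsupp.single l (d l • v) := by
  simp [degOp]

lemma incl_apply (v : V) : (incl v : G →₀ V) = Finsupp.single 0 v := rfl

lemma mode_apply (f : Module.End ℂ (G →₀ V)) (l : G) (v : V) :
    mode f l v = f (incl v) l := rfl

lemma pair_eq_sum (P : G → Module.End ℂ V) (u : G →₀ V) :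
    pair P u = ∑ l ∈ u.support, P (-l) (u l) := by
  simp [pair, Finsupp.sum]

lemma loop_hom_ext {M : Type*} [AddCommGroup M] [Module ℂ M] {f g : (G →₀ V) →ₗ[ℂ] M}
    (h : ∀ l v, f (Finsupp.single l v) = g (Finsupp.single l v)) : f = g :=
  Finsupp.lhom_ext h

lemma cw_mul (φ ψ : Module.End ℂ V) : (cw (φ * ψ) : Module.End ℂ (G →₀ V)) = cw φ * cw ψ :=
  loop_hom_ext fun l v => by simp

lemma cw_sub (φ ψ : Module.End ℂ V) : (cw (φ - ψ) : Module.End ℂ (G →₀ V)) = cw φ - cw ψ :=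
  loop_hom_ext fun l v => by simp

lemma cw_sum {ι : Type*} (s : Finset ι) (φ : ι → Module.End ℂ V) :
    (cw (∑ i ∈ s, φ i) : Module.End ℂ (G →₀ V)) = ∑ i ∈ s, cw (φ i) :=
  loop_hom_ext fun l v => by simp [LinearMap.sum_apply, Finsupp.single_finsetSum]

lemma cw_incl (φ : Module.End ℂ V) (v : V) : cw φ (incl v : G →₀ V) = incl (φ v) := by
  simp [incl_apply]

lemma shift_mul (k m : G) : (shift k * shift m : Module.End ℂ (G →₀ V)) = shift (k + m) :=
  loop_hom_ext fun l v => by simp [add_assoc]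

lemma shift_zero : (shift 0 : Module.End ℂ (G →₀ V)) = 1 :=
  loop_hom_ext fun l v => by simp

lemma isLoop_shift (k : G) : IsLoop (shift k : Module.End ℂ (G →₀ V)) := fun m => by
  rw [Commute, SemiconjBy, shift_mul, shift_mul, add_comm]

lemma isLoop_cw (φ : Module.End ℂ V) : IsLoop (cw φ : Module.End ℂ (G →₀ V)) := fun k =>
  loop_hom_ext fun l v => by simp

lemma degOp_commute_cw (d : G →+ ℂ) (φ : Module.End ℂ V) :
    Commute (degOp d : Module.End ℂ (G →₀ V)) (cw φ) :=
  loop_hom_ext fun l v => by simp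

lemma degOp_shift (d : G →+ ℂ) (k : G) :
    ⁅(degOp d : Module.End ℂ (G →₀ V)), (shift k : Module.End ℂ (G →₀ V))⁆ = d k • shift k :=
  loop_hom_ext fun l v => by
    simp [Ring.lie_def, ← Finsupp.single_sub, ← sub_smul]

lemma degOp_incl (d : G →+ ℂ) (v : V) : degOp d (incl v : G →₀ V) = 0 := by
  simp [incl_apply]

lemma IsLoop.map_single {f : Module.End ℂ (G →₀ V)} (hf : IsLoop f) (l : G) (v : V) :
    f (Finsupp.single l v) = shift l (f (incl v)) := by
  have h := LinearMap.congr_fun (hf l) (incl v)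
  simp only [Module.End.mul_apply, incl_apply, shift_single, add_zero] at h
  rw [incl_apply, h]

lemma shift_apply (k : G) (u : G →₀ V) (l : G) : shift k u l = u (l - k) := by
  induction u using Finsupp.induction_linear with
  | zero => simp
  | add f g hf hg => simp [hf, hg]
  | single a v =>
    classical
    simp only [shift_single, Finsupp.single_apply]
    congr 1
    rw [eq_sub_iff_add_eq', eq_iff_iff]

lemma IsLoop.ext {f g : Module.End ℂ (G →₀ V)} (hf : IsLoop f) (hg : IsLoop g)
    (h : ∀ l, mode f l = mode g l) : f = g := by
  refine loop_hom_ext fun l v => ?_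
  rw [hf.map_single, hg.map_single]
  congr 1
  ext k
  exact LinearMap.congr_fun (h k) v

lemma IsLoop.apply_eq_sum {f : Module.End ℂ (G →₀ V)} (hf : IsLoop f) (u : G →₀ V) (m : G) :
    f u m = ∑ l ∈ u.support, mode f (m - l) (u l) := by
  conv_lhs => rw [← u.sum_single, Finsupp.sum, map_sum, Finsupp.finsetSum_apply]
  refine Finset.sum_congr rfl fun l _ => ?_
  rw [hf.map_single, shift_apply, mode_apply]

/-- A locally finite family of operators, as an operator on Laurent polynomials. -/
def field (X : G → Module.End ℂ V) (hX : ∀ w, {k | X k w ≠ 0}.Finite) :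
    Module.End ℂ (G →₀ V) :=
  Finsupp.lsum ℂ fun l => shift l ∘ₗ
    { toFun := fun w => Finsupp.ofSupportFinite (fun k => X k w) (hX w)
      map_add' := fun v w => by ext k; exact map_add (X k) v w
      map_smul' := fun c w => by ext k; exact map_smul (X k) c w }

lemma isLoop_field (X : G → Module.End ℂ V) (hX : ∀ w, {k | X k w ≠ 0}.Finite) :
    IsLoop (field X hX) := fun k => loop_hom_ext fun l v => by
  simp only [field, Module.End.mul_apply, shift_single, Finsupp.lsum_single,
    LinearMap.comp_apply]
  rw [← shift_mul]
  rfl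

lemma mode_field (X : G → Module.End ℂ V) (hX : ∀ w, {k | X k w ≠ 0}.Finite) (l : G) :
    mode (field X hX) l = X l := by
  ext w
  simp only [mode_apply, field, incl_apply, Finsupp.lsum_single, LinearMap.comp_apply]
  rw [shift_zero]
  rfl

lemma mode_zero (l : G) : mode (0 : Module.End ℂ (G →₀ V)) l = 0 := rfl

lemma mode_neg (f : Module.End ℂ (G →₀ V)) (l : G) : mode (-f) l = -mode f l := by
  ext; simp [mode_apply]

lemma commute_cw_iff {f : Module.End ℂ (G →₀ V)} (hf : IsLoop f) (φ : Module.End ℂ V) :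
    Commute f (cw φ) ↔ ∀ l, Commute (mode f l) φ := by
  constructor
  · intro h l
    ext w
    have h1 := DFunLike.congr_fun (LinearMap.congr_fun h (incl w)) l
    simpa [Module.End.mul_apply, cw_incl, mode_apply] using h1
  · intro h
    refine loop_hom_ext fun l v => ?_
    simp only [Module.End.mul_apply, cw_single, hf.map_single]
    ext k
    have := LinearMap.congr_fun (h (k - l)) v
    simpa [shift_apply, mode_apply] using this

lemma IsLoop.lie_cw {f g : Module.End ℂ (G →₀ V)} (hf : IsLoop f) (hg : IsLoop g)
    (φ : Module.End ℂ V) (h : ∀ l, ⁅mode f l, φ⁆ = mode g l) : ⁅f, cw φ⁆ = g := by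
  refine IsLoop.ext (fun k => ?_) hg fun l => ?_
  · rw [Ring.lie_def]
    exact ((hf k).mul_right (isLoop_cw φ k)).sub_right ((isLoop_cw φ k).mul_right (hf k))
  · rw [← h]
    ext w
    simp [mode_apply, Ring.lie_def, cw_incl]

/-- The algebra of operators on Laurent polynomials generated, in the completed sense, by the
operators on `V` in `S`. -/
def loopAlg (S : Set (Module.End ℂ V)) : Subalgebra ℂ (Module.End ℂ (G →₀ V)) :=
  Subalgebra.centralizer ℂ (Set.range shift ∪ cw '' {ψ | ∀ d ∈ S, Commute d ψ})

lemma mem_loopAlg {S : Set (Module.End ℂ V)} {f : Module.End ℂ (G →₀ V)} :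
    f ∈ loopAlg S ↔ IsLoop f ∧ ∀ ψ : Module.End ℂ V, (∀ d ∈ S, Commute d ψ) → Commute f (cw ψ) := by
  rw [loopAlg, Subalgebra.mem_centralizer_iff]
  constructor
  · intro h
    exact ⟨fun k => h _ (Or.inl ⟨k, rfl⟩),
      fun ψ hψ => (h _ (Or.inr ⟨ψ, hψ, rfl⟩) : Commute _ _).symm⟩
  · rintro ⟨h1, h2⟩ g (⟨k, rfl⟩ | ⟨ψ, hψ, rfl⟩)
    · exact h1 k
    · exact (h2 ψ hψ).symm

lemma shift_mem_loopAlg (S : Set (Module.End ℂ V)) (k : G) : shift k ∈ loopAlg (G := G) S :=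
  mem_loopAlg.2 ⟨isLoop_shift k, fun ψ _ => isLoop_cw ψ k⟩

lemma mem_loopAlg_of_mode {S : Set (Module.End ℂ V)} {f : Module.End ℂ (G →₀ V)} (hf : IsLoop f)
    (h : ∀ l, mode f l ∈ S) : f ∈ loopAlg S :=
  mem_loopAlg.2 ⟨hf, fun ψ hψ => (commute_cw_iff hf ψ).2 fun l => hψ _ (h l)⟩

lemma commute_cw_of_mem {S : Set (Module.End ℂ V)} {f : Module.End ℂ (G →₀ V)}
    (hf : f ∈ loopAlg S) {ψ : Module.End ℂ V} (h : ∀ d ∈ S, Commute d ψ) : Commute f (cw ψ) :=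
  (mem_loopAlg.1 hf).2 ψ h

lemma mode_commute_mode {S : Set (Module.End ℂ V)} (hS : ∀ a ∈ S, ∀ b ∈ S, Commute a b)
    {f g : Module.End ℂ (G →₀ V)} (hf : f ∈ loopAlg S) (hg : g ∈ loopAlg S) (l l' : G) :
    Commute (mode f l) (mode g l') := by
  refine (commute_cw_iff (mem_loopAlg.1 hf).1 _).1 (commute_cw_of_mem hf fun d hd => ?_) l
  exact ((commute_cw_iff (mem_loopAlg.1 hg).1 _).1
    (commute_cw_of_mem hg fun e he => hS e he d hd) l').symm

lemma commute_of_mem_loopAlg {S : Set (Module.End ℂ V)} (hS : ∀ a ∈ S, ∀ b ∈ S, Commute a b)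
    {f g : Module.End ℂ (G →₀ V)} (hf : f ∈ loopAlg S) (hg : g ∈ loopAlg S) : Commute f g := by
  have lf := (mem_loopAlg.1 hf).1
  have lg := (mem_loopAlg.1 hg).1
  refine IsLoop.ext (fun k => (lf k).mul_right (lg k)) (fun k => (lg k).mul_right (lf k))
    fun m => ?_
  ext w
  simp only [mode_apply, Module.End.mul_apply]
  have key : ∀ l, cw (mode g l) (f (incl w)) = f (incl (mode g l w)) := fun l => by
    have := (commute_cw_iff lf (mode g l)).2 fun l' => mode_commute_mode hS hf hg l' l
    rw [← cw_incl]
    exact (LinearMap.congr_fun this (incl w)).symm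
  rw [lf.apply_eq_sum, lg.apply_eq_sum]
  have e1 : ∀ l ∈ (g (incl w)).support, mode f (m - l) (g (incl w) l)
      = mode g l (f (incl w) (m - l)) := fun l _ => by
    exact LinearMap.congr_fun (mode_commute_mode hS hf hg (m - l) l) w
  rw [Finset.sum_congr rfl e1]
  refine Finset.sum_bij_ne_zero (fun l _ _ => m - l) ?_ ?_ ?_ ?_
  · intro l _ h
    rw [Finsupp.mem_support_iff]
    intro h0
    exact h (by rw [h0, map_zero])
  · intro a _ _ b _ _ h
    exact sub_right_injective h
  · intro b _ h
    refine ⟨m - b, ?_, ?_, by simp⟩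
    · rw [Finsupp.mem_support_iff]
      intro h0
      refine h ?_
      have := LinearMap.congr_fun (mode_commute_mode hS hf hg b (m - b)) w
      simp only [Module.End.mul_apply, mode_apply] at this
      rw [mode_apply, ← this, h0]
      simp
    · rwa [sub_sub_cancel]
  · intro l _ _
    rw [sub_sub_cancel]

lemma lie_degOp_mem {S : Set (Module.End ℂ V)} {f : Module.End ℂ (G →₀ V)}
    (hf : f ∈ loopAlg S) (d : G →+ ℂ) : ⁅(degOp d : Module.End ℂ (G →₀ V)), f⁆ ∈ loopAlg S := by
  obtain ⟨h1, h2⟩ := mem_loopAlg.1 hf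
  refine mem_loopAlg.2 ⟨fun k => ?_, fun ψ hψ => ?_⟩
  · have e : (shift k : Module.End ℂ (G →₀ V)) * degOp d = degOp d * shift k - d k • shift k := by
      rw [← degOp_shift, Ring.lie_def]; abel
    have hk : shift k * f = f * shift k := h1 k
    have e' : (degOp d : Module.End ℂ (G →₀ V)) * shift k = shift k * degOp d + d k • shift k := by
      rw [e]; abel
    rw [Ring.lie_def, Commute, SemiconjBy, mul_sub, sub_mul, ← mul_assoc, e, sub_mul, mul_assoc,
      hk, mul_assoc f, e', mul_add, ← mul_assoc (shift k), hk]
    simp only [smul_mul_assoc, mul_smul_comm, hk, mul_assoc]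
    abel
  · rw [Ring.lie_def]
    exact ((degOp_commute_cw d ψ).mul_left (h2 ψ hψ)).sub_left
      ((h2 ψ hψ).mul_left (degOp_commute_cw d ψ))

lemma mode_lie_degOp (d : G →+ ℂ) (f : Module.End ℂ (G →₀ V)) (l : G) :
    mode ⁅(degOp d : Module.End ℂ (G →₀ V)), f⁆ l = d l • mode f l := by
  have key : ∀ u : G →₀ V, degOp d u l = d l • u l := fun u => by
    induction u using Finsupp.induction_linear with
    | zero => simp
    | add f g hf hg => simp [hf, hg]
    | single a v =>
      classical
      simp only [degOp_single, Finsupp.single_apply]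
      split_ifs with h <;> simp [h]
  ext w
  simp [mode_apply, Ring.lie_def, degOp_incl, key]

end Loop

section Swap

set_option linter.unusedSectionVars false

variable {G V : Type*} [AddCommGroup G] [AddCommGroup V] [Module ℂ V]

/-- The family of scalar operators attached to a functional on Laurent polynomials. -/
def scal (κ : G → ℂ) : G → Module.End ℂ V := fun l => κ (-l) • 1

lemma pair_eq_sum_of_subset (P : G → Module.End ℂ V) {u : G →₀ V} {s : Finset G}
    (h : u.support ⊆ s) : pair P u = ∑ l ∈ s, P (-l) (u l) := by
  rw [pair_eq_sum]
  refine Finset.sum_subset h fun l _ hl => ?_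
  rw [Finsupp.notMem_support_iff.1 hl, map_zero]

lemma support_subset_of_commute {f : Module.End ℂ (G →₀ V)} {φ : Module.End ℂ V}
    (h : ∀ l, Commute (mode f l) φ) (w : V) :
    (f (incl (φ w))).support ⊆ (f (incl w)).support := by
  intro l hl
  rw [Finsupp.mem_support_iff] at hl ⊢
  intro h0
  refine hl ?_
  have := LinearMap.congr_fun (h l) w
  simp only [Module.End.mul_apply, mode_apply, h0, map_zero] at this
  exact this

variable {S : Set (Module.End ℂ V)} (hS : ∀ a ∈ S, ∀ b ∈ S, Commute a b)

include hS

lemma pair_cw_pair (P Q : G → Module.End ℂ V) {f g : Module.End ℂ (G →₀ V)}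
    (hf : f ∈ loopAlg S) (hg : g ∈ loopAlg S) (w : V) :
    pair P (cw (pair Q ∘ₗ g ∘ₗ incl) (f (incl w)))
      = ∑ l ∈ (f (incl w)).support, ∑ l' ∈ (g (incl w)).support,
          P (-l) (Q (-l') (mode g l' (mode f l w))) := by
  rw [pair_eq_sum_of_subset (s := (f (incl w)).support)]
  · refine Finset.sum_congr rfl fun l _ => ?_
    rw [cw_apply, LinearMap.comp_apply, LinearMap.comp_apply, ← mode_apply f,
      pair_eq_sum_of_subset (s := (g (incl w)).support), map_sum]
    · rfl
    · exact support_subset_of_commute (fun l' => mode_commute_mode hS hg hf l' l) w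
  · intro l hl
    rw [Finsupp.mem_support_iff] at hl ⊢
    intro h0
    exact hl (by rw [cw_apply, h0, map_zero])

lemma pair_scal_mul (κ : G → ℂ) (d : G →+ ℂ) {f g : Module.End ℂ (G →₀ V)}
    (hf : f ∈ loopAlg S) (hg : g ∈ loopAlg S) (w : V) :
    pair (scal κ) ((⁅(degOp d : Module.End ℂ (G →₀ V)), f⁆ * g) (incl w))
      = ∑ l ∈ (f (incl w)).support, ∑ l' ∈ (g (incl w)).support,
          (κ (l + l') * d l) • mode g l' (mode f l w) := by
  have hF := lie_degOp_mem hf d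
  set F := ⁅(degOp d : Module.End ℂ (G →₀ V)), f⁆ with hFdef
  rw [Module.End.mul_apply]
  conv_lhs => rw [← (g (incl w)).sum_single, Finsupp.sum, map_sum, map_sum]
  rw [Finset.sum_comm]
  refine Finset.sum_congr rfl fun l' _ => ?_
  rw [(mem_loopAlg.1 hF).1.map_single, ← mode_apply g]
  have key : ∀ u : G →₀ V, pair (scal κ) (shift l' u) = pair (scal fun l => κ (l + l')) u :=
    fun u => by
      induction u using Finsupp.induction_linear with
      | zero => simp
      | add f g hf hg => simp [hf, hg]
      | single a v => simp [scal, add_comm]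
  rw [key, pair_eq_sum_of_subset (s := (f (incl w)).support)]
  · refine Finset.sum_congr rfl fun l _ => ?_
    rw [← mode_apply F, hFdef, mode_lie_degOp]
    have := LinearMap.congr_fun (mode_commute_mode hS hf hg l l') w
    simp only [Module.End.mul_apply] at this
    simp [scal, this, smul_smul, mul_comm]
  · refine (support_subset_of_commute (fun l => mode_commute_mode hS hF hg l l') w).trans ?_
    intro l hl
    rw [Finsupp.mem_support_iff] at hl ⊢
    intro h0
    refine hl ?_
    have := LinearMap.congr_fun (mode_lie_degOp d f l) w
    rw [mode_apply, LinearMap.smul_apply, mode_apply, h0, smul_zero] at this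
    exact this

lemma pair_cw_pair_sub {J : Type*} [Fintype J] (κ : J → G → ℂ) (d : J → G →+ ℂ)
    (P Q : G → Module.End ℂ V) (c : ℂ)
    (hPQ : ∀ l l' v, P (-l) (Q (-l') v) - Q (-l') (P (-l) v)
      = c • ∑ p, (κ p (l + l') * d p l) • v)
    {f g : Module.End ℂ (G →₀ V)} (hf : f ∈ loopAlg S) (hg : g ∈ loopAlg S) (w : V) :
    pair P (cw (pair Q ∘ₗ g ∘ₗ incl) (f (incl w)))
        - pair Q (cw (pair P ∘ₗ f ∘ₗ incl) (g (incl w)))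
      = c • ∑ p, pair (scal (κ p))
          ((⁅(degOp (d p) : Module.End ℂ (G →₀ V)), f⁆ * g) (incl w)) := by
  simp only [pair_scal_mul hS _ _ hf hg]
  rw [pair_cw_pair hS P Q hf hg, pair_cw_pair hS Q P hg hf,
    Finset.sum_comm (s := (g (incl w)).support), ← Finset.sum_sub_distrib,
    Finset.sum_comm (s := Finset.univ), Finset.smul_sum]
  refine Finset.sum_congr rfl fun l _ => ?_
  rw [← Finset.sum_sub_distrib, Finset.sum_comm (s := Finset.univ), Finset.smul_sum]
  refine Finset.sum_congr rfl fun l' _ => ?_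
  rw [← hPQ]
  have := LinearMap.congr_fun (mode_commute_mode hS hf hg l l') w
  simp only [Module.End.mul_apply] at this
  rw [this]

lemma current_antisymm {I J : Type*} [Fintype I] [Fintype J] (κ : J → G → ℂ) (d : J → G →+ ℂ)
    (P : I → G → Module.End ℂ V) (c : I → I → ℂ)
    (hP : ∀ a b l l' v, P a (-l) (P b (-l') v) - P b (-l') (P a (-l) v)
      = c a b • ∑ p, (κ p (l + l') * d p l) • v)
    {f g : I → Module.End ℂ (G →₀ V)} (hf : ∀ a, f a ∈ loopAlg S) (hg : ∀ a, g a ∈ loopAlg S)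
    (w : V) :
    (∑ a, pair (P a) (cw (∑ b, pair (P b) ∘ₗ g b ∘ₗ incl) (f a (incl w))))
        - (∑ a, pair (P a) (cw (∑ b, pair (P b) ∘ₗ f b ∘ₗ incl) (g a (incl w))))
      = ∑ a, ∑ b, c a b • ∑ p, pair (scal (κ p))
          ((⁅(degOp (d p) : Module.End ℂ (G →₀ V)), f a⁆ * g b) (incl w)) := by
  simp only [cw_sum, LinearMap.sum_apply, map_sum]
  rw [Finset.sum_comm (γ := I) (f := fun a b => (pair (P a))
    ((cw (pair (P b) ∘ₗ f b ∘ₗ incl)) ((g a) (incl w)))), ← Finset.sum_sub_distrib]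
  refine Finset.sum_congr rfl fun a _ => ?_
  rw [← Finset.sum_sub_distrib]
  refine Finset.sum_congr rfl fun b _ => ?_
  exact pair_cw_pair_sub hS κ d (P a) (P b) (c a b) (hP a b) (hf a) (hg b) w

end Swap

section UpperTriangular

set_option linter.unusedSectionVars false

variable {ι R : Type*} [Fintype ι] [LinearOrder ι] [Ring R]

/-- The strictly upper triangular part of a matrix. -/
def up (P : Matrix ι ι R) : Matrix ι ι R := Matrix.of fun i j => if i < j then P i j else 0

lemma up_apply (P : Matrix ι ι R) (i j : ι) : up P i j = if i < j then P i j else 0 := rfl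

lemma up_sub (P Q : Matrix ι ι R) : up (P - Q) = up P - up Q := by
  ext i j
  simp only [up_apply, Matrix.sub_apply]
  split_ifs <;> simp

lemma lie_scalar_apply (P : Matrix ι ι R) (r : R) (i j : ι) :
    ⁅P, Matrix.scalar ι r⁆ i j = ⁅P i j, r⁆ := by
  simp [Ring.lie_def]

lemma scalar_lie_apply (P : Matrix ι ι R) (r : R) (i j : ι) :
    ⁅Matrix.scalar ι r, P⁆ i j = ⁅r, P i j⁆ := by
  simp [Ring.lie_def]

lemma up_lie_scalar (P : Matrix ι ι R) (r : R) :
    up ⁅P, Matrix.scalar ι r⁆ = ⁅up P, Matrix.scalar ι r⁆ := by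
  ext i j
  rw [lie_scalar_apply, up_apply, up_apply, lie_scalar_apply]
  split_ifs
  · rfl
  · simp [Ring.lie_def]

lemma up_mul_up_apply_self (P Q : Matrix ι ι R) (i : ι) : (up P * up Q) i i = 0 := by
  rw [Matrix.mul_apply]
  refine Finset.sum_eq_zero fun k _ => ?_
  simp only [up_apply]
  split_ifs with h1 h2
  · exact absurd h2 h1.not_gt
  all_goals simp

lemma up_mul_up (P Q : Matrix ι ι R) : up (up P * up Q) = up P * up Q := by
  ext i j
  rw [up_apply]
  split_ifs with h
  · rfl
  · rw [Matrix.mul_apply]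
    refine (Finset.sum_eq_zero fun k _ => ?_).symm
    simp only [up_apply]
    split_ifs with h1 h2
    · exact absurd (h1.trans h2) h
    all_goals simp

lemma up_low_mul_low (P Q : Matrix ι ι R) : up ((P - up P) * (Q - up Q)) = 0 := by
  ext i j
  rw [up_apply]
  split_ifs with h
  · rw [Matrix.mul_apply]
    refine Finset.sum_eq_zero fun k _ => ?_
    simp only [Matrix.sub_apply, up_apply]
    rcases lt_or_ge i k with h1 | h1
    · simp [h1]
    · simp [h1.trans_lt h]
  · rfl

lemma low_mul_low_apply_self (P Q : Matrix ι ι R) (i : ι) :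
    ((P - up P) * (Q - up Q)) i i = P i i * Q i i := by
  rw [Matrix.mul_apply, Finset.sum_eq_single i]
  · simp [up_apply]
  · intro k _ hk
    simp only [Matrix.sub_apply, up_apply]
    rcases lt_or_gt_of_ne hk with h1 | h1 <;> simp [h1]
  · simp

lemma up_lie_sub_lie (P Q : Matrix ι ι R) :
    up (⁅up Q, P⁆ - ⁅up P, Q⁆) + ⁅up P, up Q⁆ = up ⁅Q, P⁆ := by
  have h1 : ⁅up Q, P⁆ - ⁅up P, Q⁆ = ⁅Q, P⁆ - ((Q - up Q) * (P - up P) - (P - up P) * (Q - up Q))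
      - ⁅up P, up Q⁆ := by
    simp only [Ring.lie_def]
    noncomm_ring
  have h2 : up ⁅up P, up Q⁆ = ⁅up P, up Q⁆ := by
    rw [Ring.lie_def, up_sub, up_mul_up, up_mul_up]
  rw [h1, up_sub, up_sub, up_sub, up_low_mul_low, up_low_mul_low, h2]
  abel

lemma lie_sub_lie_apply_self (P Q : Matrix ι ι R) (h : ∀ i j k l, Commute (P i j) (Q k l)) (i : ι) :
    (⁅up Q, P⁆ - ⁅up P, Q⁆) i i = ⁅Q, P⁆ i i := by
  have h1 : ⁅up Q, P⁆ - ⁅up P, Q⁆ = ⁅Q, P⁆ - ((Q - up Q) * (P - up P) - (P - up P) * (Q - up Q))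
      - (up P * up Q - up Q * up P) := by
    simp only [Ring.lie_def]
    noncomm_ring
  rw [h1]
  simp only [Matrix.sub_apply, up_mul_up_apply_self, low_mul_low_apply_self, (h i i i i).eq]
  simp

lemma trace_mul_comm_of_commute (P Q : Matrix ι ι R) (h : ∀ i j k l, Commute (P i j) (Q k l)) :
    Matrix.trace (P * Q) = Matrix.trace (Q * P) := by
  simp only [Matrix.trace, Matrix.diag_apply, Matrix.mul_apply]
  rw [Finset.sum_comm]
  exact Finset.sum_congr rfl fun i _ => Finset.sum_congr rfl fun j _ => h _ _ _ _

lemma lie_lie_eq_up {X P Q : Matrix ι ι R} {a b : R}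
    (hXa : ⁅X, Matrix.scalar ι a⁆ = up P * X) (hXb : ⁅X, Matrix.scalar ι b⁆ = up Q * X)
    (hP : ⁅P, Matrix.scalar ι b⁆ = ⁅up Q, P⁆) (hQ : ⁅Q, Matrix.scalar ι a⁆ = ⁅up P, Q⁆) :
    ⁅X, Matrix.scalar ι (a * b - b * a)⁆ = up ⁅Q, P⁆ * X := by
  have hP' := up_lie_scalar P b
  have hQ' := up_lie_scalar Q a
  rw [← up_lie_sub_lie, up_sub, ← hP, ← hQ, hP', hQ']
  simp only [map_sub, map_mul]
  set α := Matrix.scalar ι a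
  set β := Matrix.scalar ι b
  simp only [Ring.lie_def] at *
  linear_combination (norm := noncomm_ring) hXa * β - β * hXa - hXb * α + α * hXb
    + up P * hXb - up Q * hXa

/-- The trace of a commutator against the strictly upper triangular part. -/
lemma trace_mul_lie_up_sub (P Q : Matrix ι ι R) (D : R)
    (h : ∀ i j k l, Commute ⁅D, P i j⁆ (Q k l)) :
    Matrix.trace (P * ⁅Matrix.scalar ι D, up Q⁆) - Matrix.trace (Q * ⁅Matrix.scalar ι D, up P⁆)
      = ⁅D, Matrix.trace (P * up Q)⁆ - Matrix.trace (⁅Matrix.scalar ι D, P⁆ * Q)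
        + ∑ i, ⁅D, P i i⁆ * Q i i := by
  have h1 : Matrix.trace (P * ⁅Matrix.scalar ι D, up Q⁆)
      = ⁅D, Matrix.trace (P * up Q)⁆ - Matrix.trace (⁅Matrix.scalar ι D, P⁆ * up Q) := by
    have : ⁅D, Matrix.trace (P * up Q)⁆ = Matrix.trace ⁅Matrix.scalar ι D, P * up Q⁆ := by
      simp only [Matrix.trace, Matrix.diag_apply, scalar_lie_apply]
      rw [Ring.lie_def, Finset.mul_sum, Finset.sum_mul, ← Finset.sum_sub_distrib]
      rfl
    rw [this, ← Matrix.trace_sub]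
    congr 1
    simp only [Ring.lie_def]
    noncomm_ring
  have h2 : Matrix.trace (Q * ⁅Matrix.scalar ι D, up P⁆)
      = Matrix.trace (up ⁅Matrix.scalar ι D, P⁆ * Q) := by
    simp only [Matrix.trace, Matrix.diag_apply, Matrix.mul_apply, scalar_lie_apply, up_apply]
    rw [Finset.sum_comm]
    refine Finset.sum_congr rfl fun i _ => Finset.sum_congr rfl fun j _ => ?_
    split_ifs with hij
    · exact ((h i j j i).eq).symm
    · simp [Ring.lie_def]
  have h3 : ∀ P : Matrix ι ι R, Matrix.trace (P * Q)
      = Matrix.trace (P * up Q) + Matrix.trace (up P * Q) + ∑ i, P i i * Q i i := fun P => by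
    have : P * Q = P * up Q + up P * Q + (P - up P) * (Q - up Q) - up P * up Q := by noncomm_ring
    rw [this]
    simp only [Matrix.trace, Matrix.diag_apply, Matrix.add_apply, Matrix.sub_apply,
      up_mul_up_apply_self, low_mul_low_apply_self, Finset.sum_add_distrib, sub_zero]
  have h4 : ∑ i, ⁅Matrix.scalar ι D, P⁆ i i * Q i i = ∑ i, ⁅D, P i i⁆ * Q i i :=
    Finset.sum_congr rfl fun i _ => by rw [scalar_lie_apply]
  rw [h1, h2, h3 ⁅Matrix.scalar ι D, P⁆, h4]
  abel

variable [Algebra ℂ R]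

/-- A complex matrix, with entries viewed in `R`. -/
def cmat (A : Matrix ι ι ℂ) : Matrix ι ι R := A.map (algebraMap ℂ R)

lemma cmat_mul (A B : Matrix ι ι ℂ) : (cmat (A * B) : Matrix ι ι R) = cmat A * cmat B :=
  Matrix.map_mul

lemma cmat_sub (A B : Matrix ι ι ℂ) : (cmat (A - B) : Matrix ι ι R) = cmat A - cmat B := by
  ext i j
  simp [cmat]

lemma trace_cmat (A : Matrix ι ι ℂ) :
    Matrix.trace (cmat A : Matrix ι ι R) = algebraMap ℂ R (Matrix.trace A) := by
  simp [cmat, Matrix.trace]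

lemma scalar_commute_cmat (r : R) (A : Matrix ι ι ℂ) : Commute (Matrix.scalar ι r) (cmat A) := by
  ext i j
  simp [cmat, (Algebra.commutes (A i j) r)]

lemma scalar_commute_of_forall {r : R} {P : Matrix ι ι R} (h : ∀ i j, Commute r (P i j)) :
    Commute (Matrix.scalar ι r) P := by
  ext i j
  simp [(h i j).eq]

section Deform

variable {X Y P U : Matrix ι ι R} {A : Matrix ι ι ℂ} {t r D : R}

lemma mul_scalar_of_lie (hXY : X * Y = 1) (hYX : Y * X = 1)
    (hX : ⁅X, Matrix.scalar ι r⁆ = U * X) :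
    Y * Matrix.scalar ι r = Matrix.scalar ι r * Y - Y * U := by
  have : Y * (X * Matrix.scalar ι r - Matrix.scalar ι r * X) * Y = Y * (U * X) * Y := by
    rw [← Ring.lie_def, hX]
  linear_combination (norm := noncomm_ring) -this + hYX * Matrix.scalar ι r * Y
    - Y * Matrix.scalar ι r * hXY - Y * U * hXY

/-- `P = t X A Y` satisfies `⁅P, r⁆ = ⁅U, P⁆` if `⁅X, r⁆ = U X`. -/
lemma lie_deform (hXY : X * Y = 1) (hYX : Y * X = 1) (hX : ⁅X, Matrix.scalar ι r⁆ = U * X)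
    (htU : ∀ i j, Commute t (U i j)) (htr : Commute t r)
    (hP : P = Matrix.scalar ι t * (X * cmat A * Y)) :
    ⁅P, Matrix.scalar ι r⁆ = ⁅U, P⁆ := by
  have h1 := (scalar_commute_of_forall htU).eq
  have h2 : Matrix.scalar ι t * Matrix.scalar ι r = Matrix.scalar ι r * Matrix.scalar ι t := by
    rw [← map_mul, htr.eq, map_mul]
  have h3 := (scalar_commute_cmat r A).eq
  have h4 := mul_scalar_of_lie hXY hYX hX
  rw [hP]
  simp only [Ring.lie_def] at *
  generalize Matrix.scalar ι r = ρ at *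
  generalize Matrix.scalar ι t = τ at *
  generalize (cmat A : Matrix ι ι R) = α at *
  linear_combination (norm := noncomm_ring) τ * X * α * h4 - τ * X * h3 * Y + τ * hX * α * Y
    + h2 * X * α * Y + h1 * X * α * Y

lemma lie_deform_degree (hXY : X * Y = 1) (hYX : Y * X = 1)
    (hX : ⁅X, Matrix.scalar ι r⁆ = U * X) (htr : Commute t r) (hDr : Commute D r) :
    ⁅Matrix.scalar ι t * (cmat A * Y * ⁅Matrix.scalar ι D, X⁆), Matrix.scalar ι r⁆
      = Matrix.scalar ι t * (cmat A * Y * ⁅Matrix.scalar ι D, U⁆) * X := by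
  have h1 : Matrix.scalar ι D * Matrix.scalar ι r = Matrix.scalar ι r * Matrix.scalar ι D := by
    rw [← map_mul, hDr.eq, map_mul]
  have h2 : Matrix.scalar ι t * Matrix.scalar ι r = Matrix.scalar ι r * Matrix.scalar ι t := by
    rw [← map_mul, htr.eq, map_mul]
  have h3 := (scalar_commute_cmat r A).eq
  have h4 := mul_scalar_of_lie hXY hYX hX
  simp only [Ring.lie_def] at *
  generalize Matrix.scalar ι r = ρ at *
  generalize Matrix.scalar ι t = τ at *
  generalize Matrix.scalar ι D = δ at *
  generalize (cmat A : Matrix ι ι R) = α at *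
  linear_combination (norm := noncomm_ring) τ * α * Y * δ * hX - τ * α * Y * X * h1
    - τ * α * Y * hX * δ + τ * α * Y * h1 * X
    + τ * α * h4 * (δ * X - X * δ) - τ * h3 * Y * (δ * X - X * δ)
    + h2 * α * Y * (δ * X - X * δ)

end Deform

section Trace

variable {C : Subalgebra ℂ R} (hC : ∀ a ∈ C, ∀ b ∈ C, Commute a b) {X Y : Matrix ι ι R}
  {A B : Matrix ι ι ℂ} {s t D : R}

lemma cmat_mem (C : Subalgebra ℂ R) (A : Matrix ι ι ℂ) : cmat A ∈ C.matrix :=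
  fun _ _ => C.algebraMap_mem _

lemma scalar_mul_mem {a : R} (ha : a ∈ C) {Q : Matrix ι ι R}
    (hQ : Q ∈ C.matrix) : Matrix.scalar ι a * Q ∈ C.matrix := fun i j => by
  simpa using C.mul_mem ha (hQ i j)

lemma scalar_lie_mem (hD : ∀ c ∈ C, ⁅D, c⁆ ∈ C) {Q : Matrix ι ι R}
    (hQ : Q ∈ C.matrix) : ⁅Matrix.scalar ι D, Q⁆ ∈ C.matrix := fun i j => by
  rw [scalar_lie_apply]
  exact hD _ (hQ i j)

lemma up_mem {Q : Matrix ι ι R} (hQ : Q ∈ C.matrix) :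
    up Q ∈ C.matrix := fun i j => by
  rw [up_apply]
  split_ifs
  · exact hQ i j
  · exact C.zero_mem

lemma trace_scalar_mul (a : R) (P : Matrix ι ι R) :
    Matrix.trace (Matrix.scalar ι a * P) = a * Matrix.trace P := by
  simp [Matrix.trace, Finset.mul_sum]

include hC

lemma trace_mul_comm_of_mem {P Q : Matrix ι ι R} (hP : P ∈ C.matrix)
    (hQ : Q ∈ C.matrix) : Matrix.trace (P * Q) = Matrix.trace (Q * P) :=
  trace_mul_comm_of_commute P Q fun i j k l => hC _ (hP i j) _ (hQ k l)

lemma scalar_commute_of_mem {a : R} (ha : a ∈ C) {Q : Matrix ι ι R}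
    (hQ : Q ∈ C.matrix) : Commute (Matrix.scalar ι a) Q :=
  scalar_commute_of_forall fun i j => hC _ ha _ (hQ i j)

lemma trace_lie_degree_mul (hD : ∀ c ∈ C, ⁅D, c⁆ ∈ C) (hXY : X * Y = 1) (hYX : Y * X = 1)
    (hXC : X ∈ C.matrix) (hYC : Y ∈ C.matrix) (hs : s ∈ C)
    (hAB : Matrix.trace (A * B) = 0) :
    Matrix.trace (⁅Matrix.scalar ι D, Matrix.scalar ι t * (X * cmat A * Y)⁆
        * (Matrix.scalar ι s * (X * cmat B * Y)))
      = -Matrix.trace (Matrix.scalar ι (t * s)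
        * (cmat (B * A - A * B) * Y * ⁅Matrix.scalar ι D, X⁆)) := by
  have hA := cmat_mem C A
  have hB := cmat_mem C B
  have hDX := scalar_lie_mem hD hXC
  have hlt : ⁅Matrix.scalar ι D, Matrix.scalar ι t⁆ = Matrix.scalar ι ⁅D, t⁆ := by
    simp only [Ring.lie_def, map_sub, map_mul]
  have hDY : ⁅Matrix.scalar ι D, Y⁆ = -(Y * ⁅Matrix.scalar ι D, X⁆ * Y) := by
    simp only [Ring.lie_def]
    linear_combination (norm := noncomm_ring) Y * Matrix.scalar ι D * hXY
      - hYX * Matrix.scalar ι D * Y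
  have hDA := (scalar_commute_cmat D A).eq
  have hsX := (scalar_commute_of_mem hC hs hXC).eq
  have hsY := (scalar_commute_of_mem hC hs hYC).eq
  have hsA := (scalar_commute_of_mem hC hs hA).eq
  have hsDX := (scalar_commute_of_mem hC hs hDX).eq
  have e1 : ⁅Matrix.scalar ι D, Matrix.scalar ι t * (X * cmat A * Y)⁆
        * (Matrix.scalar ι s * (X * cmat B * Y))
      = Matrix.scalar ι (⁅D, t⁆ * s) * (X * (cmat A * cmat B * Y))
        + Matrix.scalar ι (t * s) * (⁅Matrix.scalar ι D, X⁆ * (cmat A * cmat B * Y))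
        - Matrix.scalar ι (t * s) * ((X * cmat A * Y * ⁅Matrix.scalar ι D, X⁆)
            * (cmat B * Y)) := by
    have e2 : ⁅Matrix.scalar ι D, Matrix.scalar ι t * (X * cmat A * Y)⁆
        = Matrix.scalar ι ⁅D, t⁆ * (X * cmat A * Y)
          + Matrix.scalar ι t * (⁅Matrix.scalar ι D, X⁆ * cmat A * Y)
          - Matrix.scalar ι t * (X * cmat A * (Y * ⁅Matrix.scalar ι D, X⁆ * Y)) := by
      rw [← hlt]
      have : Matrix.scalar ι t * (X * cmat A * (Y * ⁅Matrix.scalar ι D, X⁆ * Y))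
          = -(Matrix.scalar ι t * (X * cmat A * ⁅Matrix.scalar ι D, Y⁆)) := by
        rw [hDY]; noncomm_ring
      rw [this]
      simp only [Ring.lie_def]
      linear_combination (norm := noncomm_ring) Matrix.scalar ι t * X * hDA * Y
    rw [e2, map_mul, map_mul]
    generalize ⁅Matrix.scalar ι D, X⁆ = E at *
    generalize Matrix.scalar ι ⁅D, t⁆ = τ' at *
    generalize Matrix.scalar ι t = τ at *
    generalize Matrix.scalar ι s = σ at *
    generalize (cmat A : Matrix ι ι R) = α at *
    generalize (cmat B : Matrix ι ι R) = β at *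
    have f1 : Y * (σ * (X * β * Y)) = σ * (β * Y) := by
      linear_combination (norm := noncomm_ring) -hsY * X * β * Y + σ * hYX * β * Y
    linear_combination (norm := noncomm_ring) (τ' * X * α + τ * E * α - τ * X * α * Y * E) * f1
      - (τ' * X + τ * E) * hsA * β * Y - τ' * hsX * α * β * Y - τ * hsDX * α * β * Y
      + τ * hsX * α * Y * E * β * Y + τ * X * hsA * Y * E * β * Y
      + τ * X * α * hsY * E * β * Y + τ * X * α * Y * hsDX * β * Y
  have t1 : Matrix.trace (X * (cmat A * cmat B * Y)) = 0 := by
    rw [trace_mul_comm_of_mem hC hXC (mul_mem (mul_mem hA hB) hYC), mul_assoc, hYX, mul_one,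
      ← cmat_mul, trace_cmat, hAB, map_zero]
  rw [e1, Matrix.trace_sub, Matrix.trace_add, trace_scalar_mul, trace_scalar_mul,
    trace_scalar_mul, trace_scalar_mul, t1,
    trace_mul_comm_of_mem hC hDX (mul_mem (mul_mem hA hB) hYC),
    trace_mul_comm_of_mem hC (mul_mem (mul_mem (mul_mem hXC hA) hYC) hDX) (mul_mem hB hYC),
    show cmat B * Y * (X * cmat A * Y * ⁅Matrix.scalar ι D, X⁆)
      = cmat B * (Y * X) * cmat A * Y * ⁅Matrix.scalar ι D, X⁆ by noncomm_ring, hYX, cmat_sub,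
    cmat_mul, cmat_mul, sub_mul, sub_mul, Matrix.trace_sub, mul_one]
  noncomm_ring

/-- The antisymmetrized action of a pair of matrices on the degree terms. -/
lemma trace_deform_degree_sub {P Q : Matrix ι ι R} {r r' : R}
    (hD : ∀ c ∈ C, ⁅D, c⁆ ∈ C) (hXY : X * Y = 1) (hYX : Y * X = 1)
    (hXC : X ∈ C.matrix) (hYC : Y ∈ C.matrix) (ht : t ∈ C) (hs : s ∈ C)
    (hAB : Matrix.trace (A * B) = 0)
    (hP : P = Matrix.scalar ι t * (X * cmat A * Y))
    (hQ : Q = Matrix.scalar ι s * (X * cmat B * Y))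
    (hXr : ⁅X, Matrix.scalar ι r⁆ = up P * X) (hXr' : ⁅X, Matrix.scalar ι r'⁆ = up Q * X)
    (htr' : Commute t r') (hsr : Commute s r) (hDr : Commute D r) (hDr' : Commute D r') :
    ⁅Matrix.trace (Matrix.scalar ι t * (cmat A * Y * ⁅Matrix.scalar ι D, X⁆)), r'⁆
      - ⁅Matrix.trace (Matrix.scalar ι s * (cmat B * Y * ⁅Matrix.scalar ι D, X⁆)), r⁆
      = Matrix.trace (Matrix.scalar ι (t * s)
          * (cmat (B * A - A * B) * Y * ⁅Matrix.scalar ι D, X⁆))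
        + ⁅D, Matrix.trace (P * up Q)⁆ + ∑ i, ⁅D, P i i⁆ * Q i i := by
  have key : ∀ {t r : R} {A : Matrix ι ι ℂ} {P U : Matrix ι ι R}, t ∈ C → U ∈ C.matrix →
      P = Matrix.scalar ι t * (X * cmat A * Y) → ⁅X, Matrix.scalar ι r⁆ = U * X → Commute t r →
      Commute D r →
      ⁅Matrix.trace (Matrix.scalar ι t * (cmat A * Y * ⁅Matrix.scalar ι D, X⁆)), r⁆
        = Matrix.trace (P * ⁅Matrix.scalar ι D, U⁆) := by
    intro t r A P U ht hU hP hXr htr hDr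
    have hDU := scalar_lie_mem hD hU
    have : ∀ M : Matrix ι ι R, ⁅Matrix.trace M, r⁆ = Matrix.trace ⁅M, Matrix.scalar ι r⁆ := by
      intro M
      simp [Ring.lie_def, Matrix.trace, Finset.sum_mul, Finset.mul_sum]
    rw [this, lie_deform_degree hXY hYX hXr htr hDr,
      trace_mul_comm_of_mem hC (scalar_mul_mem ht (mul_mem (mul_mem (cmat_mem C A) hYC) hDU)) hXC,
      hP]
    congr 1
    have := (scalar_commute_of_mem hC ht hXC).eq
    linear_combination (norm := noncomm_ring) -this * cmat A * Y * ⁅Matrix.scalar ι D, U⁆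
  have hPC : P ∈ C.matrix := hP ▸ scalar_mul_mem ht (mul_mem (mul_mem hXC (cmat_mem C A)) hYC)
  have hQC : Q ∈ C.matrix := hQ ▸ scalar_mul_mem hs (mul_mem (mul_mem hXC (cmat_mem C B)) hYC)
  rw [key ht (up_mem hQC) hP hXr' htr' hDr', key hs (up_mem hPC) hQ hXr hsr hDr,
    trace_mul_lie_up_sub P Q D fun i j k l => hC _ (hD _ (hPC i j)) _ (hQC k l)]
  have := trace_lie_degree_mul (t := t) hC hD hXY hYX hXC hYC hs hAB
  rw [← hP, ← hQ] at this
  rw [this]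
  abel

end Trace

end UpperTriangular

section Derivations

open MvPolynomial

variable {σ : Type*}

/-- The derivation of a polynomial ring with prescribed constant values on the variables. -/
def dconst (f : σ → ℂ) : Module.End ℂ (MvPolynomial σ ℂ) := (mkDerivation ℂ fun v => C (f v) :
  Derivation ℂ (MvPolynomial σ ℂ) (MvPolynomial σ ℂ)).toLinearMap

lemma dconst_X (f : σ → ℂ) (v : σ) : dconst f (X v) = C (f v) := mkDerivation_X _ _ _

lemma dconst_C (f : σ → ℂ) (c : ℂ) : dconst f (C c) = 0 := derivation_C _ _

lemma dconst_mul (f : σ → ℂ) (p q : MvPolynomial σ ℂ) :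
    dconst f (p * q) = p * dconst f q + dconst f p * q := by
  refine (Derivation.leibniz (mkDerivation ℂ fun v => C (f v)) p q).trans ?_
  rw [smul_eq_mul, smul_eq_mul, mul_comm q]
  rfl

lemma dconst_congr {f g : σ → ℂ} {p : MvPolynomial σ ℂ} (h : ∀ v ∈ p.vars, f v = g v) :
    dconst f p = dconst g p :=
  derivation_eq_of_forall_mem_vars fun v hv => by
    rw [mkDerivation_X, mkDerivation_X, h v hv]

lemma dconst_zero : dconst (0 : σ → ℂ) = 0 := by
  have : (mkDerivation ℂ fun v => C ((0 : σ → ℂ) v) :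
    Derivation ℂ (MvPolynomial σ ℂ) (MvPolynomial σ ℂ)) = 0 := derivation_ext fun v => by
      simp [mkDerivation_X]
  rw [dconst, this]
  rfl

lemma dconst_add (f g : σ → ℂ) : dconst (f + g) = dconst f + dconst g := by
  have : (mkDerivation ℂ fun v => C ((f + g) v) :
    Derivation ℂ (MvPolynomial σ ℂ) (MvPolynomial σ ℂ)) = mkDerivation ℂ (fun v => C (f v))
      + mkDerivation ℂ (fun v => C (g v)) := derivation_ext fun v => by
      simp [mkDerivation_X]
  rw [dconst, this]
  rfl

lemma dconst_smul (c : ℂ) (f : σ → ℂ) : dconst (c • f) = c • dconst f := by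
  have : (mkDerivation ℂ fun v => C ((c • f) v) :
    Derivation ℂ (MvPolynomial σ ℂ) (MvPolynomial σ ℂ)) = c • mkDerivation ℂ (fun v => C (f v)) :=
      derivation_ext fun v => by simp [mkDerivation_X, MvPolynomial.smul_eq_C_mul]
  rw [dconst, this]
  rfl

lemma dconst_sub (f g : σ → ℂ) : dconst (f - g) = dconst f - dconst g := by
  rw [eq_sub_iff_add_eq, ← dconst_add, sub_add_cancel]

lemma dconst_sum {ι : Type*} (s : Finset ι) (f : ι → σ → ℂ) :
    dconst (∑ i ∈ s, f i) = ∑ i ∈ s, dconst (f i) := by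
  classical
  induction s using Finset.induction_on with
  | empty => simp [dconst_zero]
  | insert a s ha ih => rw [Finset.sum_insert ha, Finset.sum_insert ha, dconst_add, ih]

lemma pderiv_eq_dconst [DecidableEq σ] (v : σ) (p : MvPolynomial σ ℂ) :
    pderiv v p = dconst (Pi.single v 1) p :=
  derivation_eq_of_forall_mem_vars (D₁ := pderiv v) fun u _ => by
    rw [pderiv_X, mkDerivation_X, Pi.single_apply, Pi.single_apply]
    by_cases h : u = v
    · simp [h]
    · simp [h]

lemma dconst_commute (f g : σ → ℂ) : Commute (dconst f) (dconst g) := by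
  refine LinearMap.ext fun p => ?_
  simp only [Module.End.mul_apply]
  induction p using MvPolynomial.induction_on with
  | C a => simp [dconst_C]
  | add p q hp hq => simp only [map_add, hp, hq]
  | mul_X p v hp => simp only [dconst_mul, dconst_X, dconst_C, map_add, hp]; ring

lemma finite_dconst {ι : Type*} (f : ι → σ → ℂ) (hf : ∀ v, {i | f i v ≠ 0}.Finite)
    (p : MvPolynomial σ ℂ) : {i | dconst (f i) p ≠ 0}.Finite := by
  refine (p.vars.finite_toSet.biUnion fun v _ => hf v).subset fun i hi => ?_
  simp only [Set.mem_iUnion]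
  by_contra! h
  refine hi ?_
  rw [dconst_congr (g := 0), dconst_zero, LinearMap.zero_apply]
  intro v hv
  simpa using h v hv

lemma finsum_dconst {ι : Type*} (f : ι → σ → ℂ) (hf : ∀ v, {i | f i v ≠ 0}.Finite)
    (p : MvPolynomial σ ℂ) :
    ∑ᶠ i, dconst (f i) p = dconst (fun v => ∑ᶠ i, f i v) p := by
  classical
  have hT := p.vars.finite_toSet.biUnion fun v _ => hf v
  rw [finsum_eq_sum_of_support_subset (s := hT.toFinset), ← LinearMap.sum_apply, ← dconst_sum]
  · refine dconst_congr fun v hv => ?_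
    rw [Finset.sum_apply, finsum_eq_sum_of_support_subset]
    intro i hi
    simp only [Set.Finite.coe_toFinset, Set.mem_iUnion]
    exact ⟨v, hv, hi⟩
  · intro i hi
    simp only [Set.Finite.coe_toFinset, Set.mem_iUnion]
    by_contra! h
    refine hi ?_
    beta_reduce
    rw [dconst_congr (g := 0), dconst_zero, LinearMap.zero_apply]
    intro v hv
    simpa using h v hv

lemma lie_dconst_mulLeft (f : σ → ℂ) (p : MvPolynomial σ ℂ) :
    ⁅dconst f, LinearMap.mulLeft ℂ p⁆ = LinearMap.mulLeft ℂ (dconst f p) :=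
  LinearMap.ext fun q => by simp [Ring.lie_def, dconst_mul]

/-- An operator commuting with the partial derivatives in the variables `s`, with image in the
ideal they generate, vanishes. -/
lemma eq_zero_of_commute_dconst (s : Set σ) [DecidableEq σ] (Z : Module.End ℂ (MvPolynomial σ ℂ))
    (h : ∀ v ∈ s, Commute (dconst (Pi.single v 1)) Z)
    (hZ : ∀ p, Z p ∈ Ideal.span (X '' s : Set (MvPolynomial σ ℂ))) : Z = 0 := by
  have key : ∀ q ∈ Ideal.span (X '' s : Set (MvPolynomial σ ℂ)), (∀ v ∈ s, pderiv v q = 0) →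
      q = 0 := by
    intro q hq hd
    ext t
    by_contra ht
    obtain ⟨v, hv, htv⟩ := mem_ideal_span_X_image.1 hq t (mem_support_iff.2 ht)
    have := congrArg (coeff (t - Finsupp.single v 1)) (hd v hv)
    rw [coeff_pderiv, coeff_zero, tsub_add_cancel_of_le, mul_eq_zero] at this
    · rcases this with h | h
      · exact ht h
      · exact Nat.cast_add_one_ne_zero _ h
    · rw [Finsupp.single_le_iff]
      omega
  have main : ∀ d : ℕ, ∀ t : σ →₀ ℕ, t.degree = d → ∀ c, Z (monomial t c) = 0 := by
    intro d
    induction d using Nat.strong_induction_on with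
    | _ d ih =>
      intro t ht c
      refine key _ (hZ _) fun v hv => ?_
      have hc := LinearMap.congr_fun (h v hv) (monomial t c)
      simp only [Module.End.mul_apply, ← pderiv_eq_dconst] at hc
      rw [hc, pderiv_monomial]
      by_cases htv : t v = 0
      · simp [htv]
      · refine ih (t - Finsupp.single v 1).degree ?_ _ rfl _
        have : t - Finsupp.single v 1 + Finsupp.single v 1 = t := by
          rw [tsub_add_cancel_of_le]
          rw [Finsupp.single_le_iff]
          omega
        have h2 := congrArg Finsupp.degree this
        rw [map_add, Finsupp.degree_single] at h2
        omega
  refine LinearMap.ext fun p => ?_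
  induction p using MvPolynomial.induction_on' with
  | monomial t c => exact main _ t rfl c
  | add p q hp hq => rw [map_add, hp, hq]; simp

end Derivations

section Generators

open MvPolynomial

/-- The variables of the Fock space. -/
abbrev Var (n N : ℕ) (pos : MM N → Prop) := XIdx n N ⊕ YIdx n N pos

variable (n N : ℕ) (pos : MM N → Prop)

/-- The variable `x_{ij}(m)`. -/
def xvar (i j : ℕ) (h : 1 ≤ i ∧ i < j ∧ j ≤ n + 1) (m : MM N) : Var n N pos :=
  Sum.inl ((⟨(i, j), h⟩, m) : XIdx n N)

/-- The variable `y_i(k)`. -/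
def yvar (i : ℕ) (h : 1 ≤ i ∧ i ≤ n) (k : MM N) (hk : pos k) : Var n N pos :=
  Sum.inr ((⟨i, h⟩, ⟨k, hk⟩) : YIdx n N pos)

/-- The function on the variables with values `c i j m` on `x_{ij}(m)` and `0` on the `y_i(k)`. -/
def xcoef (c : ℕ → ℕ → MM N → ℂ) : Var n N pos → ℂ :=
  Sum.elim (fun a => c a.1.1.1 a.1.1.2 a.2) fun _ => 0

/-- The function on the variables with values `c i k` on `y_i(k)` and `0` on the `x_{ij}(m)`. -/
def ycoef (c : ℕ → MM N → ℂ) : Var n N pos → ℂ :=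
  Sum.elim (fun _ => 0) fun b => c b.1.1 b.2.1

variable {n N pos} in
lemma Var.cases {P : Var n N pos → Prop} (hx : ∀ i j h m, P (xvar n N pos i j h m))
    (hy : ∀ i h k hk, P (yvar n N pos i h k hk)) (v : Var n N pos) : P v := by
  rcases v with ⟨⟨⟨i, j⟩, h⟩, m⟩ | ⟨⟨i, h⟩, ⟨k, hk⟩⟩
  · exact hx i j h m
  · exact hy i h k hk

@[simp] lemma xcoef_xvar (c : ℕ → ℕ → MM N → ℂ) (i j : ℕ) (h) (m : MM N) :
    xcoef n N pos c (xvar n N pos i j h m) = c i j m := rfl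

@[simp] lemma xcoef_yvar (c : ℕ → ℕ → MM N → ℂ) (i : ℕ) (h) (k : MM N) (hk) :
    xcoef n N pos c (yvar n N pos i h k hk) = 0 := rfl

@[simp] lemma ycoef_xvar (c : ℕ → MM N → ℂ) (i j : ℕ) (h) (m : MM N) :
    ycoef n N pos c (xvar n N pos i j h m) = 0 := rfl

@[simp] lemma ycoef_yvar (c : ℕ → MM N → ℂ) (i : ℕ) (h) (k : MM N) (hk) :
    ycoef n N pos c (yvar n N pos i h k hk) = c i k := rfl

lemma xvar_inj {i j i' j' : ℕ} {h h'} {m m' : MM N} :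
    xvar n N pos i j h m = xvar n N pos i' j' h' m' ↔ i = i' ∧ j = j' ∧ m = m' := by
  constructor
  · intro H
    have H1 := Sum.inl.inj H
    have H2 := congrArg Prod.fst H1
    have H3 := congrArg Prod.snd H1
    have H4 := congrArg Subtype.val H2
    exact ⟨congrArg Prod.fst H4, congrArg Prod.snd H4, H3⟩
  · rintro ⟨rfl, rfl, rfl⟩
    rfl

lemma yvar_inj {i i' : ℕ} {h h'} {k k' : MM N} {hk hk'} :
    yvar n N pos i h k hk = yvar n N pos i' h' k' hk' ↔ i = i' ∧ k = k' := by
  constructor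
  · intro H
    have H1 := Sum.inr.inj H
    exact ⟨congrArg Subtype.val (congrArg Prod.fst H1), congrArg Subtype.val (congrArg Prod.snd H1)⟩
  · rintro ⟨rfl, rfl⟩
    rfl

@[simp] lemma xvar_ne_yvar {i j : ℕ} {h} {m : MM N} {i' : ℕ} {h'} {k : MM N} {hk} :
    xvar n N pos i j h m ≠ yvar n N pos i' h' k hk := Sum.inl_ne_inr

@[simp] lemma yvar_ne_xvar {i j : ℕ} {h} {m : MM N} {i' : ℕ} {h'} {k : MM N} {hk} :
    yvar n N pos i' h' k hk ≠ xvar n N pos i j h m := Sum.inr_ne_inl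

open Classical in
/-- `a*_{ij,m}` as a linear map. -/
def astarL (i j : ℕ) (m : MM N) : Module.End ℂ (Fock n N pos) :=
  dconst (xcoef n N pos fun i' j' m' => if i' = i ∧ j' = j ∧ m' = -m then 1 else 0)

/-- `-x_{ij}(m)`, or `0` for out-of-range indices. -/
def negX (i j : ℕ) (m : MM N) : Fock n N pos :=
  if h : 1 ≤ i ∧ i < j ∧ j ≤ n + 1 then -X (xvar n N pos i j h m) else 0

/-- `a_{ij,m}` as a linear map. -/
def aL (i j : ℕ) (m : MM N) : Module.End ℂ (Fock n N pos) :=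
  LinearMap.mulLeft ℂ (negX n N pos i j m)

open Classical in
/-- `∂/∂y_i(s)` as a linear map. -/
def ydotL (i : ℕ) (s : MM N) : Module.End ℂ (Fock n N pos) :=
  dconst (ycoef n N pos fun i' s' => if i' = i ∧ s' = s then 1 else 0)

lemma aop_eq (i j : ℕ) (m : MM N) : aop n N pos i j m = aL n N pos i j m := by
  funext w
  rw [aop, aL, negX, LinearMap.mulLeft_apply]
  split_ifs
  · rfl
  · rw [zero_mul]

lemma astar_eq (i j : ℕ) (m : MM N) : astar n N pos i j m = astarL n N pos i j m := by
  classical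
  funext w
  have : astar n N pos i j m w = if h : 1 ≤ i ∧ i < j ∧ j ≤ n + 1 then
    pderiv (xvar n N pos i j h (-m)) w else 0 := rfl
  rw [this, astarL]
  split_ifs with h
  · rw [pderiv_eq_dconst]
    refine dconst_congr fun v _ => ?_
    cases v using Var.cases with
    | hx i' j' h' m' => simp [Pi.single_apply, xvar_inj]
    | hy i' h' k hk => simp
  · rw [dconst_congr (g := 0), dconst_zero, LinearMap.zero_apply]
    intro v _
    cases v using Var.cases with
    | hx i' j' h' m' =>
      rw [xcoef_xvar, if_neg, Pi.zero_apply]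
      rintro ⟨rfl, rfl, -⟩
      exact h h'
    | hy i' h' k hk => rfl

lemma astarL_eq_zero {i j : ℕ} (h : ¬ (1 ≤ i ∧ i < j ∧ j ≤ n + 1)) (m : MM N) :
    astarL n N pos i j m = 0 := by
  refine LinearMap.ext fun w => ?_
  rw [← astar_eq]
  exact dif_neg h

lemma ydot_eq (i : ℕ) (s : MM N) : ydot n N pos i s = ydotL n N pos i s := by
  classical
  funext w
  have : ydot n N pos i s w = if h : (1 ≤ i ∧ i ≤ n) ∧ pos s then
    pderiv (yvar n N pos i h.1 s h.2) w else 0 := by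
    rw [ydot]
    rfl
  rw [this, ydotL]
  split_ifs with h
  · rw [pderiv_eq_dconst]
    refine dconst_congr fun v _ => ?_
    cases v using Var.cases with
    | hx i' j' h' m' => simp
    | hy i' h' k hk => simp [Pi.single_apply, yvar_inj]
  · rw [dconst_congr (g := 0), dconst_zero, LinearMap.zero_apply]
    intro v _
    cases v using Var.cases with
    | hx i' j' h' m' => rfl
    | hy i' h' k hk =>
      rw [ycoef_yvar, if_neg, Pi.zero_apply]
      rintro ⟨rfl, rfl⟩
      exact h ⟨h', hk⟩

lemma astarL_commute (i j i' j' : ℕ) (m m' : MM N) :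
    Commute (astarL n N pos i j m) (astarL n N pos i' j' m') :=
  dconst_commute _ _

open Classical in
lemma lie_astarL_aL (i j i' j' : ℕ) (m m' : MM N) :
    ⁅astarL n N pos i j m, aL n N pos i' j' m'⁆
      = if (1 ≤ i ∧ i < j ∧ j ≤ n + 1) ∧ i' = i ∧ j' = j ∧ m' = -m then -1 else 0 := by
  rw [astarL, aL, lie_dconst_mulLeft, negX]
  refine LinearMap.ext fun w => ?_
  by_cases h : 1 ≤ i' ∧ i' < j' ∧ j' ≤ n + 1
  · rw [dif_pos h, map_neg, dconst_X, xcoef_xvar]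
    by_cases h2 : i' = i ∧ j' = j ∧ m' = -m
    · obtain ⟨rfl, rfl, rfl⟩ := h2
      simp [h]
    · rw [if_neg h2, if_neg]
      · simp
      · rintro ⟨_, h3⟩
        exact h2 h3
  · rw [dif_neg h, map_zero, if_neg]
    · simp
    · rintro ⟨h2, rfl, rfl, h3⟩
      exact h h2

lemma finite_astarL (i j : ℕ) (w : Fock n N pos) : {k | astarL n N pos i j k w ≠ 0}.Finite := by
  refine finite_dconst _ (fun v => ?_) w
  cases v using Var.cases with
  | hx i' j' h' m' =>
    refine (Set.finite_singleton (-m')).subset fun k hk => ?_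
    by_contra h
    refine hk ?_
    rw [xcoef_xvar, if_neg]
    rintro ⟨_, _, rfl⟩
    simp at h
  | hy i' h' k hk => simp

/-- The set of all operators `a*_{ij,m}`. -/
def annihilators : Set (Module.End ℂ (Fock n N pos)) := {d | ∃ i j m, d = astarL n N pos i j m}

lemma annihilators_commute : ∀ a ∈ annihilators n N pos, ∀ b ∈ annihilators n N pos,
    Commute a b := by
  rintro _ ⟨i, j, m, rfl⟩ _ ⟨i', j', m', rfl⟩
  exact astarL_commute ..

/-- The generating series of the operators `a*_{ij,m}`. -/
def astarF (i j : ℕ) : LoopEnd (MM N) (Fock n N pos) :=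
  field (astarL n N pos i j) (finite_astarL n N pos i j)

lemma mode_astarF (i j : ℕ) (m : MM N) : mode (astarF n N pos i j) m = astarL n N pos i j m :=
  mode_field _ _ _

lemma astarF_mem (i j : ℕ) : astarF n N pos i j ∈ loopAlg (annihilators n N pos) :=
  mem_loopAlg_of_mode (isLoop_field _ _) fun l => ⟨i, j, l, mode_astarF ..⟩

lemma astarF_eq_zero {i j : ℕ} (h : ¬ (1 ≤ i ∧ i < j ∧ j ≤ n + 1)) :
    astarF n N pos i j = 0 :=
  IsLoop.ext (isLoop_field _ _) (fun _ => Commute.zero_right _) fun l => by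
    rw [mode_astarF, astarL_eq_zero n N pos h, mode_zero]

end Generators

section CartanCurrents

open MvPolynomial

variable (n N : ℕ) (pos : MM N → Prop) (kappa : MM N → Fin (N + 1) → ℂ) (lam : ℕ → ℂ)

/-- The constant derivation `y_i(s) ↦ c_i Σ_p m_p κ_{-m+s,p}`. -/
def cartanDer (m : MM N) (c : ℕ → ℂ) : Module.End ℂ (Fock n N pos) :=
  dconst (ycoef n N pos fun i s => cnum kappa m s * c i)

/-- The Kronecker delta. -/
def kron (i j : ℕ) : ℂ := if i = j then 1 else 0

/-- The Cartan matrix of type `A_n`, for `1 ≤ i, j ≤ n`. -/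
def cartanA (i j : ℕ) : ℂ := 2 * kron i j - kron i (j + 1) - kron (i + 1) j

open Classical in
/-- The polynomial part of `Φ(b_i(m))`. -/
def cartanMul (i : ℕ) (m : MM N) : Fock n N pos :=
  (if h : (1 ≤ i ∧ i ≤ n) ∧ pos (-m) then X (yvar n N pos i h.1 (-m) h.2) else 0)
    - C (if m = 0 then lam i else 0)

/-- `Φ(b_i(m))` as a linear map. -/
def PhiL (i : ℕ) (m : MM N) : Module.End ℂ (Fock n N pos) :=
  theta pos (-m) • cartanDer n N pos kappa m (fun j => kron j (i - 1) - kron j i)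
    + theta pos m • cartanDer n N pos kappa m
        (fun j => kron j (i - 1) - 2 * kron j i + kron j (i + 1))
    + LinearMap.mulLeft ℂ (cartanMul n N pos lam i m)

variable {n N pos kappa lam}

open Classical in
lemma finsum_cartanDer (m : MM N) (c : ℕ → ℂ) (f : MM N → Var n N pos → ℂ)
    (hf : ∀ s, f s = ycoef n N pos fun i' s' => if s' = s then cnum kappa m s * c i' else 0)
    (w : Fock n N pos) :
    ∑ᶠ s, dconst (f s) w = cartanDer n N pos kappa m c w := by
  rw [finsum_dconst, cartanDer]
  · refine dconst_congr fun v _ => ?_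
    simp only [hf]
    cases v using Var.cases with
    | hx i' j' h' m' => simp
    | hy i' h' k hk =>
      simp only [ycoef_yvar]
      rw [finsum_eq_single _ k fun s hs => if_neg hs.symm, if_pos rfl]
  · intro v
    simp only [hf]
    cases v using Var.cases with
    | hx i' j' h' m' => simp
    | hy i' h' k hk =>
      refine (Set.finite_singleton k).subset fun s hs => ?_
      by_contra h
      exact hs (if_neg fun h' => h h'.symm)

lemma Phi_eq (i : ℕ) (m : MM N) : Phi n N pos kappa lam i m = PhiL n N pos kappa lam i m := by
  classical
  funext w
  have e1 : (∑ᶠ s : MM N, cnum kappa m s • (ydot n N pos (i - 1) s w - ydot n N pos i s w))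
      = cartanDer n N pos kappa m (fun j => kron j (i - 1) - kron j i) w := by
    simp only [ydot_eq, ydotL, ← LinearMap.sub_apply, ← LinearMap.smul_apply, ← dconst_sub,
      ← dconst_smul]
    refine finsum_cartanDer m _ _ (fun s => ?_) w
    funext v
    cases v using Var.cases with
    | hx i' j' h' m' => simp
    | hy i' h' k hk =>
      simp only [Pi.smul_apply, Pi.sub_apply, ycoef_yvar, smul_eq_mul, kron]
      by_cases h : k = s <;> simp [h]
  have e2 : (∑ᶠ s : MM N, cnum kappa m s • (ydot n N pos (i - 1) s w
        - (2 : ℂ) • ydot n N pos i s w + ydot n N pos (i + 1) s w))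
      = cartanDer n N pos kappa m (fun j => kron j (i - 1) - 2 * kron j i + kron j (i + 1)) w := by
    simp only [ydot_eq, ydotL, ← LinearMap.sub_apply, ← LinearMap.smul_apply, ← dconst_sub,
      ← dconst_smul, ← LinearMap.add_apply, ← dconst_add]
    refine finsum_cartanDer m _ _ (fun s => ?_) w
    funext v
    cases v using Var.cases with
    | hx i' j' h' m' => simp
    | hy i' h' k hk =>
      simp only [Pi.smul_apply, Pi.sub_apply, Pi.add_apply, ycoef_yvar, smul_eq_mul, kron]
      by_cases h : k = s <;> simp [h]
  have e3 : (if h : (1 ≤ i ∧ i ≤ n) ∧ pos (-m) then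
      (X (Sum.inr ((⟨i, h.1⟩, ⟨-m, h.2⟩) : YIdx n N pos)) : Fock n N pos) * w else 0)
      = (if h : (1 ≤ i ∧ i ≤ n) ∧ pos (-m) then X (yvar n N pos i h.1 (-m) h.2) else 0) * w := by
    split_ifs
    · rfl
    · rw [zero_mul]
  rw [Phi, e1, e2, e3, PhiL, cartanMul]
  simp only [LinearMap.add_apply, LinearMap.smul_apply, LinearMap.mulLeft_apply, sub_mul,
    ← MvPolynomial.smul_eq_C_mul, add_sub_assoc]

end CartanCurrents

section CartanCommutators

open MvPolynomial

variable {n N : ℕ} {pos : MM N → Prop} {kappa : MM N → Fin (N + 1) → ℂ} {lam : ℕ → ℂ}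

lemma cnum_swap (hE1 : ∀ m : MM N, ∑ p : Fin (N + 1), (m p : ℂ) * kappa m p = 0) (m l : MM N) :
    cnum kappa l (-m) = -cnum kappa m (-l) := by
  rw [eq_neg_iff_add_eq_zero, cnum, cnum, ← Finset.sum_add_distrib, ← neg_eq_zero,
    ← Finset.sum_neg_distrib, ← hE1 (-m + -l)]
  refine Finset.sum_congr rfl fun p _ => ?_
  rw [add_comm (-l)]
  simp only [Pi.add_apply, Pi.neg_apply]
  push_cast
  ring

lemma cnum_zero_left (s : MM N) : cnum kappa 0 s = 0 := by
  simp [cnum]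

lemma cartanDer_cartanMul (c : ℕ → ℂ) (m l : MM N) {j : ℕ} (hj : 1 ≤ j ∧ j ≤ n) :
    cartanDer n N pos kappa m c (cartanMul n N pos lam j l)
      = C (theta pos (-l) * (cnum kappa m (-l) * c j)) := by
  rw [cartanDer, cartanMul, map_sub, dconst_C, sub_zero, theta]
  by_cases h : pos (-l)
  · rw [dif_pos ⟨hj, h⟩, dconst_X, ycoef_yvar, if_pos h, one_mul]
  · rw [dif_neg fun h' => h h'.2, map_zero, if_neg h, zero_mul, map_zero]

lemma lie_PhiL_eq (i j : ℕ) (hi : 1 ≤ i ∧ i ≤ n) (hj : 1 ≤ j ∧ j ≤ n) (m l : MM N) :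
    ⁅PhiL n N pos kappa lam i m, PhiL n N pos kappa lam j l⁆
      = ((theta pos (-l) * cnum kappa m (-l) * (theta pos (-m) * (kron j (i - 1) - kron j i)
          + theta pos m * (kron j (i - 1) - 2 * kron j i + kron j (i + 1))))
        - (theta pos (-m) * cnum kappa l (-m) * (theta pos (-l) * (kron i (j - 1) - kron i j)
          + theta pos l * (kron i (j - 1) - 2 * kron i j + kron i (j + 1))))) • 1 := by
  have hD : ∀ (i : ℕ) (m : MM N) (c c' : ℕ → ℂ), theta pos (-m) • cartanDer n N pos kappa m c
      + theta pos m • cartanDer n N pos kappa m c'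
      = dconst (theta pos (-m) • (ycoef n N pos fun i s => cnum kappa m s * c i)
        + theta pos m • ycoef n N pos fun i s => cnum kappa m s * c' i) := fun i m c c' => by
    rw [dconst_add, dconst_smul, dconst_smul]
    rfl
  have key : ∀ (f g : Var n N pos → ℂ) (p q : Fock n N pos),
      ⁅dconst f + LinearMap.mulLeft ℂ p, dconst g + LinearMap.mulLeft ℂ q⁆
        = LinearMap.mulLeft ℂ (dconst f q - dconst g p) := fun f g p q => by
    have h1 := (dconst_commute f g).eq
    have h2 := lie_dconst_mulLeft f q
    have h3 := lie_dconst_mulLeft g p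
    have h4 : LinearMap.mulLeft ℂ p * LinearMap.mulLeft ℂ q
        = LinearMap.mulLeft ℂ q * LinearMap.mulLeft ℂ p := by
      refine LinearMap.ext fun w => ?_
      simp only [Module.End.mul_apply, LinearMap.mulLeft_apply]
      ring
    have h5 : LinearMap.mulLeft ℂ (dconst f q - dconst g p)
        = LinearMap.mulLeft ℂ (dconst f q) - LinearMap.mulLeft ℂ (dconst g p) :=
      LinearMap.ext fun w => by simp [sub_mul]
    rw [h5, ← h2, ← h3]
    simp only [Ring.lie_def]
    linear_combination (norm := noncomm_ring) h1 + h4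
  rw [PhiL, PhiL, hD i, hD j, key, ← hD i, ← hD j]
  simp only [LinearMap.add_apply, LinearMap.smul_apply, cartanDer_cartanMul _ _ _ hi,
    cartanDer_cartanMul _ _ _ hj]
  refine LinearMap.ext fun w => ?_
  simp only [LinearMap.mulLeft_apply, LinearMap.smul_apply, Module.End.one_apply,
    MvPolynomial.smul_eq_C_mul, ← C_mul, ← C_add, ← C_sub]
  congr 2
  ring

lemma kron_comm (i j : ℕ) : kron i j = kron j i := by
  simp only [kron, eq_comm]

lemma kron_pred {i j : ℕ} (hi : 1 ≤ i) : kron j (i - 1) = kron (j + 1) i := by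
  simp only [kron]
  congr 1
  rw [eq_iff_iff]
  omega

lemma lie_PhiL
    (htri : ∀ a : MM N, pos a ∨ a = 0 ∨ pos (-a))
    (hdisj : ∀ a : MM N, pos a → ¬ pos (-a))
    (hE1 : ∀ m : MM N, ∑ p : Fin (N + 1), (m p : ℂ) * kappa m p = 0)
    (hE2 : ∀ m k : MM N, pos m → pos k →
      ∑ p : Fin (N + 1), (m p : ℂ) * kappa (-m - k) p = 0)
    (i j : ℕ) (hi : 1 ≤ i ∧ i ≤ n) (hj : 1 ≤ j ∧ j ≤ n) (m l : MM N) :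
    ⁅PhiL n N pos kappa lam i m, PhiL n N pos kappa lam j l⁆
      = (-(cartanA i j * cnum kappa m (-l))) • 1 := by
  rw [lie_PhiL_eq i j hi hj]
  congr 1
  have hpp : pos m → pos l → cnum kappa m (-l) = 0 := fun hm hl => by
    have := hE2 m l hm hl
    rwa [cnum, ← sub_eq_add_neg]
  rw [cnum_swap hE1 m l, kron_pred hi.1, kron_pred hj.1, cartanA, kron_comm j (i + 1),
    kron_comm (j + 1) i, kron_comm j i]
  have hz : m = 0 ∨ l = 0 → cnum kappa m (-l) = 0 := by
    rintro (rfl | rfl)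
    · exact cnum_zero_left _
    · rw [← neg_eq_zero, ← cnum_swap hE1, cnum_zero_left]
  rcases htri m with hm | hm | hm
  · rcases htri l with hl | hl | hl
    · rw [hpp hm hl]; ring
    · rw [hz (Or.inr hl)]; ring
    · have h1 := hdisj _ hm
      simp only [theta, if_pos hm, if_pos hl, if_neg h1]
      ring
  · rw [hz (Or.inl hm)]; ring
  · have h1 : ¬ pos m := fun h => hdisj m h hm
    rcases htri l with hl | hl | hl
    · have h2 := hdisj _ hl
      simp only [theta, if_pos hm, if_pos hl, if_neg h1, if_neg h2]
      ring
    · rw [hz (Or.inr hl)]; ring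
    · have h2 : ¬ pos l := fun h => hdisj l h hl
      simp only [theta, if_pos hm, if_pos hl, if_neg h1, if_neg h2]
      ring

/-- The sum of the entries of the Cartan matrix in the rows `> i` and columns `> j`. -/
lemma sum_cartanA (i j : ℕ) (hi : i ≤ n) (hj : j ≤ n) :
    ∑ r ∈ Finset.Icc (i + 1) n, ∑ s ∈ Finset.Icc (j + 1) n, cartanA r s
      = if i < n ∧ j < n then kron i j + 1 else 0 := by
  by_cases hj' : j < n
  · have h1 : ∀ r ∈ Finset.Icc (i + 1) n, ∑ s ∈ Finset.Icc (j + 1) n, cartanA r s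
        = kron r (j + 1) - kron r j + kron r n := fun r hr => by
      rw [Finset.mem_Icc] at hr
      have e : ∀ s, kron r (s + 1) = kron (r - 1) s := fun s => by
        simp only [kron]
        congr 1
        rw [eq_iff_iff]
        omega
      simp only [cartanA, e]
      simp only [kron, Finset.sum_sub_distrib, ← Finset.mul_sum, Finset.sum_ite_eq,
        Finset.mem_Icc]
      split_ifs <;> first | omega | norm_num
    rw [Finset.sum_congr rfl h1]
    simp only [kron, Finset.sum_add_distrib, Finset.sum_sub_distrib, Finset.sum_ite_eq',
      Finset.mem_Icc]
    split_ifs <;> first | omega | norm_num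
  · rw [if_neg fun h => hj' h.2, show j = n by omega]
    simp

/-- The partial sums of the Cartan currents. -/
def PhiP (n N : ℕ) (pos : MM N → Prop) (kappa : MM N → Fin (N + 1) → ℂ) (lam : ℕ → ℂ)
    (i : ℕ) (m : MM N) : Module.End ℂ (Fock n N pos) :=
  ∑ r ∈ Finset.Icc (i + 1) n, PhiL n N pos kappa lam r m

/-- The derivation `-D_p`. -/
def degNeg {N : ℕ} (p : Fin (N + 1)) : MM N →+ ℂ where
  toFun l := -(l p : ℂ)
  map_zero' := by simp
  map_add' l l' := by simp only [Pi.add_apply]; push_cast; ring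

lemma PhiP_sub
    (htri : ∀ a : MM N, pos a ∨ a = 0 ∨ pos (-a))
    (hdisj : ∀ a : MM N, pos a → ¬ pos (-a))
    (hE1 : ∀ m : MM N, ∑ p : Fin (N + 1), (m p : ℂ) * kappa m p = 0)
    (hE2 : ∀ m k : MM N, pos m → pos k →
      ∑ p : Fin (N + 1), (m p : ℂ) * kappa (-m - k) p = 0)
    (i j : ℕ) (hi : i ≤ n) (hj : j ≤ n) (l l' : MM N) (v : Fock n N pos) :
    PhiP n N pos kappa lam i (-l) (PhiP n N pos kappa lam j (-l') v)
        - PhiP n N pos kappa lam j (-l') (PhiP n N pos kappa lam i (-l) v)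
      = (if i < n ∧ j < n then -(kron i j + 1) else 0)
        • ∑ p, (kappa (l + l') p * degNeg p l) • v := by
  have h1 : ⁅PhiP n N pos kappa lam i (-l), PhiP n N pos kappa lam j (-l')⁆
      = ∑ r ∈ Finset.Icc (i + 1) n, ∑ s ∈ Finset.Icc (j + 1) n,
          ⁅PhiL n N pos kappa lam r (-l), PhiL n N pos kappa lam s (-l')⁆ := by
    simp only [PhiP, Ring.lie_def, Finset.sum_sub_distrib, Finset.sum_mul_sum]
    rw [Finset.sum_comm (s := Finset.Icc (j + 1) n)]
  have h2 : ∀ r ∈ Finset.Icc (i + 1) n, ∀ s ∈ Finset.Icc (j + 1) n,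
      ⁅PhiL n N pos kappa lam r (-l), PhiL n N pos kappa lam s (-l')⁆
        = (cartanA r s * ∑ p, (l p : ℂ) * kappa (l + l') p) • 1 := fun r hr s hs => by
    rw [Finset.mem_Icc] at hr hs
    rw [lie_PhiL htri hdisj hE1 hE2 r s ⟨by omega, hr.2⟩ ⟨by omega, hs.2⟩, cnum]
    congr 1
    rw [← mul_neg, ← Finset.sum_neg_distrib]
    congr 1
    refine Finset.sum_congr rfl fun p _ => ?_
    rw [neg_neg, neg_neg, Pi.neg_apply]
    push_cast
    ring
  have h3 := LinearMap.congr_fun h1 v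
  rw [Finset.sum_congr rfl fun r hr => Finset.sum_congr rfl fun s hs => h2 r hr s hs] at h3
  rw [Ring.lie_def, LinearMap.sub_apply, Module.End.mul_apply, Module.End.mul_apply] at h3
  rw [h3]
  simp only [← Finset.sum_smul, ← Finset.sum_mul, sum_cartanA i j hi hj, LinearMap.smul_apply,
    Module.End.one_apply, smul_smul]
  congr 1
  rw [Finset.mul_sum, Finset.mul_sum]
  refine Finset.sum_congr rfl fun p _ => ?_
  simp only [degNeg, AddMonoidHom.coe_mk, ZeroHom.coe_mk]
  split_ifs <;> ring

lemma astarL_commute_PhiL (i j : ℕ) (m : MM N) (r : ℕ) (l : MM N) :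
    Commute (astarL n N pos i j m) (PhiL n N pos kappa lam r l) := by
  refine ((dconst_commute _ _).smul_right _).add_right ((dconst_commute _ _).smul_right _)
    |>.add_right ?_
  rw [commute_iff_lie_eq, lie_dconst_mulLeft, cartanMul, map_sub, dconst_C, sub_zero]
  split_ifs
  · rw [dconst_X, xcoef_yvar, C_0]
    exact LinearMap.ext fun w => zero_mul w
  · rw [map_zero]
    exact LinearMap.ext fun w => zero_mul w

lemma astarL_commute_PhiP (i j : ℕ) (m : MM N) (r : ℕ) (l : MM N) :
    Commute (astarL n N pos i j m) (PhiP n N pos kappa lam r l) :=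
  Commute.sum_right _ _ _ fun _ _ => astarL_commute_PhiL ..

variable (n N pos) in
/-- The ideal generated by the variables `x_{ij}(m)`. -/
def xideal : Ideal (Fock n N pos) := Ideal.span (X '' {v | ∃ i j h m, v = xvar n N pos i j h m})

lemma X_mem_xideal (i j : ℕ) (h) (m : MM N) : X (xvar n N pos i j h m) ∈ xideal n N pos :=
  Ideal.subset_span ⟨_, ⟨i, j, h, m, rfl⟩, rfl⟩

lemma aL_mem_xideal (i j : ℕ) (m : MM N) (w : Fock n N pos) :
    aL n N pos i j m w ∈ xideal n N pos := by
  rw [aL, LinearMap.mulLeft_apply, negX]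
  refine Ideal.mul_mem_right _ _ ?_
  split_ifs
  · exact neg_mem (X_mem_xideal i j _ m)
  · exact zero_mem _

lemma dconst_ycoef_mem_xideal (c : ℕ → MM N → ℂ) {w : Fock n N pos} (hw : w ∈ xideal n N pos) :
    dconst (ycoef n N pos c) w ∈ xideal n N pos := by
  refine Submodule.span_induction ?_ ?_ ?_ ?_ hw
  · rintro _ ⟨_, ⟨i, j, h, m, rfl⟩, rfl⟩
    rw [dconst_X, ycoef_xvar, C_0]
    exact zero_mem _
  · rw [map_zero]
    exact zero_mem _
  · intro p q _ _ hp hq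
    rw [map_add]
    exact add_mem hp hq
  · intro a p hp hp'
    rw [smul_eq_mul, dconst_mul]
    exact add_mem (Ideal.mul_mem_left _ _ hp') (Ideal.mul_mem_left _ _ hp)

lemma PhiP_mem_xideal (i : ℕ) (m : MM N) {w : Fock n N pos} (hw : w ∈ xideal n N pos) :
    PhiP n N pos kappa lam i m w ∈ xideal n N pos := by
  rw [PhiP, LinearMap.sum_apply]
  refine sum_mem fun r _ => ?_
  have hs : ∀ (c : ℂ) {p : Fock n N pos}, p ∈ xideal n N pos → c • p ∈ xideal n N pos :=
    fun c p hp => by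
      rw [MvPolynomial.smul_eq_C_mul]
      exact Ideal.mul_mem_left _ _ hp
  exact add_mem (add_mem (hs _ (dconst_ycoef_mem_xideal _ hw))
    (hs _ (dconst_ycoef_mem_xideal _ hw)))
    (Ideal.mul_mem_left _ _ hw)

lemma dconst_single_xvar [DecidableEq (Var n N pos)] (i j : ℕ) (h) (m : MM N) :
    dconst (Pi.single (xvar n N pos i j h m) 1) = astarL n N pos i j (-m) := by
  refine LinearMap.ext fun w => ?_
  rw [← astar_eq, ← pderiv_eq_dconst]
  refine Eq.trans ?_ (dif_pos h).symm
  rw [neg_neg]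
  rfl

end CartanCommutators

section Realization

variable (n N : ℕ) (pos : MM N → Prop)

/-- The strictly upper triangular matrix of the fields `a*_{ij}`. -/
def Umat : Matrix (Fin (n + 1)) (Fin (n + 1)) (LoopEnd (MM N) (Fock n N pos)) :=
  Matrix.of fun i j => astarF n N pos (i + 1) (j + 1)

/-- The generic unipotent matrix. -/
def Xmat : Matrix (Fin (n + 1)) (Fin (n + 1)) (LoopEnd (MM N) (Fock n N pos)) :=
  1 - Umat n N pos

/-- The inverse of the generic unipotent matrix. -/
def Ymat : Matrix (Fin (n + 1)) (Fin (n + 1)) (LoopEnd (MM N) (Fock n N pos)) :=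
  ∑ k ∈ Finset.range (n + 1), Umat n N pos ^ k

/-- The conjugate of the loop `A t^{-m}` by the generic unipotent matrix. -/
def Pmat (A : Matrix (Fin (n + 1)) (Fin (n + 1)) ℂ) (m : MM N) :
    Matrix (Fin (n + 1)) (Fin (n + 1)) (LoopEnd (MM N) (Fock n N pos)) :=
  Matrix.scalar (Fin (n + 1)) (shift (-m)) * (Xmat n N pos * cmat A * Ymat n N pos)

/-- The coefficient of the central terms. -/
def Hmat (A : Matrix (Fin (n + 1)) (Fin (n + 1)) ℂ) (m : MM N) (p : Fin (N + 1)) :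
    Matrix (Fin (n + 1)) (Fin (n + 1)) (LoopEnd (MM N) (Fock n N pos)) :=
  Matrix.scalar (Fin (n + 1)) (shift (-m)) * (cmat A * Ymat n N pos
    * ⁅Matrix.scalar (Fin (n + 1)) (degOp (degNeg p) : LoopEnd (MM N) (Fock n N pos)),
      Xmat n N pos⁆)

lemma Umat_apply (i j : Fin (n + 1)) : Umat n N pos i j = astarF n N pos (i + 1) (j + 1) := rfl

lemma Umat_eq_zero {i j : Fin (n + 1)} (h : j ≤ i) : Umat n N pos i j = 0 :=
  astarF_eq_zero n N pos (by rw [Fin.le_def] at h; omega)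

lemma Umat_pow_eq_zero (k : ℕ) {i j : Fin (n + 1)} (h : (j : ℕ) < i + k) :
    (Umat n N pos ^ k) i j = 0 := by
  induction k generalizing j with
  | zero =>
    have : i ≠ j := fun e => by rw [e] at h; omega
    rw [pow_zero, Matrix.one_apply_ne this]
  | succ k ih =>
    rw [pow_succ, Matrix.mul_apply]
    refine Finset.sum_eq_zero fun l _ => ?_
    rcases lt_or_ge (l : ℕ) (i + k) with h1 | h1
    · rw [ih h1, zero_mul]
    · rw [Umat_eq_zero n N pos (Fin.le_def.2 (by omega)), mul_zero]

lemma Umat_pow : Umat n N pos ^ (n + 1) = 0 := by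
  ext1 i j
  exact Umat_pow_eq_zero n N pos _ (by omega)

lemma Xmat_mul_Ymat : Xmat n N pos * Ymat n N pos = 1 := by
  rw [Xmat, Ymat, mul_neg_geom_sum, Umat_pow, sub_zero]

lemma Ymat_mul_Xmat : Ymat n N pos * Xmat n N pos = 1 := by
  rw [Xmat, Ymat, geom_sum_mul_neg, Umat_pow, sub_zero]

lemma Xmat_eq_zero {i j : Fin (n + 1)} (h : j < i) : Xmat n N pos i j = 0 := by
  rw [Xmat, Matrix.sub_apply, Umat_eq_zero n N pos h.le, Matrix.one_apply_ne h.ne', sub_zero]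

lemma Xmat_self (i : Fin (n + 1)) : Xmat n N pos i i = 1 := by
  rw [Xmat, Matrix.sub_apply, Umat_eq_zero n N pos le_rfl, Matrix.one_apply_eq, sub_zero]

lemma Umat_mem : Umat n N pos ∈ (loopAlg (G := MM N) (annihilators n N pos)).matrix :=
  fun i j => astarF_mem n N pos (i + 1) (j + 1)

lemma Xmat_mem : Xmat n N pos ∈ (loopAlg (G := MM N) (annihilators n N pos)).matrix :=
  sub_mem (one_mem _) (Umat_mem n N pos)

lemma Ymat_mem : Ymat n N pos ∈ (loopAlg (G := MM N) (annihilators n N pos)).matrix :=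
  sum_mem fun _ _ => pow_mem (Umat_mem n N pos) _

lemma loopAlg_annihilators_commute : ∀ a ∈ loopAlg (G := MM N) (annihilators n N pos),
    ∀ b ∈ loopAlg (G := MM N) (annihilators n N pos), Commute a b :=
  fun _ ha _ hb => commute_of_mem_loopAlg (annihilators_commute n N pos) ha hb

variable (A : Matrix (Fin (n + 1)) (Fin (n + 1)) ℂ) (m : MM N)

lemma Pmat_mem : Pmat n N pos A m ∈ (loopAlg (G := MM N) (annihilators n N pos)).matrix :=
  scalar_mul_mem (shift_mem_loopAlg _ _)
    (mul_mem (mul_mem (Xmat_mem n N pos) (cmat_mem _ A)) (Ymat_mem n N pos))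

lemma Hmat_mem (p : Fin (N + 1)) :
    Hmat n N pos A m p ∈ (loopAlg (G := MM N) (annihilators n N pos)).matrix :=
  scalar_mul_mem (shift_mem_loopAlg _ (-m)) (mul_mem (mul_mem (cmat_mem _ A) (Ymat_mem n N pos))
    (scalar_lie_mem (fun _ hc => lie_degOp_mem hc (degNeg p)) (Xmat_mem n N pos)))

lemma trace_Pmat (hA : A.trace = 0) : (Pmat n N pos A m).trace = 0 := by
  rw [Pmat, trace_scalar_mul, mul_assoc,
    trace_mul_comm_of_mem (loopAlg_annihilators_commute n N pos) (Xmat_mem n N pos)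
      (mul_mem (cmat_mem _ A) (Ymat_mem n N pos)), mul_assoc, Ymat_mul_Xmat, mul_one, trace_cmat,
    hA, map_zero, mul_zero]

lemma up_Pmat_mul_Xmat_eq_zero {i j : Fin (n + 1)} (h : j ≤ i) :
    (up (Pmat n N pos A m) * Xmat n N pos) i j = 0 := by
  rw [Matrix.mul_apply]
  refine Finset.sum_eq_zero fun k _ => ?_
  rcases lt_or_ge i k with h1 | h1
  · rw [Xmat_eq_zero n N pos (h.trans_lt h1), mul_zero]
  · rw [up_apply, if_neg h1.not_gt, zero_mul]

variable (kappa : MM N → Fin (N + 1) → ℂ) (lam : ℕ → ℂ)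

/-- The part of the realization containing the operators `a_{ij}`. -/
def creationPart : Module.End ℂ (Fock n N pos) :=
  ∑ i : Fin (n + 1), ∑ j : Fin (n + 1), pair (aL n N pos (i + 1) (j + 1))
    ∘ₗ (up (Pmat n N pos A m) * Xmat n N pos) i j ∘ₗ incl

/-- The Cartan currents and the central currents. -/
def currents : Fin (n + 1) ⊕ Fin (N + 1) → MM N → Module.End ℂ (Fock n N pos) :=
  Sum.elim (fun i => PhiP n N pos kappa lam i) fun p => scal fun l => kappa l p

/-- The coefficients of the currents in the realization. -/
def currentCoef : Fin (n + 1) ⊕ Fin (N + 1) → LoopEnd (MM N) (Fock n N pos) :=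
  Sum.elim (fun i => Pmat n N pos A m i i) fun p => (Hmat n N pos A m p).trace

/-- The part of the realization containing the currents. -/
def currentPart : Module.End ℂ (Fock n N pos) :=
  ∑ a, pair (currents n N pos kappa lam a) ∘ₗ currentCoef n N pos A m a ∘ₗ incl

/-- The action of the loop `A t^{-m}` of matrices on the Fock space. -/
def rho : Module.End ℂ (Fock n N pos) :=
  creationPart n N pos A m + currentPart n N pos A m kappa lam

variable {n N pos A m kappa lam}

lemma currentCoef_mem (a : Fin (n + 1) ⊕ Fin (N + 1)) :
    currentCoef n N pos A m a ∈ loopAlg (G := MM N) (annihilators n N pos) := by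
  rcases a with i | p
  · exact Pmat_mem n N pos A m i i
  · have : (Hmat n N pos A m p).trace ∈ loopAlg (G := MM N) (annihilators n N pos) := by
      rw [Matrix.trace]
      exact Subalgebra.sum_mem _ fun i _ => Hmat_mem n N pos A m p i i
    exact this

lemma lie_pair {G V : Type*} [AddCommGroup G] [AddCommGroup V] [Module ℂ V]
    (D : Module.End ℂ V) (P : G → Module.End ℂ V) {f : Module.End ℂ (G →₀ V)}
    (hf : Commute f (cw D)) :
    ⁅D, pair P ∘ₗ f ∘ₗ incl⁆ = pair (fun l => ⁅D, P l⁆) ∘ₗ f ∘ₗ incl := by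
  have key : ∀ u : G →₀ V, D (pair P u) - pair P (cw D u) = pair (fun l => ⁅D, P l⁆) u := by
    intro u
    have : D ∘ₗ pair P - pair P ∘ₗ cw D = pair fun l => ⁅D, P l⁆ :=
      loop_hom_ext fun l v => by simp [Ring.lie_def]
    rw [← this]
    rfl
  refine LinearMap.ext fun w => ?_
  have h := LinearMap.congr_fun hf (incl w)
  simp only [Module.End.mul_apply] at h
  simp only [Ring.lie_def, LinearMap.sub_apply, Module.End.mul_apply, LinearMap.comp_apply] at key ⊢
  rw [← key, ← cw_incl, h]

lemma astarL_commute_currents (i j : ℕ) (k : MM N) (a : Fin (n + 1) ⊕ Fin (N + 1)) (l : MM N) :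
    ⁅astarL n N pos i j k, currents n N pos kappa lam a l⁆ = 0 := by
  rw [← commute_iff_lie_eq]
  rcases a with r | p
  · exact astarL_commute_PhiP ..
  · exact (Commute.one_right _).smul_right _

lemma lie_astarL_currentPart (i j : ℕ) (k : MM N) :
    ⁅astarL n N pos i j k, currentPart n N pos A m kappa lam⁆ = 0 := by
  rw [currentPart, LieRing.of_associative_ring_bracket, Finset.mul_sum, Finset.sum_mul,
    ← Finset.sum_sub_distrib]
  refine Finset.sum_eq_zero fun a _ => ?_
  rw [← Ring.lie_def, lie_pair]
  · simp only [astarL_commute_currents]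
    refine LinearMap.ext fun w => ?_
    rw [LinearMap.comp_apply, pair_eq_sum]
    simp
  · exact commute_cw_of_mem (currentCoef_mem a) fun d hd =>
      annihilators_commute n N pos d hd _ ⟨_, _, _, rfl⟩

lemma pair_zero {G V : Type*} [AddCommGroup G] [AddCommGroup V] [Module ℂ V] :
    pair (fun _ : G => (0 : Module.End ℂ V)) = 0 :=
  loop_hom_ext fun l v => by simp

lemma pair_indicator {G V : Type*} [AddCommGroup G] [AddCommGroup V] [Module ℂ V] [DecidableEq G]
    (k : G) (u : G →₀ V) :
    pair (fun l : G => if l = -k then (-1 : Module.End ℂ V) else 0) u = -u k := by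
  induction u using Finsupp.induction_linear with
  | zero => simp
  | add f g hf hg => rw [map_add, hf, hg, Finsupp.add_apply, neg_add]
  | single a v =>
    rw [pair_single, Finsupp.single_apply]
    by_cases h : a = k
    · simp [h]
    · simp [h]

lemma lie_astarL_creationPart (i j : Fin (n + 1)) (k : MM N) :
    ⁅astarL n N pos (i + 1) (j + 1) k, creationPart n N pos A m⁆
      = -mode ((up (Pmat n N pos A m) * Xmat n N pos) i j) k := by
  classical
  have hmem := mul_mem (up_mem (Pmat_mem n N pos A m)) (Xmat_mem n N pos)
  have key : ∀ i' j' : Fin (n + 1), ⁅astarL n N pos (i + 1) (j + 1) k,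
      pair (aL n N pos (i' + 1) (j' + 1))
        ∘ₗ (up (Pmat n N pos A m) * Xmat n N pos) i' j' ∘ₗ incl⁆
      = if i' = i ∧ j' = j then -mode ((up (Pmat n N pos A m) * Xmat n N pos) i j) k else 0 := by
    intro i' j'
    rw [lie_pair _ _ (commute_cw_of_mem (hmem i' j') fun d hd =>
      annihilators_commute n N pos d hd _ ⟨_, _, _, rfl⟩)]
    simp only [lie_astarL_aL]
    by_cases h : i' = i ∧ j' = j
    · obtain ⟨rfl, rfl⟩ := h
      rw [if_pos ⟨rfl, rfl⟩]
      rcases lt_or_ge i' j' with h | h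
      · refine LinearMap.ext fun w => ?_
        have h1 : (1 ≤ (i' : ℕ) + 1 ∧ (i' : ℕ) + 1 < j' + 1 ∧ (j' : ℕ) + 1 ≤ n + 1) := by
          rw [Fin.lt_def] at h
          omega
        simp only [h1, true_and]
        exact pair_indicator k _
      · rw [up_Pmat_mul_Xmat_eq_zero n N pos A m h, mode_zero, neg_zero, LinearMap.zero_comp,
          LinearMap.comp_zero]
    · rw [if_neg h]
      have : ∀ l, (if (1 ≤ (i : ℕ) + 1 ∧ (i : ℕ) + 1 < j + 1 ∧ (j : ℕ) + 1 ≤ n + 1)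
          ∧ (i' : ℕ) + 1 = i + 1 ∧ (j' : ℕ) + 1 = j + 1 ∧ l = -k
          then (-1 : Module.End ℂ (Fock n N pos)) else 0) = 0 := fun l => by
        refine if_neg fun h' => h ?_
        exact ⟨Fin.ext (by omega), Fin.ext (by omega)⟩
      simp only [this, pair_zero, LinearMap.zero_comp]
  rw [creationPart, LieRing.of_associative_ring_bracket]
  simp only [Finset.mul_sum, Finset.sum_mul, ← Finset.sum_sub_distrib]
  simp only [← Ring.lie_def, key]
  rw [Finset.sum_eq_single i, Finset.sum_eq_single j, if_pos ⟨rfl, rfl⟩]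
  · exact fun j' _ h => if_neg fun h' => h h'.2
  · simp
  · exact fun i' _ h => Finset.sum_eq_zero fun j' _ => if_neg fun h' => h h'.1
  · simp

lemma lie_astarL_rho (i j : Fin (n + 1)) (k : MM N) :
    ⁅astarL n N pos (i + 1) (j + 1) k, rho n N pos A m kappa lam⁆
      = -mode ((up (Pmat n N pos A m) * Xmat n N pos) i j) k := by
  rw [rho, Ring.lie_def, mul_add, add_mul, add_sub_add_comm, ← Ring.lie_def, ← Ring.lie_def,
    lie_astarL_creationPart, lie_astarL_currentPart, add_zero]

lemma lie_Xmat_rho :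
    ⁅Xmat n N pos, Matrix.scalar (Fin (n + 1))
      (cw (rho n N pos A m kappa lam) : LoopEnd (MM N) (Fock n N pos))⁆
      = up (Pmat n N pos A m) * Xmat n N pos := by
  have hmem := mul_mem (up_mem (Pmat_mem n N pos A m)) (Xmat_mem n N pos)
  ext1 i j
  rw [lie_scalar_apply, Xmat, Matrix.sub_apply, ← Xmat, Ring.lie_def, sub_mul, mul_sub,
    sub_sub_sub_comm,
    ← Ring.lie_def, ← Ring.lie_def, Umat_apply]
  have h1 : ⁅(1 : Matrix (Fin (n + 1)) (Fin (n + 1)) (LoopEnd (MM N) (Fock n N pos))) i j,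
      (cw (rho n N pos A m kappa lam) : LoopEnd (MM N) (Fock n N pos))⁆ = 0 := by
    rw [Matrix.one_apply]
    split_ifs <;> simp [Ring.lie_def]
  have h2 : ⁅astarF n N pos (i + 1) (j + 1),
      (cw (rho n N pos A m kappa lam) : LoopEnd (MM N) (Fock n N pos))⁆
      = -(up (Pmat n N pos A m) * Xmat n N pos) i j := by
    refine IsLoop.lie_cw (mem_loopAlg.1 (astarF_mem n N pos _ _)).1
      (mem_loopAlg.1 (neg_mem (hmem i j))).1 _ fun l => ?_
    rw [mode_astarF, lie_astarL_rho, mode_neg]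
  rw [h1, h2, zero_sub, neg_neg]

end Realization

section MainCommutator

variable {n N : ℕ} {pos : MM N → Prop} {kappa : MM N → Fin (N + 1) → ℂ} {lam : ℕ → ℂ}
  (A B : Matrix (Fin (n + 1)) (Fin (n + 1)) ℂ) (k m : MM N)

lemma Pmat_mul_Pmat : Pmat n N pos A k * Pmat n N pos B m
    = Matrix.scalar (Fin (n + 1)) (shift (-(k + m)) : LoopEnd (MM N) (Fock n N pos))
      * (Xmat n N pos * cmat (A * B) * Ymat n N pos) := by
  have h1 : Commute (Matrix.scalar (Fin (n + 1)) (shift (-m) : LoopEnd (MM N) (Fock n N pos)))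
      (Xmat n N pos * cmat A * Ymat n N pos) :=
    scalar_commute_of_mem (loopAlg_annihilators_commute n N pos) (shift_mem_loopAlg _ (-m))
      (mul_mem (mul_mem (Xmat_mem n N pos) (cmat_mem _ A)) (Ymat_mem n N pos))
  have h2 := Ymat_mul_Xmat n N pos
  rw [neg_add, ← shift_mul, map_mul, cmat_mul, Pmat, Pmat]
  generalize Matrix.scalar (Fin (n + 1)) (shift (-m) : LoopEnd (MM N) (Fock n N pos)) = τ at *
  generalize Matrix.scalar (Fin (n + 1)) (shift (-k) : LoopEnd (MM N) (Fock n N pos)) = σ at *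
  have h1' := h1.eq
  generalize Xmat n N pos = X at *
  generalize Ymat n N pos = Y at *
  linear_combination (norm := noncomm_ring) σ * h1'.symm * X * cmat B * Y
    + σ * τ * X * cmat A * h2 * cmat B * Y

lemma lie_Pmat : ⁅Pmat n N pos B m, Pmat n N pos A k⁆ = Pmat n N pos (B * A - A * B) (k + m) := by
  rw [Ring.lie_def, Pmat_mul_Pmat, Pmat_mul_Pmat, add_comm m, Pmat, cmat_sub, mul_sub, sub_mul,
    mul_sub]

lemma shift_commute_cw (R : Module.End ℂ (Fock n N pos)) :
    Commute (shift (-k) : LoopEnd (MM N) (Fock n N pos)) (cw R) :=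
  isLoop_cw R (-k)

lemma lie_Pmat_rho : ⁅Pmat n N pos A k, Matrix.scalar (Fin (n + 1))
      (cw (rho n N pos B m kappa lam) : LoopEnd (MM N) (Fock n N pos))⁆
      = ⁅up (Pmat n N pos B m), Pmat n N pos A k⁆ := by
  have h1 : ∀ i j, Commute (shift (-k) : LoopEnd (MM N) (Fock n N pos))
      (up (Pmat n N pos B m) i j) := fun i j =>
    loopAlg_annihilators_commute n N pos _ (shift_mem_loopAlg _ (-k)) _
      (up_mem (Pmat_mem n N pos B m) i j)
  have h2 := lie_Xmat_rho (n := n) (N := N) (pos := pos) (A := B) (m := m) (kappa := kappa)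
    (lam := lam)
  exact lie_deform (A := A) (t := shift (-k)) (U := up (Pmat n N pos B m))
    (P := Pmat n N pos A k) (Xmat_mul_Ymat n N pos) (Ymat_mul_Xmat n N pos) h2 h1
    (shift_commute_cw k _) (by rw [Pmat])

lemma lie_scalar_sub_eq_zero {ι R : Type*} [Fintype ι] [DecidableEq ι] [Ring R]
    {X : Matrix ι ι R} {a b : R} (h : ⁅X, Matrix.scalar ι a⁆ = ⁅X, Matrix.scalar ι b⁆) :
    ⁅X, Matrix.scalar ι (a - b)⁆ = 0 := by
  rw [Ring.lie_def, map_sub, mul_sub, sub_mul, sub_sub_sub_comm, ← Ring.lie_def, ← Ring.lie_def, h,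
    sub_self]

lemma astarL_commute_commutator (i j : ℕ) (l : MM N) :
    Commute (astarL n N pos i j l)
      (rho n N pos A k kappa lam * rho n N pos B m kappa lam
        - rho n N pos B m kappa lam * rho n N pos A k kappa lam
        - rho n N pos (B * A - A * B) (k + m) kappa lam) := by
  set Z := rho n N pos A k kappa lam * rho n N pos B m kappa lam
        - rho n N pos B m kappa lam * rho n N pos A k kappa lam
        - rho n N pos (B * A - A * B) (k + m) kappa lam with hZ
  have h1 := lie_lie_eq_up (lie_Xmat_rho (n := n) (N := N) (pos := pos) (A := A) (m := k)
    (kappa := kappa) (lam := lam))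
    (lie_Xmat_rho (A := B) (m := m) (kappa := kappa) (lam := lam))
    (lie_Pmat_rho (kappa := kappa) (lam := lam) A B k m)
    (lie_Pmat_rho (kappa := kappa) (lam := lam) B A m k)
  rw [lie_Pmat, ← lie_Xmat_rho (kappa := kappa) (lam := lam)] at h1
  by_cases h : 1 ≤ i ∧ i < j ∧ j ≤ n + 1
  · have h2 : ⁅Xmat n N pos,
        Matrix.scalar (Fin (n + 1)) (cw Z : LoopEnd (MM N) (Fock n N pos))⁆ = 0 := by
      rw [hZ, cw_sub, cw_sub, cw_mul, cw_mul]
      exact lie_scalar_sub_eq_zero h1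
    have h3 := congrFun (congrFun h2 ⟨i - 1, by omega⟩) ⟨j - 1, by omega⟩
    have h4 : i - 1 + 1 = i := by omega
    have h5 : j - 1 + 1 = j := by omega
    rw [lie_scalar_apply, Matrix.zero_apply, ← commute_iff_lie_eq, Xmat, Matrix.sub_apply,
      Matrix.one_apply_ne (by simp; omega), Umat_apply, zero_sub, Commute.neg_left_iff] at h3
    simp only [h4, h5] at h3
    rw [← mode_astarF]
    exact (commute_cw_iff (mem_loopAlg.1 (astarF_mem n N pos _ _)).1 _).1 h3 l
  · rw [astarL_eq_zero n N pos h]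
    exact Commute.zero_left _

/-- The quotient by the ideal generated by the `x_{ij}(m)`. -/
def modX (n N : ℕ) (pos : MM N → Prop) : Fock n N pos →ₗ[ℂ] (Fock n N pos ⧸ xideal n N pos) :=
  (Ideal.Quotient.mkₐ ℂ (xideal n N pos)).toLinearMap

lemma modX_eq_zero {w : Fock n N pos} : modX n N pos w = 0 ↔ w ∈ xideal n N pos :=
  Ideal.Quotient.eq_zero_iff_mem

lemma modX_creationPart (w : Fock n N pos) : modX n N pos (creationPart n N pos A m w) = 0 := by
  rw [modX_eq_zero, creationPart]
  simp only [LinearMap.sum_apply, LinearMap.comp_apply, pair_eq_sum]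
  exact sum_mem fun i _ => sum_mem fun j _ => sum_mem fun l _ => aL_mem_xideal _ _ _ _

lemma currents_mem_xideal (a : Fin (n + 1) ⊕ Fin (N + 1)) (l : MM N) {w : Fock n N pos}
    (hw : w ∈ xideal n N pos) : currents n N pos kappa lam a l w ∈ xideal n N pos := by
  rcases a with i | p
  · exact PhiP_mem_xideal _ _ hw
  · change kappa (-l) p • w ∈ _
    rw [MvPolynomial.smul_eq_C_mul]
    exact Ideal.mul_mem_left _ _ hw

lemma modX_pair_currents (a : Fin (n + 1) ⊕ Fin (N + 1)) (u : MM N →₀ Fock n N pos) :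
    modX n N pos (pair (currents n N pos kappa lam a) (cw (rho n N pos B m kappa lam) u))
      = modX n N pos (pair (currents n N pos kappa lam a)
          (cw (currentPart n N pos B m kappa lam) u)) := by
  rw [← sub_eq_zero, ← map_sub, ← map_sub, ← LinearMap.sub_apply, ← cw_sub, rho,
    add_sub_cancel_right, modX_eq_zero, pair_eq_sum]
  refine sum_mem fun l _ => currents_mem_xideal _ _ ?_
  rw [cw_apply]
  exact modX_eq_zero.1 (modX_creationPart ..)

lemma modX_rho_rho (w : Fock n N pos) :
    modX n N pos (rho n N pos A k kappa lam (rho n N pos B m kappa lam w))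
      = modX n N pos ((∑ a, pair (currents n N pos kappa lam a)
          (cw (currentPart n N pos B m kappa lam) (currentCoef n N pos A k a (incl w))))
        + ∑ a, pair (currents n N pos kappa lam a)
          (⁅currentCoef n N pos A k a,
            (cw (rho n N pos B m kappa lam) : LoopEnd (MM N) (Fock n N pos))⁆ (incl w))) := by
  have h1 : ∀ a, pair (currents n N pos kappa lam a) (currentCoef n N pos A k a
        (incl (rho n N pos B m kappa lam w)))
      = pair (currents n N pos kappa lam a) (cw (rho n N pos B m kappa lam)
          (currentCoef n N pos A k a (incl w)))
        + pair (currents n N pos kappa lam a)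
          (⁅currentCoef n N pos A k a,
            (cw (rho n N pos B m kappa lam) : LoopEnd (MM N) (Fock n N pos))⁆ (incl w)) :=
    fun a => by
      rw [← map_add]
      congr 1
      rw [Ring.lie_def, LinearMap.sub_apply, Module.End.mul_apply, Module.End.mul_apply, cw_incl]
      abel
  conv_lhs => rw [rho, LinearMap.add_apply, map_add, modX_creationPart, zero_add, currentPart]
  simp only [LinearMap.sum_apply, LinearMap.comp_apply, h1, map_sum, map_add, modX_pair_currents]
  rw [Finset.sum_add_distrib]

/-- The structure constants of the currents. -/
def currentBracket (n N : ℕ) : Fin (n + 1) ⊕ Fin (N + 1) → Fin (n + 1) ⊕ Fin (N + 1) → ℂ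
  | Sum.inl i, Sum.inl j => if (i : ℕ) < n ∧ (j : ℕ) < n then -(kron i j + 1) else 0
  | _, _ => 0

lemma currents_sub
    (htri : ∀ a : MM N, pos a ∨ a = 0 ∨ pos (-a))
    (hdisj : ∀ a : MM N, pos a → ¬ pos (-a))
    (hE1 : ∀ m : MM N, ∑ p : Fin (N + 1), (m p : ℂ) * kappa m p = 0)
    (hE2 : ∀ m k : MM N, pos m → pos k →
      ∑ p : Fin (N + 1), (m p : ℂ) * kappa (-m - k) p = 0)
    (a b : Fin (n + 1) ⊕ Fin (N + 1)) (l l' : MM N) (v : Fock n N pos) :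
    currents n N pos kappa lam a (-l) (currents n N pos kappa lam b (-l') v)
        - currents n N pos kappa lam b (-l') (currents n N pos kappa lam a (-l) v)
      = currentBracket n N a b • ∑ p, (kappa (l + l') p * degNeg p l) • v := by
  have hs : ∀ (p : Fin (N + 1)) (l : MM N) (v : Fock n N pos),
      currents n N pos kappa lam (Sum.inr p) l v = kappa (-l) p • v := fun _ _ _ => rfl
  rcases a with i | p
  · rcases b with j | q
    · exact PhiP_sub htri hdisj hE1 hE2 i j (by omega) (by omega) l l' v
    · rw [hs, hs, map_smul, sub_self]
      exact (zero_smul ℂ _).symm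
  · rw [hs, hs, map_smul, sub_self]
    cases b <;> exact (zero_smul ℂ _).symm

lemma sum_currentBracket {R : Type*} [Ring R] [Algebra ℂ R] (x y : Fin (n + 1) → R)
    (hx : ∑ i, x i = 0) (hy : ∑ i, y i = 0) :
    ∑ i, ∑ j, currentBracket n N (Sum.inl i) (Sum.inl j) • (x i * y j) = -∑ i, x i * y i := by
  simp only [currentBracket, kron, Fin.sum_univ_castSucc] at *
  simp only [Fin.val_castSucc, Fin.is_lt, Fin.val_last, lt_irrefl, and_false, and_true,
    if_false, if_true, zero_smul, Finset.sum_const_zero, add_zero, neg_smul, add_smul, one_smul,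
    Finset.sum_neg_distrib, Finset.sum_add_distrib]
  rw [← Finset.sum_mul_sum, eq_neg_of_add_eq_zero_left hx, eq_neg_of_add_eq_zero_left hy,
    neg_mul_neg]
  simp [← Fin.ext_iff]

end MainCommutator

section Representation

variable {n N : ℕ} {pos : MM N → Prop} {kappa : MM N → Fin (N + 1) → ℂ} {lam : ℕ → ℂ}
  (A B : Matrix (Fin (n + 1)) (Fin (n + 1)) ℂ) (k m : MM N)

lemma sum_pair_scal_lie_degOp (hE1 : ∀ m : MM N, ∑ p : Fin (N + 1), (m p : ℂ) * kappa m p = 0)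
    (h : LoopEnd (MM N) (Fock n N pos)) (w : Fock n N pos) :
    ∑ p, pair (scal fun l => kappa l p)
      (⁅(degOp (degNeg p) : LoopEnd (MM N) (Fock n N pos)), h⁆ (incl w)) = 0 := by
  have h1 : ∀ p l, (⁅(degOp (degNeg p) : LoopEnd (MM N) (Fock n N pos)), h⁆ (incl w)) l
      = degNeg p l • h (incl w) l := fun p l => by
    rw [← mode_apply, mode_lie_degOp]
    rfl
  have h2 : ∀ p, pair (scal fun l => kappa l p)
      (⁅(degOp (degNeg p) : LoopEnd (MM N) (Fock n N pos)), h⁆ (incl w))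
      = ∑ l ∈ (h (incl w)).support, (kappa l p * degNeg p l) • h (incl w) l := fun p => by
    rw [pair_eq_sum_of_subset (s := (h (incl w)).support)]
    · refine Finset.sum_congr rfl fun l _ => ?_
      rw [h1, mul_smul, scal, neg_neg]
      rfl
    · intro l hl
      rw [Finsupp.mem_support_iff] at hl ⊢
      exact fun h0 => hl (by rw [h1, h0, smul_zero])
  simp only [h2]
  rw [Finset.sum_comm]
  refine Finset.sum_eq_zero fun l _ => ?_
  rw [← Finset.sum_smul]
  have h3 : ∑ p, kappa l p * degNeg p l = 0 := by
    rw [← neg_eq_zero, ← hE1 l, ← Finset.sum_neg_distrib]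
    refine Finset.sum_congr rfl fun p _ => ?_
    change -(kappa l p * -(l p : ℂ)) = _
    ring
  rw [h3, zero_smul]

lemma lie_currentCoef_inl_sub (i : Fin (n + 1)) :
    ⁅Pmat n N pos A k i i, (cw (rho n N pos B m kappa lam) : LoopEnd (MM N) (Fock n N pos))⁆
      - ⁅Pmat n N pos B m i i, (cw (rho n N pos A k kappa lam) : LoopEnd (MM N) (Fock n N pos))⁆
      = Pmat n N pos (B * A - A * B) (k + m) i i := by
  rw [← lie_scalar_apply, ← lie_scalar_apply, lie_Pmat_rho, lie_Pmat_rho, ← lie_Pmat,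
    ← Matrix.sub_apply]
  exact lie_sub_lie_apply_self _ _ (fun _ _ _ _ => loopAlg_annihilators_commute n N pos _
    (Pmat_mem n N pos A k _ _) _ (Pmat_mem n N pos B m _ _)) i

lemma lie_trace_Hmat_sub (hAB : (A * B).trace = 0) (p : Fin (N + 1)) :
    ⁅(Hmat n N pos A k p).trace, (cw (rho n N pos B m kappa lam) : LoopEnd (MM N) (Fock n N pos))⁆
      - ⁅(Hmat n N pos B m p).trace,
        (cw (rho n N pos A k kappa lam) : LoopEnd (MM N) (Fock n N pos))⁆
      = (Hmat n N pos (B * A - A * B) (k + m) p).trace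
        + ⁅(degOp (degNeg p) : LoopEnd (MM N) (Fock n N pos)),
          (Pmat n N pos A k * up (Pmat n N pos B m)).trace⁆
        + ∑ i, ⁅(degOp (degNeg p) : LoopEnd (MM N) (Fock n N pos)), Pmat n N pos A k i i⁆
          * Pmat n N pos B m i i := by
  have h1 := lie_Xmat_rho (n := n) (N := N) (pos := pos) (A := A) (m := k) (kappa := kappa)
    (lam := lam)
  have h2 := lie_Xmat_rho (n := n) (N := N) (pos := pos) (A := B) (m := m) (kappa := kappa)
    (lam := lam)
  have h3 := trace_deform_degree_sub (D := degOp (degNeg p)) (t := shift (-k)) (s := shift (-m))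
    (A := A) (B := B) (P := Pmat n N pos A k) (Q := Pmat n N pos B m)
    (loopAlg_annihilators_commute n N pos) (fun _ hc => lie_degOp_mem hc (degNeg p))
    (Xmat_mul_Ymat n N pos) (Ymat_mul_Xmat n N pos) (Xmat_mem n N pos) (Ymat_mem n N pos)
    (shift_mem_loopAlg _ (-k)) (shift_mem_loopAlg _ (-m)) hAB (by rw [Pmat]) (by rw [Pmat]) h1 h2
    (shift_commute_cw k _) (shift_commute_cw m _) (degOp_commute_cw _ _) (degOp_commute_cw _ _)
  rw [shift_mul, ← neg_add] at h3
  exact h3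

theorem rho_commutator
    (htri : ∀ a : MM N, pos a ∨ a = 0 ∨ pos (-a))
    (hdisj : ∀ a : MM N, pos a → ¬ pos (-a))
    (hE1 : ∀ m : MM N, ∑ p : Fin (N + 1), (m p : ℂ) * kappa m p = 0)
    (hE2 : ∀ m k : MM N, pos m → pos k →
      ∑ p : Fin (N + 1), (m p : ℂ) * kappa (-m - k) p = 0)
    (hA : A.trace = 0) (hB : B.trace = 0) (hAB : (A * B).trace = 0) :
    rho n N pos A k kappa lam * rho n N pos B m kappa lam
      - rho n N pos B m kappa lam * rho n N pos A k kappa lam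
      = rho n N pos (B * A - A * B) (k + m) kappa lam := by
  classical
  rw [← sub_eq_zero]
  refine eq_zero_of_commute_dconst {v | ∃ i j h m, v = xvar n N pos i j h m} _ ?_ fun w => ?_
  · rintro _ ⟨i, j, h, l, rfl⟩
    rw [dconst_single_xvar]
    exact astarL_commute_commutator ..
  refine modX_eq_zero.1 ?_
  have h1 := current_antisymm (annihilators_commute n N pos) (fun p l => kappa l p) degNeg
    (currents n N pos kappa lam) (currentBracket n N) (currents_sub htri hdisj hE1 hE2)
    (f := currentCoef n N pos A k) (g := currentCoef n N pos B m) currentCoef_mem currentCoef_mem w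
  have h2 : ∑ a, ∑ b, currentBracket n N a b • ∑ p, pair (scal fun l => kappa l p)
        ((⁅(degOp (degNeg p) : LoopEnd (MM N) (Fock n N pos)), currentCoef n N pos A k a⁆
          * currentCoef n N pos B m b) (incl w))
      = -∑ p, pair (scal fun l => kappa l p)
        ((∑ i, ⁅(degOp (degNeg p) : LoopEnd (MM N) (Fock n N pos)), Pmat n N pos A k i i⁆
          * Pmat n N pos B m i i) (incl w)) := by
    have hr : ∀ p : Fin (N + 1), ∀ a, currentBracket n N (Sum.inr p) a = 0 := fun _ _ => rfl
    have hr' : ∀ a, ∀ p : Fin (N + 1), currentBracket n N a (Sum.inr p) = 0 := fun a _ => by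
      cases a <;> rfl
    simp only [Fintype.sum_sum_type, hr, hr', zero_smul, Finset.sum_const_zero, add_zero]
    simp only [Finset.smul_sum]
    rw [← Finset.sum_neg_distrib]
    simp only [Finset.sum_comm (s := (Finset.univ : Finset (Fin (n + 1))))
      (t := (Finset.univ : Finset (Fin (N + 1))))]
    refine Finset.sum_congr rfl fun p _ => ?_
    rw [← map_neg, ← LinearMap.neg_apply, ← sum_currentBracket (N := N)]
    · simp only [LinearMap.sum_apply, map_sum, LinearMap.smul_apply, map_smul]
      rfl
    · have := trace_Pmat n N pos A k hA
      rw [Matrix.trace] at this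
      simp only [Ring.lie_def, ← Finset.mul_sum, ← Finset.sum_mul, Finset.sum_sub_distrib]
      simp only [Matrix.diag_apply] at this
      rw [this, mul_zero, zero_mul, sub_zero]
    · exact trace_Pmat n N pos B m hB
  have h3 : ∑ a, pair (currents n N pos kappa lam a) (⁅currentCoef n N pos A k a,
            (cw (rho n N pos B m kappa lam) : LoopEnd (MM N) (Fock n N pos))⁆ (incl w))
      - ∑ a, pair (currents n N pos kappa lam a) (⁅currentCoef n N pos B m a,
            (cw (rho n N pos A k kappa lam) : LoopEnd (MM N) (Fock n N pos))⁆ (incl w))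
      = currentPart n N pos (B * A - A * B) (k + m) kappa lam w
        + ∑ p, pair (scal fun l => kappa l p)
        ((∑ i, ⁅(degOp (degNeg p) : LoopEnd (MM N) (Fock n N pos)), Pmat n N pos A k i i⁆
          * Pmat n N pos B m i i) (incl w)) := by
    rw [← Finset.sum_sub_distrib]
    simp only [← map_sub, ← LinearMap.sub_apply]
    rw [Fintype.sum_sum_type]
    have hl : ∀ i, ⁅currentCoef n N pos A k (Sum.inl i),
          (cw (rho n N pos B m kappa lam) : LoopEnd (MM N) (Fock n N pos))⁆
        - ⁅currentCoef n N pos B m (Sum.inl i),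
          (cw (rho n N pos A k kappa lam) : LoopEnd (MM N) (Fock n N pos))⁆
        = currentCoef n N pos (B * A - A * B) (k + m) (Sum.inl i) :=
      lie_currentCoef_inl_sub A B k m
    have hr := lie_trace_Hmat_sub (pos := pos) (kappa := kappa) (lam := lam) A B k m hAB
    have hc : ∀ A k p, currentCoef n N pos A k (Sum.inr p) = (Hmat n N pos A k p).trace :=
      fun _ _ _ => rfl
    have hs : ∀ p, currents n N pos kappa lam (Sum.inr p) = scal fun l => kappa l p := fun _ => rfl
    simp only [hl, hc, hr, hs, LinearMap.add_apply, map_add, Finset.sum_add_distrib]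
    rw [sum_pair_scal_lie_degOp hE1, add_zero, ← add_assoc]
    congr 1
    rw [currentPart, LinearMap.sum_apply, Fintype.sum_sum_type]
    rfl
  rw [LinearMap.sub_apply, LinearMap.sub_apply, Module.End.mul_apply, Module.End.mul_apply,
    map_sub, map_sub, modX_rho_rho, modX_rho_rho, ← map_sub, add_sub_add_comm, h3]
  unfold currentPart at h1 ⊢
  rw [h1, h2, rho, LinearMap.add_apply, map_add (modX n N pos) (creationPart n N pos _ _ w),
    modX_creationPart, zero_add, ← map_sub, currentPart]
  convert map_zero (modX n N pos)
  abel

end Representation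

section Convolution

section Modes

variable {G V : Type*} [AddCommGroup G] [AddCommGroup V] [Module ℂ V]

/-- The modes `Σ_k P_{m-k} f_k` of the product of a family of operators with a loop. -/
def conv (P : G → Module.End ℂ V) (f : LoopEnd G V) (m : G) : Module.End ℂ V :=
  pair P ∘ₗ (shift (-m) * f) ∘ₗ incl

lemma finsum_eq_pair (P : G → Module.End ℂ V) (m : G) (u : G →₀ V) :
    ∑ᶠ k, P k (u (m - k)) = pair P (shift (-m) u) := by
  have h1 : ∀ u : G →₀ V, pair P (shift (-m) u) = ∑ l ∈ u.support, P (m - l) (u l) := fun u => by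
    conv_lhs => rw [← u.sum_single, Finsupp.sum, map_sum, map_sum]
    simp [sub_eq_add_neg, add_comm]
  rw [h1, ← finsum_comp_equiv (Equiv.subLeft m)]
  simp only [Equiv.subLeft_apply, sub_sub_cancel]
  refine finsum_eq_sum_of_support_subset _ fun l hl => ?_
  rw [Finset.mem_coe, Finsupp.mem_support_iff]
  exact fun h => hl (by simp only [h, map_zero])

lemma conv_one (P : G → Module.End ℂ V) (m : G) : conv P 1 m = P m := by
  refine LinearMap.ext fun w => ?_
  simp [conv, incl_apply]

lemma conv_zero (P : G → Module.End ℂ V) (m : G) : conv P 0 m = 0 := by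
  rw [conv, mul_zero, LinearMap.zero_comp, LinearMap.comp_zero]

lemma conv_neg (P : G → Module.End ℂ V) (f : LoopEnd G V) (m : G) :
    conv P (-f) m = -conv P f m := by
  refine LinearMap.ext fun w => ?_
  simp [conv]

lemma conv_add (P : G → Module.End ℂ V) (f g : LoopEnd G V) (m : G) :
    conv P (f + g) m = conv P f m + conv P g m := by
  rw [conv, mul_add, LinearMap.add_comp, LinearMap.comp_add, conv, conv]

lemma conv_sum {ι : Type*} (s : Finset ι) (P : G → Module.End ℂ V) (f : ι → LoopEnd G V) (m : G) :
    conv P (∑ i ∈ s, f i) m = ∑ i ∈ s, conv P (f i) m := by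
  refine LinearMap.ext fun w => ?_
  simp [conv, Finset.mul_sum, LinearMap.sum_apply]

lemma sum_conv {ι : Type*} (s : Finset ι) (P : ι → G → Module.End ℂ V) (f : LoopEnd G V) (m : G) :
    conv (fun l => ∑ i ∈ s, P i l) f m = ∑ i ∈ s, conv (P i) f m := by
  refine LinearMap.ext fun w => ?_
  simp only [conv, LinearMap.sum_apply, LinearMap.comp_apply, pair_eq_sum]
  rw [Finset.sum_comm]

lemma conv_mode {f : LoopEnd G V} (hf : IsLoop f) (g : LoopEnd G V) (m : G) :
    conv (mode f) g m = mode (f * g) m := by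
  refine LinearMap.ext fun w => ?_
  rw [conv, LinearMap.comp_apply, LinearMap.comp_apply, Module.End.mul_apply, ← finsum_eq_pair,
    mode_apply, Module.End.mul_apply, hf.apply_eq_sum, ← finsum_comp_equiv (Equiv.subLeft m)]
  simp only [Equiv.subLeft_apply, sub_sub_cancel]
  refine finsum_eq_sum_of_support_subset _ fun l hl => ?_
  rw [Finset.mem_coe, Finsupp.mem_support_iff]
  exact fun h => hl (by simp only [h, map_zero])

lemma conv_conv (P : G → Module.End ℂ V) {f : LoopEnd G V} (hf : IsLoop f) (g : LoopEnd G V)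
    (m : G) : conv (conv P f) g m = conv P (f * g) m := by
  have key : ∀ u : G →₀ V, pair (conv P f) u = pair P (f u) := fun u => by
    induction u using Finsupp.induction_linear with
    | zero => simp
    | add u v hu hv => rw [map_add, hu, hv, map_add, map_add]
    | single l v =>
      rw [pair_single, conv, neg_neg, hf.map_single]
      rfl
  refine LinearMap.ext fun w => ?_
  rw [conv, conv, LinearMap.comp_apply, key, ← mul_assoc, (hf (-m)).eq]
  rfl

lemma commute_conv {S : Set (Module.End ℂ V)} (hS : ∀ a ∈ S, ∀ b ∈ S, Commute a b)
    {P : G → Module.End ℂ V} (hP : ∀ d ∈ S, ∀ l, Commute d (P l)) {f g : LoopEnd G V}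
    (hf : f ∈ loopAlg S) (hg : g ∈ loopAlg S) (k m : G) :
    Commute (mode f k) (conv P g m) := by
  have h1 : ∀ l, Commute (mode f k) (P l) := fun l =>
    (commute_cw_iff (mem_loopAlg.1 hf).1 _).1 (commute_cw_of_mem hf fun d hd => hP d hd l) k
  have hg' : shift (-m) * g ∈ loopAlg S := mul_mem (shift_mem_loopAlg _ _) hg
  rw [commute_iff_lie_eq, conv, lie_pair]
  · simp only [(commute_iff_lie_eq).1 (h1 _), pair_zero, LinearMap.zero_comp]
  · exact commute_cw_of_mem hg' fun d hd => ((commute_cw_iff (mem_loopAlg.1 hf).1 _).1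
      (commute_cw_of_mem hf fun d' hd' => hS d' hd' d hd) k).symm

end Modes

variable {n N : ℕ} {pos : MM N → Prop}

lemma fmul_mode (P : MM N → Module.End ℂ (Fock n N pos)) (f : LoopEnd (MM N) (Fock n N pos))
    (m : MM N) :
    fmul n N pos (fun k => ⇑(P k)) (fun k => ⇑(mode f k)) m = conv P f m :=
  funext fun w => finsum_eq_pair P m (f (incl w))

lemma fmul_mode_mode {f : LoopEnd (MM N) (Fock n N pos)} (hf : IsLoop f)
    (g : LoopEnd (MM N) (Fock n N pos)) (m : MM N) :
    fmul n N pos (fun k => ⇑(mode f k)) (fun k => ⇑(mode g k)) m = mode (f * g) m := by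
  rw [fmul_mode, conv_mode hf]

lemma fmul_comm_mode (P : MM N → Module.End ℂ (Fock n N pos)) (f : LoopEnd (MM N) (Fock n N pos))
    (h : ∀ k l, Commute (mode f k) (P l)) (m : MM N) :
    fmul n N pos (fun k => ⇑(mode f k)) (fun k => ⇑(P k)) m = conv P f m := by
  rw [← fmul_mode]
  funext w
  rw [fmul, fmul, ← finsum_comp_equiv (Equiv.subLeft m)]
  refine finsum_congr fun k => ?_
  rw [Equiv.subLeft_apply, sub_sub_cancel]
  exact LinearMap.congr_fun (h (m - k) k) w

lemma fprod_mode (L : List (LoopEnd (MM N) (Fock n N pos)))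
    (hL : ∀ f ∈ L, f ∈ loopAlg (annihilators n N pos)) :
    fprod n N pos (L.map fun f m => ⇑(mode f m)) = fun m => ⇑(mode L.prod m) := by
  induction L with
  | nil =>
    funext m w
    classical
    rw [List.prod_nil, mode_apply, Module.End.one_apply, incl_apply, Finsupp.single_apply]
    simp only [eq_comm (a := (0 : MM N))]
    rfl
  | cons f L ih =>
    funext m
    rw [List.map_cons, fprod, ih fun g hg => hL g (List.mem_cons_of_mem _ hg),
      fmul_mode_mode (mem_loopAlg.1 (hL f List.mem_cons_self)).1, List.prod_cons]

lemma fprod_mode_append (P : MM N → Module.End ℂ (Fock n N pos))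
    (hP : ∀ d ∈ annihilators n N pos, ∀ l, Commute d (P l))
    (L : List (LoopEnd (MM N) (Fock n N pos)))
    (hL : ∀ f ∈ L, f ∈ loopAlg (annihilators n N pos)) :
    fprod n N pos ((L.map fun f m => ⇑(mode f m)) ++ [fun m => ⇑(P m)])
      = fun m => ⇑(conv P L.prod m) := by
  induction L with
  | nil =>
    funext m
    have h := fprod_mode (n := n) (N := N) (pos := pos) [] (by simp)
    rw [List.map_nil] at h
    rw [List.map_nil, List.nil_append, fprod, h, fmul_mode]
  | cons f L ih =>
    have hf := hL f List.mem_cons_self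
    have hL' : ∀ g ∈ L, g ∈ loopAlg (annihilators n N pos) :=
      fun g hg => hL g (List.mem_cons_of_mem _ hg)
    have hp := list_prod_mem hL'
    funext m
    rw [List.map_cons, List.cons_append, fprod, ih hL',
      fmul_comm_mode _ _ (commute_conv (annihilators_commute n N pos) hP hf hp),
      conv_conv _ (mem_loopAlg.1 hp).1, List.prod_cons,
      (commute_of_mem_loopAlg (annihilators_commute n N pos) hf hp).eq]

variable (n N pos) in
lemma astar_eq_mode (i j : ℕ) :
    astar n N pos i j = fun m => ⇑(mode (astarF n N pos i j) m) :=
  funext fun _ => by rw [astar_eq, mode_astarF]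

variable (n N pos) in
lemma aop_eq_aL (i j : ℕ) : aop n N pos i j = fun m => ⇑(aL n N pos i j m) :=
  funext fun _ => aop_eq ..

lemma Phi_eq_PhiL (kappa : MM N → Fin (N + 1) → ℂ) (lam : ℕ → ℂ) (i : ℕ) :
    Phi n N pos kappa lam i = fun m => ⇑(PhiL n N pos kappa lam i m) :=
  funext fun _ => Phi_eq ..

/-- The family `(κ·D a*_{ij})_v` as linear maps. -/
def kDL (n N : ℕ) (pos : MM N → Prop) (kappa : MM N → Fin (N + 1) → ℂ) (i j : ℕ) (v : MM N) :
    Module.End ℂ (Fock n N pos) :=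
  ∑ p, conv (scal fun l => kappa l p)
    ⁅(degOp (degNeg p) : LoopEnd (MM N) (Fock n N pos)), astarF n N pos i j⁆ v

lemma kD_eq_kDL (kappa : MM N → Fin (N + 1) → ℂ) (i j : ℕ) :
    kD n N pos kappa i j = fun v => ⇑(kDL n N pos kappa i j v) := by
  funext v w
  have h1 : ∀ p, conv (scal fun l => kappa l p)
      ⁅(degOp (degNeg p) : LoopEnd (MM N) (Fock n N pos)), astarF n N pos i j⁆ v w
      = ∑ᶠ q : MM N, (kappa (q - v) p * -(q p : ℂ)) • astarL n N pos i j q w := fun p => by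
    have h := fmul_mode (n := n) (pos := pos) (scal fun l => kappa l p)
      ⁅(degOp (degNeg p) : LoopEnd (MM N) (Fock n N pos)), astarF n N pos i j⁆ v
    rw [← h, fmul, ← finsum_comp_equiv (Equiv.subLeft v)]
    refine finsum_congr fun q => ?_
    rw [Equiv.subLeft_apply, sub_sub_cancel, mode_lie_degOp, mode_astarF, scal, neg_sub, mul_smul]
    rfl
  have hfin : ∀ p, (Function.support fun q : MM N =>
      (kappa (q - v) p * -(q p : ℂ)) • astarL n N pos i j q w).Finite := fun p =>
    (finite_astarL n N pos i j w).subset fun q hq h => hq (by simp only [h, smul_zero])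
  rw [kDL, LinearMap.sum_apply]
  simp only [h1]
  rw [kD, ← finsum_sum_comm _ _ fun p _ => hfin p]
  refine finsum_congr fun q => ?_
  rw [Finset.sum_smul, astar_eq]

end Convolution

section RootVectors

variable {n N : ℕ} {pos : MM N → Prop} {kappa : MM N → Fin (N + 1) → ℂ} {lam : ℕ → ℂ}

lemma up_scalar_mul {ι R : Type*} [Fintype ι] [LinearOrder ι] [Ring R] (r : R)
    (P : Matrix ι ι R) : up (Matrix.scalar ι r * P) = Matrix.scalar ι r * up P := by
  ext1 i j
  simp only [up_apply, Matrix.scalar_apply, Matrix.diagonal_mul]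
  split_ifs <;> simp

lemma mul_cmat_single_mul_apply {ι R : Type*} [Fintype ι] [LinearOrder ι] [Ring R] [Algebra ℂ R]
    (X Y : Matrix ι ι R) (a b i j : ι) :
    (X * cmat (Matrix.single a b 1) * Y : Matrix ι ι R) i j = X i a * Y b j := by
  have h : (cmat (Matrix.single a b 1) : Matrix ι ι R) = Matrix.single a b 1 := by
    ext1 i j
    simp [cmat, Matrix.single_apply]
  rw [h, Matrix.mul_apply, Finset.sum_eq_single b]
  · simp
  · intro k _ hk
    rw [Matrix.mul_single_apply_of_ne _ _ _ _ _ hk, zero_mul]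
  · simp

lemma rho_single (a b : Fin (n + 1)) (m : MM N) :
    rho n N pos (Matrix.single a b 1) m kappa lam
      = ∑ i : Fin (n + 1), ∑ j : Fin (n + 1), conv (aL n N pos (i + 1) (j + 1))
          (∑ k, if i < k then Xmat n N pos i a * Ymat n N pos b k * Xmat n N pos k j else 0) m
        + (∑ i : Fin (n + 1), conv (PhiP n N pos kappa lam i)
            (Xmat n N pos i a * Ymat n N pos b i) m
          + ∑ p, conv (scal fun l => kappa l p) (∑ c, Ymat n N pos b c
            * ⁅(degOp (degNeg p) : LoopEnd (MM N) (Fock n N pos)), Xmat n N pos c a⁆) m) := by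
  have h1 : ∀ i j, (up (Pmat n N pos (Matrix.single a b 1) m) * Xmat n N pos) i j = shift (-m)
      * ∑ k, if i < k then Xmat n N pos i a * Ymat n N pos b k * Xmat n N pos k j else 0 := by
    intro i j
    rw [Pmat, up_scalar_mul, mul_assoc, Matrix.scalar_apply, Matrix.diagonal_mul, Matrix.mul_apply]
    congr 1
    refine Finset.sum_congr rfl fun k _ => ?_
    rw [up_apply, mul_cmat_single_mul_apply]
    split_ifs <;> simp
  have h2 : ∀ i, currentCoef n N pos (Matrix.single a b 1) m (Sum.inl i)
      = shift (-m) * (Xmat n N pos i a * Ymat n N pos b i) := fun i => by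
    change Pmat n N pos _ m i i = _
    rw [Pmat, Matrix.scalar_apply, Matrix.diagonal_mul, mul_cmat_single_mul_apply]
  have h3 : ∀ p, currentCoef n N pos (Matrix.single a b 1) m (Sum.inr p)
      = shift (-m) * ∑ c, Ymat n N pos b c
        * ⁅(degOp (degNeg p) : LoopEnd (MM N) (Fock n N pos)), Xmat n N pos c a⁆ := fun p => by
    change (Hmat n N pos _ m p).trace = _
    rw [Hmat, trace_scalar_mul]
    congr 1
    rw [mul_assoc, Matrix.trace, Finset.sum_eq_single a]
    · have := mul_cmat_single_mul_apply (1 : Matrix (Fin (n + 1)) (Fin (n + 1))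
        (LoopEnd (MM N) (Fock n N pos))) (Ymat n N pos * ⁅Matrix.scalar (Fin (n + 1))
        (degOp (degNeg p) : LoopEnd (MM N) (Fock n N pos)), Xmat n N pos⁆) a b a a
      rw [one_mul, Matrix.one_apply_eq, one_mul] at this
      rw [Matrix.diag_apply, this, Matrix.mul_apply]
      simp only [scalar_lie_apply]
    · intro i _ hi
      have := mul_cmat_single_mul_apply (1 : Matrix (Fin (n + 1)) (Fin (n + 1))
        (LoopEnd (MM N) (Fock n N pos))) (Ymat n N pos * ⁅Matrix.scalar (Fin (n + 1))
        (degOp (degNeg p) : LoopEnd (MM N) (Fock n N pos)), Xmat n N pos⁆) a b i i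
      rw [one_mul, Matrix.one_apply_ne hi, zero_mul] at this
      rw [Matrix.diag_apply, this]
    · simp
  rw [rho, creationPart, currentPart, Fintype.sum_sum_type]
  simp only [h1, h2, h3]
  rfl

lemma Ymat_eq_zero {i j : Fin (n + 1)} (h : j < i) : Ymat n N pos i j = 0 := by
  rw [Ymat, Matrix.sum_apply]
  exact Finset.sum_eq_zero fun k _ => Umat_pow_eq_zero n N pos k (by rw [Fin.lt_def] at h; omega)

lemma Ymat_apply (i j : Fin (n + 1)) :
    Ymat n N pos i j = (1 : Matrix (Fin (n + 1)) (Fin (n + 1)) (LoopEnd (MM N) (Fock n N pos))) i j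
      + ∑ k, Ymat n N pos i k * Umat n N pos k j := by
  have h : Ymat n N pos = 1 + Ymat n N pos * Umat n N pos := by
    rw [← sub_eq_iff_eq_add, ← Ymat_mul_Xmat, Xmat, mul_sub, mul_one]
  exact congrFun (congrFun h i) j

lemma Ymat_self (i : Fin (n + 1)) : Ymat n N pos i i = 1 := by
  rw [Ymat_apply, Matrix.one_apply_eq, Finset.sum_eq_zero, add_zero]
  intro k _
  rcases lt_or_ge k i with h | h
  · rw [Ymat_eq_zero h, zero_mul]
  · rw [Umat_eq_zero n N pos h, mul_zero]

lemma sum_Ymat_mul_Xmat (i j : Fin (n + 1)) :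
    ∑ k, Ymat n N pos i k * Xmat n N pos k j
      = (1 : Matrix (Fin (n + 1)) (Fin (n + 1)) (LoopEnd (MM N) (Fock n N pos))) i j := by
  rw [← Matrix.mul_apply, Ymat_mul_Xmat]

lemma Xmat_of_ne {i j : Fin (n + 1)} (h : i ≠ j) :
    Xmat n N pos i j = -astarF n N pos (i + 1) (j + 1) := by
  rw [Xmat, Matrix.sub_apply, Matrix.one_apply_ne h, zero_sub, Umat_apply]

lemma lie_Xmat_self (D : LoopEnd (MM N) (Fock n N pos)) (i : Fin (n + 1)) :
    ⁅D, Xmat n N pos i i⁆ = 0 := by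
  rw [Xmat_self, ← commute_iff_lie_eq]
  exact Commute.one_right _

lemma sum_fin_succ {M : Type*} [AddCommMonoid M] (g : ℕ → M) (s : Finset ℕ)
    (hs : s ⊆ Finset.Icc 1 (n + 1)) (h : ∀ i ∈ Finset.Icc 1 (n + 1), i ∉ s → g i = 0) :
    ∑ i : Fin (n + 1), g (i + 1) = ∑ i ∈ s, g i := by
  rw [Fin.sum_univ_eq_sum_range (fun i => g (i + 1)) (n + 1), Finset.sum_subset hs h,
    Finset.range_eq_Ico, Finset.sum_Ico_add' g 0 (n + 1) 1]
  rfl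

lemma rho_single_of_lt {a b : Fin (n + 1)} (hab : a < b) (m : MM N) :
    rho n N pos (Matrix.single a b 1) m kappa lam
      = aL n N pos (a + 1) (b + 1) m - ∑ i : Fin (n + 1), conv (aL n N pos (i + 1) (b + 1))
          (astarF n N pos (i + 1) (a + 1)) m := by
  have h1 : ∀ i j, (∑ k, if i < k then Xmat n N pos i a * Ymat n N pos b k * Xmat n N pos k j
      else 0) = if j = b then Xmat n N pos i a else 0 := fun i j => by
    have : ∀ k, (if i < k then Xmat n N pos i a * Ymat n N pos b k * Xmat n N pos k j else 0)
        = Xmat n N pos i a * (Ymat n N pos b k * Xmat n N pos k j) := fun k => by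
      split_ifs with h
      · rw [mul_assoc]
      · rcases lt_or_ge a i with h' | h'
        · rw [Xmat_eq_zero n N pos h', zero_mul]
        · rw [Ymat_eq_zero (((not_lt.1 h).trans h').trans_lt hab), zero_mul, mul_zero]
    simp only [this]
    rw [← Finset.mul_sum, sum_Ymat_mul_Xmat, Matrix.one_apply]
    simp only [eq_comm (a := b), mul_ite, mul_one, mul_zero]
  have h2 : ∀ i, Xmat n N pos i a * Ymat n N pos b i = 0 := fun i => by
    rcases lt_or_ge a i with h' | h'
    · rw [Xmat_eq_zero n N pos h', zero_mul]
    · rw [Ymat_eq_zero (h'.trans_lt hab), mul_zero]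
  have h3 : ∀ p, ∑ c, Ymat n N pos b c
      * ⁅(degOp (degNeg p) : LoopEnd (MM N) (Fock n N pos)), Xmat n N pos c a⁆ = 0 := fun p =>
    Finset.sum_eq_zero fun c _ => by
      rcases lt_or_ge a c with h' | h'
      · rw [Xmat_eq_zero n N pos h', Ring.lie_def, zero_mul, mul_zero, sub_zero, mul_zero]
      · rw [Ymat_eq_zero (h'.trans_lt hab), zero_mul]
  rw [rho_single]
  simp only [h1, h2, h3, conv_zero, Finset.sum_const_zero, add_zero]
  have h4 : ∀ i : Fin (n + 1), ∑ j : Fin (n + 1), conv (aL n N pos (i + 1) (j + 1))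
        (if j = b then Xmat n N pos i a else 0) m
      = (if i = a then aL n N pos (a + 1) (b + 1) m else 0)
        - conv (aL n N pos (i + 1) (b + 1)) (astarF n N pos (i + 1) (a + 1)) m := fun i => by
    rw [Finset.sum_eq_single b, if_pos rfl]
    · split_ifs with h
      · rw [h, Xmat_self, conv_one, astarF_eq_zero n N pos (by omega), conv_zero, sub_zero]
      · rw [Xmat_of_ne h, conv_neg, zero_sub]
    · intro j _ hj
      rw [if_neg hj, conv_zero]
    · simp
  simp only [h4]
  rw [Finset.sum_sub_distrib, Finset.sum_ite_eq' Finset.univ a, if_pos (Finset.mem_univ a)]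

lemma fmul_aop_astar (i j i' j' : ℕ) (m : MM N) :
    fmul n N pos (aop n N pos i j) (astar n N pos i' j') m
      = conv (aL n N pos i j) (astarF n N pos i' j') m := by
  rw [aop_eq_aL, astar_eq_mode, fmul_mode]

lemma rhoF_eq_rho {r : ℕ} (hr : r + 1 < n + 1) (m : MM N) :
    rhoF n N pos (r + 1) m
      = rho n N pos (Matrix.single ⟨r, by omega⟩ ⟨r + 1, hr⟩ 1) m kappa lam := by
  rw [rho_single_of_lt (by simp), rhoF,
    sum_fin_succ (fun i => conv (aL n N pos i (r + 1 + 1)) (astarF n N pos i (r + 1)) m)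
      (Finset.Ico 1 (r + 1)) (fun i hi => by simp at hi ⊢; omega) fun i hi hi' => by
        simp at hi hi'
        rw [astarF_eq_zero n N pos (by omega), conv_zero]]
  simp only [fmul_aop_astar, aop_eq]
  funext w
  simp [LinearMap.sum_apply]

lemma rhoE_zero_eq_rho (hn : 0 < n) (m : MM N) :
    rhoE n N pos kappa lam 0 m
      = -rho n N pos (Matrix.single 0 (Fin.last n) 1) m kappa lam := by
  rw [rho_single_of_lt (by rw [Fin.lt_def]; simpa using hn), rhoE, if_pos rfl, aop_eq,
    Finset.sum_eq_zero fun i _ => by rw [astarF_eq_zero n N pos (by simp), conv_zero], sub_zero]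
  rfl

end RootVectors

section SimpleRoots

variable {n N : ℕ} {pos : MM N → Prop} {kappa : MM N → Fin (N + 1) → ℂ} {lam : ℕ → ℂ}

lemma conv_aL_eq_zero {i j : ℕ} (h : ¬ (1 ≤ i ∧ i < j ∧ j ≤ n + 1))
    (f : LoopEnd (MM N) (Fock n N pos)) (m : MM N) : conv (aL n N pos i j) f m = 0 := by
  have h0 : aL n N pos i j = fun _ => 0 := funext fun l => by
    rw [aL, negX, dif_neg h]
    exact LinearMap.ext fun w => zero_mul w
  rw [h0, conv, pair_zero, LinearMap.zero_comp]

lemma astarF_commute (i j i' j' : ℕ) : Commute (astarF n N pos i j) (astarF n N pos i' j') :=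
  loopAlg_annihilators_commute n N pos _ (astarF_mem _ _ _ _ _) _ (astarF_mem _ _ _ _ _)

lemma isLoop_astarF (i j : ℕ) : IsLoop (astarF n N pos i j) :=
  (mem_loopAlg.1 (astarF_mem _ _ _ _ _)).1

lemma rhoEn_eq (r : ℕ) (m : MM N) :
    rhoEn n N pos kappa lam r m = ⇑(conv (aL n N pos r (r + 1))
        (astarF n N pos r (r + 1) * astarF n N pos r (r + 1)) m
      - ∑ j ∈ Finset.Icc (r + 2) (n + 1), conv (aL n N pos (r + 1) j) (astarF n N pos r j) m
      + ∑ j ∈ Finset.Ico 1 r, conv (aL n N pos j r) (astarF n N pos j (r + 1)) m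
      + ∑ j ∈ Finset.Icc (r + 2) (n + 1),
        (conv (aL n N pos r j) (astarF n N pos r j * astarF n N pos r (r + 1)) m
          - conv (aL n N pos (r + 1) j) (astarF n N pos (r + 1) j * astarF n N pos r (r + 1)) m)
      + conv (PhiL n N pos kappa lam r) (astarF n N pos r (r + 1)) m
      + kDL n N pos kappa r (r + 1) m) := by
  have h1 : ∀ i j i' j', fmul n N pos (aop n N pos i j) (astar n N pos i' j')
      = fun l => ⇑(conv (aL n N pos i j) (astarF n N pos i' j') l) := fun _ _ _ _ =>
    funext fun l => fmul_aop_astar ..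
  have h2 : ∀ i j i' j' l, fmul n N pos (fmul n N pos (aop n N pos i j) (astar n N pos i' j'))
      (astar n N pos r (r + 1)) l
      = conv (aL n N pos i j) (astarF n N pos i' j' * astarF n N pos r (r + 1)) l :=
    fun i j i' j' l => by
      rw [h1, astar_eq_mode, fmul_mode (conv (aL n N pos i j) (astarF n N pos i' j')),
        conv_conv _ (isLoop_astarF i' j')]
  have h3 : fmul n N pos (aop n N pos r (r + 1)) (fmul n N pos (astar n N pos r (r + 1))
      (astar n N pos r (r + 1))) m
      = conv (aL n N pos r (r + 1)) (astarF n N pos r (r + 1) * astarF n N pos r (r + 1)) m := by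
    rw [astar_eq_mode, funext (fmul_mode_mode (isLoop_astarF r (r + 1)) (astarF n N pos r (r + 1))),
      aop_eq_aL,
      fmul_mode]
  have h4 : fmul n N pos (astar n N pos r (r + 1)) (Phi n N pos kappa lam r) m
      = conv (PhiL n N pos kappa lam r) (astarF n N pos r (r + 1)) m := by
    rw [astar_eq_mode, Phi_eq_PhiL, fmul_comm_mode]
    intro k l
    rw [mode_astarF]
    exact astarL_commute_PhiL ..
  rw [rhoEn]
  simp only [h2]
  simp only [h1, h3, h4, kD_eq_kDL]
  funext w
  simp [LinearMap.sum_apply]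

lemma Ymat_succ {a b : Fin (n + 1)} (hab : (b : ℕ) + 1 = a) :
    Ymat n N pos b a = astarF n N pos (b + 1) (a + 1) := by
  have hba : b < a := by rw [Fin.lt_def]; omega
  rw [Ymat_apply, Matrix.one_apply_ne hba.ne, zero_add, Finset.sum_eq_single b, Ymat_self,
    one_mul, Umat_apply]
  · intro k _ hk
    rcases lt_or_ge k b with h | h
    · rw [Ymat_eq_zero h, zero_mul]
    · rw [Umat_eq_zero, mul_zero]
      have := lt_of_le_of_ne h hk.symm
      rw [Fin.lt_def] at this
      rw [Fin.le_def]
      omega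
  · simp

lemma lie_Xmat_eq_zero (D : LoopEnd (MM N) (Fock n N pos)) {i j : Fin (n + 1)} (h : j ≤ i) :
    ⁅D, Xmat n N pos i j⁆ = 0 := by
  rcases h.lt_or_eq with h | rfl
  · rw [Xmat_eq_zero n N pos h, Ring.lie_def, mul_zero, zero_mul, sub_zero]
  · exact lie_Xmat_self D j

lemma lie_Xmat_of_ne (D : LoopEnd (MM N) (Fock n N pos)) {i j : Fin (n + 1)} (h : i ≠ j) :
    ⁅D, Xmat n N pos i j⁆ = -⁅D, astarF n N pos (i + 1) (j + 1)⁆ := by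
  rw [Xmat_of_ne h]
  refine LinearMap.ext fun w => ?_
  simp [Ring.lie_def, sub_eq_add_neg, add_comm]

lemma sum_Icc_eq_add {M : Type*} [AddCommMonoid M] {a b : ℕ} (h : a ≤ b) (f : ℕ → M) :
    ∑ i ∈ Finset.Icc a b, f i = f a + ∑ i ∈ Finset.Icc (a + 1) b, f i := by
  rw [Finset.Icc_eq_cons_Ioc h, Finset.sum_cons, Finset.Icc_add_one_left_eq_Ioc]

lemma conv_PhiP (i : ℕ) (f : LoopEnd (MM N) (Fock n N pos)) (m : MM N) :
    conv (PhiP n N pos kappa lam i) f m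
      = ∑ r ∈ Finset.Icc (i + 1) n, conv (PhiL n N pos kappa lam r) f m :=
  sum_conv ..

lemma sum_lt_Ymat_mul_Xmat {a b i j : Fin (n + 1)} (hab : (b : ℕ) + 1 = a) (hij : i < j) :
    (∑ k, if i < k then Xmat n N pos i a * Ymat n N pos b k * Xmat n N pos k j else 0)
      = (if i = b then -(astarF n N pos (b + 1) (a + 1) * astarF n N pos (b + 1) (j + 1)) else 0)
        + (if i = a then astarF n N pos (b + 1) (j + 1)
          + astarF n N pos (b + 1) (a + 1) * astarF n N pos (a + 1) (j + 1) else 0)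
        - (if j = b then astarF n N pos (i + 1) (a + 1) else 0) := by
  have hba : b < a := by rw [Fin.lt_def]; omega
  have h1 : ∀ s : Finset (Fin (n + 1)), (∀ k, k ∉ s → k ≤ i → Ymat n N pos b k = 0) →
      (∀ k ∈ s, k ≤ i) →
      (∑ k, if i < k then Xmat n N pos i a * Ymat n N pos b k * Xmat n N pos k j else 0)
      = Xmat n N pos i a * ((if j = b then 1 else 0)
        - ∑ k ∈ s, Ymat n N pos b k * Xmat n N pos k j) := fun s hs hs' => by
    have h2 : (∑ k ∈ s, Ymat n N pos b k * Xmat n N pos k j)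
        = ∑ k, if i < k then 0 else Ymat n N pos b k * Xmat n N pos k j := by
      rw [← Finset.sum_subset (Finset.subset_univ s)]
      · exact Finset.sum_congr rfl fun k hk => by rw [if_neg (not_lt.2 (hs' k hk))]
      · intro k _ hk
        split_ifs with h
        · rfl
        · rw [hs k hk (not_lt.1 h), zero_mul]
    have h3 : (if j = b then (1 : LoopEnd (MM N) (Fock n N pos)) else 0)
        = ∑ k, Ymat n N pos b k * Xmat n N pos k j := by
      rw [sum_Ymat_mul_Xmat, Matrix.one_apply]
      simp only [eq_comm]
    rw [h2, h3, ← Finset.sum_sub_distrib, Finset.mul_sum]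
    refine Finset.sum_congr rfl fun k _ => ?_
    split_ifs
    · rw [sub_zero, mul_assoc]
    · rw [sub_self, mul_zero]
  rcases lt_trichotomy i b with h | rfl | h
  · rw [h1 ∅ (fun k _ hk => Ymat_eq_zero (hk.trans_lt h)) (by simp), if_neg h.ne,
      if_neg (h.trans hba).ne, Finset.sum_empty, sub_zero, Xmat_of_ne (h.trans hba).ne]
    split_ifs <;> simp
  · rw [h1 {i} (fun k hk hk' => Ymat_eq_zero (lt_of_le_of_ne hk' (by simpa using hk))) (by simp),
      if_pos rfl, if_neg hba.ne, if_neg hij.ne', if_neg hij.ne', Finset.sum_singleton, Ymat_self,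
      one_mul, Xmat_of_ne hba.ne, Xmat_of_ne hij.ne]
    refine LinearMap.ext fun w => by simp
  · rw [if_neg h.ne', if_neg (h.trans hij).ne']
    rcases eq_or_ne i a with rfl | h'
    · rw [h1 {b, i} (fun k hk hk' => Ymat_eq_zero ?_) (by simp [h.le]), if_pos rfl,
        if_neg (h.trans hij).ne', Finset.sum_pair h.ne, Ymat_self, Ymat_succ hab, one_mul,
        Xmat_of_ne (h.trans hij).ne, Xmat_of_ne hij.ne, Xmat_self]
      · refine LinearMap.ext fun w => by simp [add_comm]
      · simp only [Finset.mem_insert, Finset.mem_singleton, not_or, Fin.ext_iff, Fin.le_def,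
          Fin.lt_def] at hk hk' h ⊢
        omega
    · rw [if_neg h', Xmat_eq_zero]
      · simp
      · simp only [Fin.ext_iff, Fin.lt_def, ne_eq] at h h' ⊢
        omega

lemma rhoEn_eq_rho {r : ℕ} (hr : r + 1 < n + 1) (m : MM N) :
    rhoEn n N pos kappa lam (r + 1) m
      = -rho n N pos (Matrix.single ⟨r + 1, hr⟩ ⟨r, by omega⟩ 1) m kappa lam := by
  set a : Fin (n + 1) := ⟨r + 1, hr⟩ with ha
  set b : Fin (n + 1) := ⟨r, by omega⟩ with hb
  have hav : (a : ℕ) = r + 1 := rfl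
  have hbv : (b : ℕ) = r := rfl
  have hba : b < a := by rw [Fin.lt_def]; omega
  set U : LoopEnd (MM N) (Fock n N pos) := astarF n N pos (r + 1) (r + 2) with hU
  have h1 : ∀ i j : Fin (n + 1), conv (aL n N pos (i + 1) (j + 1))
      (∑ k, if i < k then Xmat n N pos i a * Ymat n N pos b k * Xmat n N pos k j else 0) m
      = (if i = b then -conv (aL n N pos (r + 1) (j + 1)) (U * astarF n N pos (r + 1) (j + 1)) m
          else 0)
        + (if i = a then conv (aL n N pos (r + 2) (j + 1)) (astarF n N pos (r + 1) (j + 1)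
          + U * astarF n N pos (r + 2) (j + 1)) m else 0)
        - (if j = b then conv (aL n N pos (i + 1) (r + 1)) (astarF n N pos (i + 1) (r + 2)) m
          else 0) := fun i j => by
    rcases lt_or_ge i j with hij | hij
    · rw [sum_lt_Ymat_mul_Xmat (by simp [hav, hbv]) hij, sub_eq_add_neg, conv_add, conv_add,
        conv_neg, ← sub_eq_add_neg]
      congr 2
      · split_ifs with h
        · rw [conv_neg, h]
        · rw [conv_zero]
      · split_ifs with h
        · rw [h]
        · rw [conv_zero]
      · split_ifs with h
        · rw [h]
        · rw [conv_zero]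
    · rw [Fin.le_def] at hij
      rw [conv_aL_eq_zero (by omega)]
      have e1 : ∀ f, i = b → conv (aL n N pos (r + 1) (j + 1)) f m = 0 := fun f h =>
        conv_aL_eq_zero (by rw [h] at hij; omega) f m
      have e2 : ∀ f, i = a → conv (aL n N pos (r + 2) (j + 1)) f m = 0 := fun f h =>
        conv_aL_eq_zero (by rw [h] at hij; omega) f m
      have e3 : ∀ f, j = b → conv (aL n N pos (i + 1) (r + 1)) f m = 0 := fun f h =>
        conv_aL_eq_zero (by rw [h] at hij; omega) f m
      rw [ite_eq_right_iff.2 fun h => by rw [e1 _ h, neg_zero], ite_eq_right_iff.2 (e2 _),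
        ite_eq_right_iff.2 (e3 _), add_zero, sub_zero]
  have h2 : ∑ i : Fin (n + 1), conv (PhiP n N pos kappa lam i)
      (Xmat n N pos i a * Ymat n N pos b i) m = -conv (PhiL n N pos kappa lam (r + 1)) U m := by
    rw [← Finset.sum_subset (Finset.subset_univ {b, a}), Finset.sum_pair hba.ne, Ymat_self,
      Xmat_self, Ymat_succ (by simp [hav, hbv]), Xmat_of_ne hba.ne, mul_one, one_mul, conv_neg,
      conv_PhiP, conv_PhiP, hav, hbv]
    · rw [sum_Icc_eq_add (by omega : r + 1 ≤ n), hU]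
      abel
    · intro i _ hi
      rcases lt_or_ge i b with h | h
      · rw [Ymat_eq_zero h, mul_zero, conv_zero]
      · rw [Xmat_eq_zero, zero_mul, conv_zero]
        simp only [Finset.mem_insert, Finset.mem_singleton, not_or, Fin.ext_iff, Fin.le_def,
          Fin.lt_def] at hi h ⊢
        omega
  have h3 : ∑ p, conv (scal fun l => kappa l p) (∑ c, Ymat n N pos b c
      * ⁅(degOp (degNeg p) : LoopEnd (MM N) (Fock n N pos)), Xmat n N pos c a⁆) m
      = -kDL n N pos kappa (r + 1) (r + 2) m := by
    rw [kDL, ← Finset.sum_neg_distrib]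
    refine Finset.sum_congr rfl fun p _ => ?_
    rw [← conv_neg, Finset.sum_eq_single b, Ymat_self, one_mul, lie_Xmat_of_ne _ hba.ne]
    · intro c _ hc
      rcases lt_or_ge c b with h | h
      · rw [Ymat_eq_zero h, zero_mul]
      · have : a ≤ c := by
          rw [Fin.le_def] at h ⊢
          omega
        rw [lie_Xmat_eq_zero _ this, mul_zero]
    · simp
  rw [rho_single, h2, h3]
  simp only [h1, Finset.sum_sub_distrib, Finset.sum_add_distrib]
  have e1 : ∑ i : Fin (n + 1), ∑ j : Fin (n + 1), (if i = b then
      -conv (aL n N pos (r + 1) (j + 1)) (U * astarF n N pos (r + 1) (j + 1)) m else 0)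
      = -conv (aL n N pos (r + 1) (r + 2)) (U * U) m - ∑ j ∈ Finset.Icc (r + 3) (n + 1),
        conv (aL n N pos (r + 1) j) (astarF n N pos (r + 1) j * U) m := by
    rw [Finset.sum_comm]
    simp only [Finset.sum_ite_eq', Finset.mem_univ, if_true]
    rw [sum_fin_succ (fun j => -conv (aL n N pos (r + 1) j) (U * astarF n N pos (r + 1) j) m)
      (Finset.Icc (r + 2) (n + 1)), sum_Icc_eq_add (by omega), Finset.sum_neg_distrib,
      sub_eq_add_neg]
    · simp only [hU, (astarF_commute (r + 1) (r + 2) _ _).eq]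
    · exact fun i hi => by simp at hi ⊢; omega
    · intro i hi hi'
      simp at hi hi'
      rw [conv_aL_eq_zero (by omega), neg_zero]
  have e2 : ∑ i : Fin (n + 1), ∑ j : Fin (n + 1), (if i = a then
      conv (aL n N pos (r + 2) (j + 1)) (astarF n N pos (r + 1) (j + 1)
          + U * astarF n N pos (r + 2) (j + 1)) m else 0)
      = ∑ j ∈ Finset.Icc (r + 3) (n + 1), conv (aL n N pos (r + 2) j) (astarF n N pos (r + 1) j) m
        + ∑ j ∈ Finset.Icc (r + 3) (n + 1),
          conv (aL n N pos (r + 2) j) (astarF n N pos (r + 2) j * U) m := by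
    rw [Finset.sum_comm]
    simp only [Finset.sum_ite_eq', Finset.mem_univ, if_true]
    rw [sum_fin_succ (fun j => conv (aL n N pos (r + 2) j) (astarF n N pos (r + 1) j
        + U * astarF n N pos (r + 2) j) m) (Finset.Icc (r + 3) (n + 1)), ← Finset.sum_add_distrib]
    · simp only [hU, (astarF_commute (r + 1) (r + 2) _ _).eq, conv_add]
    · exact fun i hi => by simp at hi ⊢; omega
    · intro i hi hi'
      simp at hi hi'
      rw [conv_aL_eq_zero (by omega)]
  have e3 : ∑ i : Fin (n + 1), ∑ j : Fin (n + 1), (if j = b then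
      conv (aL n N pos (i + 1) (r + 1)) (astarF n N pos (i + 1) (r + 2)) m else 0)
      = ∑ j ∈ Finset.Ico 1 (r + 1),
        conv (aL n N pos j (r + 1)) (astarF n N pos j (r + 2)) m := by
    simp only [Finset.sum_ite_eq', Finset.mem_univ, if_true]
    rw [sum_fin_succ (fun i => conv (aL n N pos i (r + 1)) (astarF n N pos i (r + 2)) m)
      (Finset.Ico 1 (r + 1))]
    · exact fun i hi => by simp at hi ⊢; omega
    · intro i hi hi'
      simp at hi hi'
      rw [conv_aL_eq_zero (by omega)]
  rw [e1, e2, e3, rhoEn_eq, Finset.sum_sub_distrib, ← LinearMap.coe_neg]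
  congr 1
  abel

end SimpleRoots

section Paths

lemma ql_insert {s : Finset ℕ} {j : ℕ} (h : ∀ x ∈ s, x < j) : ql (insert j s) = ql s ++ [j] := by
  have hj : j ∉ s := fun hj => lt_irrefl j (h j hj)
  have h1 : (s.sort (· ≤ ·) ++ [j]).toFinset = insert j s := by
    ext x
    simp
  rw [ql, ql, ← h1, (List.toFinset_sort (· ≤ ·) ?_).2 ?_]
  · rfl
  · rw [List.nodup_append]
    refine ⟨Finset.sort_nodup _ _, List.nodup_singleton j, ?_⟩
    rintro a ha b hb rfl
    rw [List.mem_singleton] at hb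
    exact hj (hb ▸ (Finset.mem_sort _).1 ha)
  · rw [List.pairwise_append]
    refine ⟨Finset.pairwise_sort _ _, List.pairwise_singleton _ _, fun a ha b hb => ?_⟩
    rw [List.mem_singleton] at hb
    exact hb ▸ (h a ((Finset.mem_sort _).1 ha)).le

lemma qend_insert {s : Finset ℕ} {j : ℕ} (h : ∀ x ∈ s, x < j) : qend (insert j s) = j := by
  simp [qend, ql_insert h]

lemma qpen_insert {s : Finset ℕ} {j : ℕ} (h : ∀ x ∈ s, x < j) : qpen (insert j s) = qend s := by
  simp [qpen, qend, ql_insert h]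

lemma qend_empty : qend ∅ = 1 := by simp [qend, ql]

lemma qpairs_concat {l : List ℕ} (hl : l ≠ []) (k : ℕ) :
    qpairs (l ++ [k]) = qpairs l ++ [(l.getLast?.getD 0, k)] := by
  induction l with
  | nil => exact absurd rfl hl
  | cons a l ih =>
    cases l with
    | nil => rfl
    | cons b l =>
      have := ih (List.cons_ne_nil _ _)
      simp only [qpairs, List.cons_append, List.tail_cons, List.zip_cons_cons,
        List.getLast?_cons_cons] at this ⊢
      rw [this]

lemma Icc_two_succ {k : ℕ} (hk : 1 ≤ k) :
    Finset.Icc 2 (k + 1) = insert (k + 1) (Finset.Icc 2 k) := by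
  ext x
  simp
  omega

lemma lt_of_mem_powerset_Icc {s : Finset ℕ} {k : ℕ} (hs : s ∈ (Finset.Icc 2 k).powerset) :
    ∀ x ∈ s, x < k + 1 := fun x hx => by
  have := Finset.mem_Icc.1 (Finset.mem_powerset.1 hs hx)
  omega

lemma sum_powerset_Icc_succ {M : Type*} [AddCommMonoid M] {k : ℕ} (hk : 1 ≤ k)
    (f : Finset ℕ → M) :
    ∑ s ∈ (Finset.Icc 2 (k + 1)).powerset, f s
      = ∑ s ∈ (Finset.Icc 2 k).powerset, f s
        + ∑ s ∈ (Finset.Icc 2 k).powerset, f (insert (k + 1) s) := by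
  rw [Icc_two_succ hk, Finset.sum_powerset_insert (by simp)]

lemma qend_mem {k : ℕ} (hk : 1 ≤ k) :
    ∀ s ∈ (Finset.Icc 2 k).powerset, 1 ≤ qend s ∧ qend s ≤ k := by
  induction k, hk using Nat.le_induction with
  | base => simp [qend_empty]
  | succ k hk ih =>
    intro s hs
    rw [Icc_two_succ hk, Finset.powerset_insert, Finset.mem_union, Finset.mem_image] at hs
    rcases hs with hs | ⟨t, ht, rfl⟩
    · have := ih s hs
      omega
    · rw [qend_insert (lt_of_mem_powerset_Icc ht)]
      omega

lemma sum_powerset_qend_eq_one {M : Type*} [AddCommMonoid M] {k : ℕ} (hk : 1 ≤ k)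
    (f : Finset ℕ → M) :
    (∑ s ∈ (Finset.Icc 2 k).powerset, if qend s = 1 then f s else 0) = f ∅ := by
  induction k, hk using Nat.le_induction with
  | base => simp [qend_empty]
  | succ k hk ih =>
    rw [sum_powerset_Icc_succ hk, ih, Finset.sum_eq_zero, add_zero]
    intro s hs
    rw [qend_insert (lt_of_mem_powerset_Icc hs), if_neg (by omega)]

lemma sum_powerset_qend_eq_succ {M : Type*} [AddCommMonoid M] {j k : ℕ} (hj : 1 ≤ j)
    (hk : j + 1 ≤ k) (f : Finset ℕ → M) :
    (∑ s ∈ (Finset.Icc 2 k).powerset, if qend s = j + 1 then f s else 0)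
      = ∑ s ∈ (Finset.Icc 2 j).powerset, f (insert (j + 1) s) := by
  induction k, hk using Nat.le_induction with
  | base =>
    rw [sum_powerset_Icc_succ hj, Finset.sum_eq_zero, zero_add]
    · refine Finset.sum_congr rfl fun s hs => ?_
      rw [qend_insert (lt_of_mem_powerset_Icc hs), if_pos rfl]
    · intro s hs
      have := qend_mem hj s hs
      rw [if_neg (by omega)]
  | succ k hk ih =>
    rw [sum_powerset_Icc_succ (by omega), ih, Finset.sum_eq_zero (s := (Finset.Icc 2 k).powerset),
      add_zero]
    intro s hs
    rw [qend_insert (lt_of_mem_powerset_Icc hs), if_neg (by omega)]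

lemma sum_powerset_eq_sum_qend {M : Type*} [AddCommMonoid M] {n k : ℕ} (hk : 1 ≤ k)
    (hkn : k ≤ n + 1) (f : Finset ℕ → M) :
    ∑ s ∈ (Finset.Icc 2 k).powerset, f s
      = ∑ d : Fin (n + 1), ∑ s ∈ (Finset.Icc 2 k).powerset,
        if qend s = (d : ℕ) + 1 then f s else 0 := by
  rw [Finset.sum_comm]
  refine Finset.sum_congr rfl fun s hs => ?_
  have := qend_mem hk s hs
  rw [Finset.sum_eq_single (⟨qend s - 1, by omega⟩ : Fin (n + 1)), if_pos (by simp; omega)]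
  · intro d _ hd
    refine if_neg fun h => hd ?_
    ext
    simp [h]
  · simp

variable {n N : ℕ} {pos : MM N → Prop}

variable (n N pos) in
/-- The product of the fields `a*` along the sequence encoded by `s`. -/
def pathProd (s : Finset ℕ) : LoopEnd (MM N) (Fock n N pos) :=
  ((qpairs (ql s)).map fun p => astarF n N pos p.1 p.2).prod

lemma prod_map_qpairs_concat (s : Finset ℕ) (j : ℕ) :
    ((qpairs (ql s ++ [j])).map fun p => astarF n N pos p.1 p.2).prod
      = pathProd n N pos s * astarF n N pos (qend s) j := by
  rw [qpairs_concat (by simp [ql]), List.map_append, List.prod_append, pathProd, List.map_singleton,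
    List.prod_singleton]
  rfl

lemma pathProd_insert {s : Finset ℕ} {j : ℕ} (h : ∀ x ∈ s, x < j) :
    pathProd n N pos (insert j s) = pathProd n N pos s * astarF n N pos (qend s) j := by
  rw [pathProd, ql_insert h, prod_map_qpairs_concat]

lemma sum_pathProd_eq_Ymat (c : Fin (n + 1)) {k : ℕ} (hk : (c : ℕ) + 1 ≤ k) :
    (∑ s ∈ (Finset.Icc 2 k).powerset, if qend s = (c : ℕ) + 1 then pathProd n N pos s else 0)
      = Ymat n N pos 0 c := by
  obtain ⟨c, hc⟩ := c
  induction c using Nat.strong_induction_on generalizing k with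
  | _ c ih =>
    rcases Nat.eq_zero_or_pos c with rfl | h
    · rw [sum_powerset_qend_eq_one (by omega)]
      have : pathProd n N pos ∅ = 1 := by simp [pathProd, ql, qpairs]
      rw [this]
      exact (Ymat_self 0).symm
    · simp only at hk ⊢
      rw [sum_powerset_qend_eq_succ h hk, Ymat_apply, Matrix.one_apply_ne (by
        rw [ne_eq, Fin.ext_iff]
        exact h.ne), zero_add, sum_powerset_eq_sum_qend h hc.le]
      refine Finset.sum_congr rfl fun d _ => ?_
      rcases lt_or_ge (d : ℕ) c with hd | hd
      · rw [← ih d hd d.2 (k := c) hd, Finset.sum_mul]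
        refine Finset.sum_congr rfl fun s hs => ?_
        split_ifs with h'
        · rw [pathProd_insert (lt_of_mem_powerset_Icc hs), h', Umat_apply]
        · rw [zero_mul]
      · rw [Umat_eq_zero n N pos (by rwa [Fin.le_def]), mul_zero]
        refine Finset.sum_eq_zero fun s hs => ?_
        have := qend_mem h s hs
        rw [if_neg (by omega)]

lemma sum_pathProd_qpen (i j : Fin (n + 1)) (hij : i < j) :
    (∑ s ∈ (Finset.Icc 2 (n + 1)).powerset,
        if qend s = (j : ℕ) + 1 then if qpen s ≤ (i : ℕ) + 1 then pathProd n N pos s else 0 else 0)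
      = ∑ d, if d ≤ i then Ymat n N pos 0 d * Umat n N pos d j else 0 := by
  rw [Fin.lt_def] at hij
  have hj := j.2
  rw [sum_powerset_qend_eq_succ (by omega) (by omega),
    sum_powerset_eq_sum_qend (by omega : 1 ≤ (j : ℕ)) hj.le]
  refine Finset.sum_congr rfl fun d _ => ?_
  split_ifs with hd
  · rw [Fin.le_def] at hd
    rw [← sum_pathProd_eq_Ymat d (by omega : (d : ℕ) + 1 ≤ j), Finset.sum_mul]
    refine Finset.sum_congr rfl fun s hs => ?_
    have hs' := lt_of_mem_powerset_Icc hs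
    rw [qpen_insert hs']
    split_ifs with h1 h2
    · rw [pathProd_insert hs', h1, Umat_apply]
    · omega
    · rw [zero_mul]
  · rw [Fin.le_def] at hd
    refine Finset.sum_eq_zero fun s hs => ?_
    rw [qpen_insert (lt_of_mem_powerset_Icc hs)]
    split_ifs
    · omega
    · rfl
    · rfl

lemma sum_pathProd_qend_le (r j : ℕ) :
    (∑ s ∈ (Finset.Icc 2 (n + 1)).powerset,
        if qend s ≤ r then pathProd n N pos s * astarF n N pos (qend s) j else 0)
      = ∑ d : Fin (n + 1), if (d : ℕ) + 1 ≤ r then Ymat n N pos 0 d * astarF n N pos (d + 1) j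
        else 0 := by
  rw [sum_powerset_eq_sum_qend (by omega) le_rfl]
  refine Finset.sum_congr rfl fun d _ => ?_
  split_ifs with hd
  · rw [← sum_pathProd_eq_Ymat d (by omega : (d : ℕ) + 1 ≤ n + 1), Finset.sum_mul]
    refine Finset.sum_congr rfl fun s hs => ?_
    split_ifs with h1 h2
    · rw [h1]
    · omega
    · rw [zero_mul]
  · refine Finset.sum_eq_zero fun s hs => ?_
    split_ifs
    · omega
    · rfl
    · rfl

end Paths

section AffineRoot

variable {n N : ℕ} {pos : MM N → Prop} {kappa : MM N → Fin (N + 1) → ℂ} {lam : ℕ → ℂ}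

lemma commute_kDL (i j : ℕ) :
    ∀ d ∈ annihilators n N pos, ∀ l, Commute d (kDL n N pos kappa i j l) := by
  rintro _ ⟨i', j', q, rfl⟩ l
  refine Commute.sum_right _ _ _ fun p _ => ?_
  rw [← mode_astarF]
  exact commute_conv (annihilators_commute n N pos)
    (fun _ _ _ => (Commute.one_right _).smul_right _) (astarF_mem n N pos i' j')
    (lie_degOp_mem (astarF_mem n N pos i j) _) q l

lemma conv_kDL (i j : ℕ) (f : LoopEnd (MM N) (Fock n N pos)) (m : MM N) :
    conv (kDL n N pos kappa i j) f m = ∑ p, conv (scal fun l => kappa l p)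
      (⁅(degOp (degNeg p) : LoopEnd (MM N) (Fock n N pos)), astarF n N pos i j⁆ * f) m := by
  have h : kDL n N pos kappa i j = fun v => ∑ p, conv (scal fun l => kappa l p)
      ⁅(degOp (degNeg p) : LoopEnd (MM N) (Fock n N pos)), astarF n N pos i j⁆ v := rfl
  rw [h, sum_conv]
  exact Finset.sum_congr rfl fun p _ => conv_conv _
    (mem_loopAlg.1 (lie_degOp_mem (astarF_mem n N pos i j) _)).1 f m

lemma map_astar_eq (l : List (ℕ × ℕ)) : (l.map fun p => astar n N pos p.1 p.2)
    = (l.map fun p => astarF n N pos p.1 p.2).map fun f m => ⇑(mode f m) := by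
  rw [List.map_map]
  exact List.map_congr_left fun p _ => astar_eq_mode n N pos p.1 p.2

lemma mem_of_mem_map_astarF (l : List (ℕ × ℕ)) :
    ∀ f ∈ l.map fun p => astarF n N pos p.1 p.2, f ∈ loopAlg (annihilators n N pos) := by
  intro f hf
  obtain ⟨p, -, rfl⟩ := List.mem_map.1 hf
  exact astarF_mem n N pos p.1 p.2

lemma fprod_aop_path (r j : ℕ) (s : Finset ℕ) (m : MM N) :
    fprod n N pos (aop n N pos r j :: ((qpairs (ql s)).map fun p => astar n N pos p.1 p.2)
        ++ [astar n N pos r (n + 1)]) m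
      = conv (aL n N pos r j) (pathProd n N pos s * astarF n N pos r (n + 1)) m := by
  have h := map_astar_eq (n := n) (N := N) (pos := pos) (qpairs (ql s) ++ [(r, n + 1)])
  rw [List.map_append, List.map_singleton] at h
  rw [List.cons_append, h, fprod, fprod_mode _ (mem_of_mem_map_astarF _), aop_eq_aL, fmul_mode,
    List.map_append, List.prod_append, List.map_singleton, List.prod_singleton, pathProd]

lemma fprod_path_Phi (r : ℕ) (s : Finset ℕ) (m : MM N) :
    fprod n N pos (((qpairs (ql s ++ [n + 1])).map fun p => astar n N pos p.1 p.2)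
        ++ [Phi n N pos kappa lam r]) m
      = conv (PhiL n N pos kappa lam r)
        (pathProd n N pos s * astarF n N pos (qend s) (n + 1)) m := by
  rw [map_astar_eq, Phi_eq_PhiL, fprod_mode_append _ _ _ (mem_of_mem_map_astarF _),
    prod_map_qpairs_concat]
  rintro _ ⟨i, j, q, rfl⟩ l
  exact astarL_commute_PhiL ..

lemma fprod_path_kD (r : ℕ) (s : Finset ℕ) (m : MM N) :
    fprod n N pos (((qpairs (ql s)).map fun p => astar n N pos p.1 p.2)
        ++ [kD n N pos kappa r (n + 1)]) m
      = conv (kDL n N pos kappa r (n + 1)) (pathProd n N pos s) m := by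
  rw [map_astar_eq, kD_eq_kDL, fprod_mode_append _ (commute_kDL _ _) _ (mem_of_mem_map_astarF _),
    pathProd]

lemma rhoF0_eq (m : MM N) :
    rhoF0 n N pos kappa lam m
      = ⇑(-(∑ r ∈ Finset.Icc 1 (n + 1), ∑ j ∈ Finset.Icc 1 (n + 1),
          conv (aL n N pos r j) (∑ s ∈ (Finset.Icc 2 (n + 1)).powerset,
            if r < j ∧ qend s = j ∧ qpen s ≤ r then
              pathProd n N pos s * astarF n N pos r (n + 1) else 0) m)
        - (∑ r ∈ Finset.Icc 1 n, conv (PhiL n N pos kappa lam r)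
          (∑ s ∈ (Finset.Icc 2 (n + 1)).powerset,
            if qend s ≤ r then pathProd n N pos s * astarF n N pos (qend s) (n + 1) else 0) m)
        - (∑ r ∈ Finset.Icc 1 n, conv (kDL n N pos kappa r (n + 1))
          (∑ s ∈ (Finset.Icc 2 (n + 1)).powerset,
            if qend s = r then pathProd n N pos s else 0) m)) := by
  have hc : ∀ (c : Prop) [Decidable c] (P : MM N → Module.End ℂ (Fock n N pos)) f,
      conv P (if c then f else 0) m = if c then conv P f m else 0 := fun c _ P f => by
    split_ifs
    · rfl
    · exact conv_zero P m
  have hw : ∀ (c : Prop) [Decidable c] (f : Module.End ℂ (Fock n N pos)) w,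
      (if c then f else 0) w = (if c then ⇑f else 0) w := fun c _ f w => by
    split_ifs <;> rfl
  rw [rhoF0]
  simp only [fprod_aop_path, fprod_path_Phi, fprod_path_kD, conv_sum, hc]
  funext w
  simp only [LinearMap.sub_apply, LinearMap.neg_apply, LinearMap.sum_apply, hw, Pi.sub_apply,
    Pi.neg_apply, Finset.sum_apply]

lemma sum_lt_Ymat_mul_Xmat_last {i j : Fin (n + 1)} (hij : i < j) :
    (∑ k, if i < k then Xmat n N pos i (Fin.last n) * Ymat n N pos 0 k * Xmat n N pos k j else 0)
      = -∑ s ∈ (Finset.Icc 2 (n + 1)).powerset,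
        if (i : ℕ) + 1 < j + 1 ∧ qend s = j + 1 ∧ qpen s ≤ i + 1 then
          pathProd n N pos s * astarF n N pos (i + 1) (n + 1) else 0 := by
  have hi : i ≠ Fin.last n := (hij.trans_le (Fin.le_last j)).ne
  have h1 : (∑ s ∈ (Finset.Icc 2 (n + 1)).powerset,
        if (i : ℕ) + 1 < j + 1 ∧ qend s = j + 1 ∧ qpen s ≤ i + 1 then
          pathProd n N pos s * astarF n N pos (i + 1) (n + 1) else 0)
      = (∑ d, if d ≤ i then Ymat n N pos 0 d * Umat n N pos d j else 0)
        * astarF n N pos (i + 1) (n + 1) := by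
    rw [← sum_pathProd_qpen i j hij, Finset.sum_mul]
    refine Finset.sum_congr rfl fun s _ => ?_
    rw [Fin.lt_def] at hij
    simp only [add_lt_add_iff_right, hij, true_and, ite_and, ite_mul, zero_mul]
  have h2 : (∑ k, if i < k then Ymat n N pos 0 k * Xmat n N pos k j else 0)
      = ∑ d, if d ≤ i then Ymat n N pos 0 d * Umat n N pos d j else 0 := by
    have h := sum_Ymat_mul_Xmat (N := N) (pos := pos) 0 j
    rw [Matrix.one_apply_ne ((Fin.zero_le i).trans_lt hij).ne] at h
    refine sub_eq_zero.1 (Eq.trans ?_ h)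
    rw [← Finset.sum_sub_distrib]
    refine Finset.sum_congr rfl fun k _ => ?_
    rcases lt_or_ge i k with hk | hk
    · rw [if_pos hk, if_neg (not_le.2 hk), sub_zero]
    · rw [if_neg (not_lt.2 hk), if_pos hk, Xmat_of_ne (hk.trans_lt hij).ne, Umat_apply]
      exact LinearMap.ext fun w => by simp
  have hm : (∑ d, if d ≤ i then Ymat n N pos 0 d * Umat n N pos d j else 0)
      ∈ loopAlg (annihilators n N pos) := by
    refine sum_mem fun d _ => ?_
    split_ifs
    · exact mul_mem (Ymat_mem n N pos 0 d) (Umat_mem n N pos d j)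
    · exact zero_mem _
  rw [h1, (loopAlg_annihilators_commute n N pos _ hm _ (astarF_mem n N pos _ _)).eq, ← h2,
    Finset.mul_sum, ← Finset.sum_neg_distrib]
  refine Finset.sum_congr rfl fun k _ => ?_
  split_ifs
  · rw [Xmat_of_ne hi, Fin.val_last, mul_assoc]
    exact LinearMap.ext fun w => by simp
  · exact LinearMap.ext fun w => by simp

lemma rhoF0_eq_rho (m : MM N) :
    rhoF0 n N pos kappa lam m = rho n N pos (Matrix.single (Fin.last n) 0 1) m kappa lam := by
  have h1 : ∑ i : Fin (n + 1), ∑ j : Fin (n + 1), conv (aL n N pos (i + 1) (j + 1))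
        (∑ k, if i < k then Xmat n N pos i (Fin.last n) * Ymat n N pos 0 k * Xmat n N pos k j
          else 0) m
      = -∑ r ∈ Finset.Icc 1 (n + 1), ∑ j ∈ Finset.Icc 1 (n + 1),
          conv (aL n N pos r j) (∑ s ∈ (Finset.Icc 2 (n + 1)).powerset,
            if r < j ∧ qend s = j ∧ qpen s ≤ r then
              pathProd n N pos s * astarF n N pos r (n + 1) else 0) m := by
    rw [← sum_fin_succ _ _ subset_rfl fun i hi hi' => absurd hi hi', ← Finset.sum_neg_distrib]
    refine Finset.sum_congr rfl fun i _ => ?_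
    rw [← sum_fin_succ _ _ subset_rfl fun i hi hi' => absurd hi hi', ← Finset.sum_neg_distrib]
    refine Finset.sum_congr rfl fun j _ => ?_
    rcases lt_or_ge i j with hij | hij
    · rw [sum_lt_Ymat_mul_Xmat_last hij, conv_neg]
    · rw [Fin.le_def] at hij
      rw [conv_aL_eq_zero (by omega), conv_aL_eq_zero (by omega), neg_zero]
  have h2 : ∑ i : Fin (n + 1), conv (PhiP n N pos kappa lam i)
        (Xmat n N pos i (Fin.last n) * Ymat n N pos 0 i) m
      = -∑ r ∈ Finset.Icc 1 n, conv (PhiL n N pos kappa lam r)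
          (∑ s ∈ (Finset.Icc 2 (n + 1)).powerset,
            if qend s ≤ r then pathProd n N pos s * astarF n N pos (qend s) (n + 1) else 0) m := by
    have h : ∀ i : Fin (n + 1), conv (PhiP n N pos kappa lam i)
        (Xmat n N pos i (Fin.last n) * Ymat n N pos 0 i) m
        = -∑ r ∈ Finset.Icc 1 n, conv (PhiL n N pos kappa lam r)
          (if (i : ℕ) + 1 ≤ r then Ymat n N pos 0 i * astarF n N pos (i + 1) (n + 1) else 0) m := by
      intro i
      rw [conv_PhiP, ← Finset.sum_neg_distrib, ← Finset.sum_subset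
        (Finset.Icc_subset_Icc_left (by omega : 1 ≤ (i : ℕ) + 1))]
      · refine Finset.sum_congr rfl fun r hr => ?_
        rw [Finset.mem_Icc] at hr
        have hi : i ≠ Fin.last n := fun h => by
          rw [h, Fin.val_last] at hr
          omega
        rw [if_pos hr.1, Xmat_of_ne hi, Fin.val_last, ← conv_neg,
          (loopAlg_annihilators_commute n N pos _ (Ymat_mem n N pos 0 i) _
            (astarF_mem n N pos _ _)).eq]
        congr 1
      · intro r hr hr'
        rw [Finset.mem_Icc] at hr hr'
        rw [if_neg (by omega), conv_zero, neg_zero]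
    simp only [h, sum_pathProd_qend_le]
    rw [Finset.sum_neg_distrib, Finset.sum_comm]
    simp only [conv_sum]
  have h3 : ∑ p, conv (scal fun l => kappa l p) (∑ c, Ymat n N pos 0 c
        * ⁅(degOp (degNeg p) : LoopEnd (MM N) (Fock n N pos)), Xmat n N pos c (Fin.last n)⁆) m
      = -∑ r ∈ Finset.Icc 1 n, conv (kDL n N pos kappa r (n + 1))
          (∑ s ∈ (Finset.Icc 2 (n + 1)).powerset,
            if qend s = r then pathProd n N pos s else 0) m := by
    have hl : ∀ D : LoopEnd (MM N) (Fock n N pos), ∀ i, ¬ i < n + 1 →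
        ⁅D, astarF n N pos i (n + 1)⁆ = 0 := fun D i hi => by
      rw [astarF_eq_zero n N pos (by omega), Ring.lie_def, mul_zero, zero_mul, sub_zero]
    rw [← sum_fin_succ (n := n) _ _ (Finset.Icc_subset_Icc_right (by omega))]
    · simp only [conv_sum]
      rw [Finset.sum_comm, ← Finset.sum_neg_distrib]
      refine Finset.sum_congr rfl fun c _ => ?_
      rw [← conv_sum, sum_pathProd_eq_Ymat c (by omega), conv_kDL, ← Finset.sum_neg_distrib]
      refine Finset.sum_congr rfl fun p _ => ?_
      rw [← conv_neg, (loopAlg_annihilators_commute n N pos _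
        (lie_degOp_mem (astarF_mem n N pos _ _) _) _ (Ymat_mem n N pos 0 c)).eq]
      congr 1
      rcases eq_or_ne c (Fin.last n) with rfl | hc
      · rw [lie_Xmat_self, Fin.val_last, hl _ _ (lt_irrefl _)]
        exact LinearMap.ext fun w => by simp
      · rw [lie_Xmat_of_ne _ hc, Fin.val_last]
        exact LinearMap.ext fun w => by simp
    · intro i hi hi'
      rw [Finset.mem_Icc] at hi hi'
      rw [conv_kDL]
      refine Finset.sum_eq_zero fun p _ => ?_
      rw [hl _ _ (by omega), zero_mul, conv_zero]
  rw [rhoF0_eq, rho_single, h1, h2, h3]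
  congr 1
  abel

end AffineRoot

section Serre

variable {n N : ℕ} {pos : MM N → Prop} {kappa : MM N → Fin (N + 1) → ℂ} {lam : ℕ → ℂ}

lemma rho_zero (m : MM N) : rho n N pos 0 m kappa lam = 0 := by
  have h0 : (cmat 0 : Matrix (Fin (n + 1)) (Fin (n + 1)) (LoopEnd (MM N) (Fock n N pos))) = 0 := by
    ext1 i j
    exact map_zero (algebraMap ℂ (LoopEnd (MM N) (Fock n N pos)))
  have hP : Pmat n N pos 0 m = 0 := by rw [Pmat, h0, mul_zero, zero_mul, mul_zero]
  have hH : ∀ p, Hmat n N pos 0 m p = 0 := fun p => by rw [Hmat, h0, zero_mul, zero_mul, mul_zero]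
  have hu : up (0 : Matrix (Fin (n + 1)) (Fin (n + 1)) (LoopEnd (MM N) (Fock n N pos))) = 0 := by
    ext1 i j
    rw [up_apply]
    exact ite_self _
  have hc : ∀ a, currentCoef n N pos 0 m a = 0 := by
    rintro (i | p)
    · exact congrFun (congrFun hP i) i
    · exact (congrArg Matrix.trace (hH p)).trans (Matrix.trace_zero _ _)
  refine LinearMap.ext fun w => ?_
  simp [rho, creationPart, currentPart, hP, hu, hc]

lemma comm_coe {V : Type*} [AddCommGroup V] [Module ℂ V] (f g : Module.End ℂ V) :
    comm ⇑f ⇑g = ⇑(f * g - g * f) := rfl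

lemma comm_neg_neg {V : Type*} [AddCommGroup V] [Module ℂ V] (f g : Module.End ℂ V) :
    comm (-⇑f) (-⇑g) = comm ⇑f ⇑g := by
  funext w
  simp [comm]

lemma comm_neg_left {V : Type*} [AddCommGroup V] [Module ℂ V] (f g : Module.End ℂ V) :
    comm (-⇑f) ⇑g = -comm ⇑f ⇑g := by
  funext w
  simp [comm]
  abel

lemma rho_serre
    (htri : ∀ a : MM N, pos a ∨ a = 0 ∨ pos (-a))
    (hdisj : ∀ a : MM N, pos a → ¬ pos (-a))
    (hE1 : ∀ m : MM N, ∑ p : Fin (N + 1), (m p : ℂ) * kappa m p = 0)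
    (hE2 : ∀ m k : MM N, pos m → pos k →
      ∑ p : Fin (N + 1), (m p : ℂ) * kappa (-m - k) p = 0)
    {a b c d : Fin (n + 1)} (hab : a ≠ b) (hcd : c ≠ d) (h : ¬ (b = c ∧ d = a)) (k m l : MM N) :
    comm ⇑(rho n N pos (Matrix.single a b 1) k kappa lam)
      (comm ⇑(rho n N pos (Matrix.single a b 1) m kappa lam)
        ⇑(rho n N pos (Matrix.single c d 1) l kappa lam)) = 0 := by
  set A : Matrix (Fin (n + 1)) (Fin (n + 1)) ℂ := Matrix.single a b 1 with hA
  set B : Matrix (Fin (n + 1)) (Fin (n + 1)) ℂ := Matrix.single c d 1 with hB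
  have hAA : A * A = 0 := Matrix.single_mul_single_of_ne _ _ _ _ hab.symm _
  have hABA : A * B * A = 0 := by
    rcases not_and_or.1 h with h | h
    · rw [hA, hB, Matrix.single_mul_single_of_ne _ _ _ _ h, zero_mul]
    · rw [mul_assoc, hA, hB, Matrix.single_mul_single_of_ne _ _ _ _ h, mul_zero]
  have htA : A.trace = 0 := Matrix.trace_single_eq_of_ne _ _ _ hab
  have htB : B.trace = 0 := Matrix.trace_single_eq_of_ne _ _ _ hcd
  have htAB : (A * B).trace = 0 := by
    by_cases hbc : b = c
    · rw [hA, hB, hbc, Matrix.single_mul_single_same]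
      exact Matrix.trace_single_eq_of_ne _ _ _ fun hd => h ⟨hbc, hd.symm⟩
    · rw [hA, hB, Matrix.single_mul_single_of_ne _ _ _ _ hbc, Matrix.trace_zero]
  have htC : (B * A - A * B).trace = 0 := by
    rw [Matrix.trace_sub, Matrix.trace_mul_comm, sub_self]
  have hAC : A * (B * A - A * B) = 0 := by
    rw [mul_sub, ← mul_assoc, ← mul_assoc, hABA, hAA, zero_mul, sub_zero]
  have hCA : (B * A - A * B) * A = 0 := by
    rw [sub_mul, hABA, mul_assoc, hAA, mul_zero, sub_zero]
  rw [comm_coe, rho_commutator _ _ _ _ htri hdisj hE1 hE2 htA htB htAB, comm_coe,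
    rho_commutator _ _ _ _ htri hdisj hE1 hE2 htA htC (by rw [hAC, Matrix.trace_zero]), hAC, hCA,
    sub_zero, rho_zero]
  rfl

lemma rhoFa_eq_rho (r : Fin (n + 1)) (m : MM N) :
    rhoFa n N pos kappa lam r m = rho n N pos (Matrix.single (r - 1) r 1) m kappa lam := by
  induction r using Fin.cases with
  | zero =>
    have h : (0 : Fin (n + 1)) - 1 = Fin.last n := by
      ext
      simp
    rw [h, ← rhoF0_eq_rho]
    rfl
  | succ i =>
    have h : i.succ - 1 = (⟨i, by omega⟩ : Fin (n + 1)) := by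
      ext
      simp [Fin.coe_sub_one, Fin.succ_ne_zero]
    rw [h]
    exact rhoF_eq_rho (by omega) m

lemma rhoE_eq_rho (hn : 0 < n) (r : Fin (n + 1)) (m : MM N) :
    rhoE n N pos kappa lam r m = -⇑(rho n N pos (Matrix.single r (r - 1) 1) m kappa lam) := by
  induction r using Fin.cases with
  | zero =>
    have h : (0 : Fin (n + 1)) - 1 = Fin.last n := by
      ext
      simp
    rw [h]
    exact rhoE_zero_eq_rho hn m
  | succ i =>
    have h : i.succ - 1 = (⟨i, by omega⟩ : Fin (n + 1)) := by
      ext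
      simp [Fin.coe_sub_one, Fin.succ_ne_zero]
    rw [h]
    exact rhoEn_eq_rho (by omega) m

lemma sub_one_ne_self (hn : 0 < n) (r : Fin (n + 1)) : r - 1 ≠ r := by
  intro h
  have := congrArg Fin.val h
  rw [Fin.coe_sub_one] at this
  split_ifs at this with h0
  · rw [h0] at this
    simp at this
    omega
  · have := Fin.pos_iff_ne_zero.2 h0
    rw [Fin.lt_def] at this
    simp at this
    omega

lemma not_sub_one_eq_and_eq (hn : 2 ≤ n) (r s : Fin (n + 1)) :
    ¬ (r = s - 1 ∧ s = r - 1) := by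
  rintro ⟨h1, h2⟩
  have h3 := congrArg Fin.val h1
  have h4 := congrArg Fin.val h2
  rw [Fin.coe_sub_one] at h3 h4
  simp only [Fin.ext_iff, Fin.val_zero] at h3 h4
  split_ifs at h3 h4 <;> omega

end Serre

/-- For all `0 ≤ r, s ≤ n` with `Â_{rs} = -1` and all `k, m, n ∈ ℤ^{N+1}`,
the Serre relations `[ρ(E_r)_k, [ρ(E_r)_m, ρ(E_s)_n]] = 0` and
`[ρ(F_r)_k, [ρ(F_r)_m, ρ(F_s)_n]] = 0` hold on `V`. -/
theorem stmt16 (n N : ℕ) (hn : 2 ≤ n) (hN : 1 ≤ N)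
    (pos : MM N → Prop)
    (hadd : ∀ a b : MM N, pos a → pos b → pos (a + b))
    (htri : ∀ a : MM N, pos a ∨ a = 0 ∨ pos (-a))
    (hzero : ¬ pos (0 : MM N))
    (hdisj : ∀ a : MM N, pos a → ¬ pos (-a))
    (kappa : MM N → Fin (N + 1) → ℂ) (lam : ℕ → ℂ)
    (hE1 : ∀ m : MM N, ∑ p : Fin (N + 1), (m p : ℂ) * kappa m p = 0)
    (hE2 : ∀ m k : MM N, pos m → pos k →
      ∑ p : Fin (N + 1), (m p : ℂ) * kappa (-m - k) p = 0) :
    ∀ r s : ℕ, r ≤ n → s ≤ n → Acar n r s = -1 → ∀ k m mm : MM N,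
      comm (rhoE n N pos kappa lam r k)
          (comm (rhoE n N pos kappa lam r m) (rhoE n N pos kappa lam s mm)) = 0
      ∧ comm (rhoFa n N pos kappa lam r k)
          (comm (rhoFa n N pos kappa lam r m) (rhoFa n N pos kappa lam s mm)) = 0 := by
  intro r s hr hs _ k m mm
  lift r to Fin (n + 1) using Nat.lt_succ_of_le hr
  lift s to Fin (n + 1) using Nat.lt_succ_of_le hs
  have hn0 : 0 < n := by omega
  simp only [rhoE_eq_rho hn0, rhoFa_eq_rho, comm_neg_neg]
  refine ⟨?_, rho_serre htri hdisj hE1 hE2 (sub_one_ne_self hn0 r) (sub_one_ne_self hn0 s)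
    (not_sub_one_eq_and_eq hn r s) k m mm⟩
  rw [comm_coe (rho _ _ _ _ m _ _), comm_neg_left, ← comm_coe,
    rho_serre htri hdisj hE1 hE2 (sub_one_ne_self hn0 r).symm (sub_one_ne_self hn0 s).symm
      fun h => not_sub_one_eq_and_eq hn r s ⟨h.2.symm, h.1.symm⟩, neg_zero]

end Stmt16
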